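/- There exist η > 0, C > 0 and X₀ > 0 such that the following holds for every integer X ≥ X₀ and every real number α. Let L = ⌊X^{θ+η}⌋ and H = ⌊10·X^{1−γ+η}/γ⌋. Then for all reals M, N, U, V ≥ 1 with M ≤ X^{15/22}, U ≤ L and V ≤ H, and all complex coefficients a_m (m ∼ M), c_l (l a nonzero integer with |l| ∼ U) and d_h (h a nonzero integer with |h| ∼ V) of modulus at most 1, one has |S₃*| ≤ C·X^{1−2η}, where S₃* = Σ_{m ∼ M} Σ_{n ∼ N, mn ∼ X} Σ_{|l| ∼ U} Σ_{|h| ∼ V} a_m·c_l·d_h·e(α·l·m·n + h·(mn)^γ), the sums running over positive integers m, n and nonzero integers l, h in the indicated ranges. -/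

import Mathlib

open Finset

noncomputable def e (z : ℝ) : ℂ := Complex.exp (2 * Real.pi * Complex.I * z)

noncomputable def nint (x : ℝ) : ℝ := |x - round x|

noncomputable def dyN (Y : ℝ) : Finset ℕ :=
  (Finset.range (⌈Y⌉₊ + 1)).filter fun m => Y/2 ≤ (m:ℝ) ∧ (m:ℝ) < Y

noncomputable def dyZ (Y : ℝ) : Finset ℤ :=
  (Finset.Icc (-(⌈Y⌉₊:ℤ)) (⌈Y⌉₊:ℤ)).filter fun l => l ≠ 0 ∧ Y/2 ≤ |(l:ℝ)| ∧ |(l:ℝ)| < Y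

lemma e_add (x y : ℝ) : e (x + y) = e x * e y := by
  simp only [e, ← Complex.exp_add]
  congr 1
  push_cast
  ring

lemma norm_e (x : ℝ) : ‖e x‖ = 1 := by
  rw [e, show 2 * (Real.pi : ℂ) * Complex.I * x = ((2 * Real.pi * x : ℝ) : ℂ) * Complex.I by
    push_cast; ring]
  exact Complex.norm_exp_ofReal_mul_I _

lemma e_intCast (n : ℤ) : e (n : ℝ) = 1 := by
  rw [e, Complex.exp_eq_one_iff]
  exact ⟨n, by push_cast; ring⟩

lemma conj_e (x : ℝ) : (starRingEnd ℂ) (e x) = e (-x) := by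
  simp only [e, ← Complex.exp_conj]
  congr 1
  simp [Complex.conj_ofNat]

lemma e_eq_cos_add_sin (x : ℝ) :
    e x = Real.cos (2 * (Real.pi * x)) + Real.sin (2 * (Real.pi * x)) * Complex.I := by
  rw [e, show 2 * (Real.pi : ℂ) * Complex.I * x = ((2 * (Real.pi * x) : ℝ) : ℂ) * Complex.I by
    push_cast; ring, Complex.exp_mul_I]
  push_cast
  rfl

lemma e_sub_intCast (x : ℝ) (n : ℤ) : e (x - n) = e x := by
  have h := e_add (x - n) n
  rw [e_intCast, sub_add_cancel, mul_one] at h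
  exact h.symm

/-- Summation by parts. -/
lemma sum_mul_eq_sub_sum_partial (c z : ℕ → ℂ) {a b : ℕ} (hab : a ≤ b) :
    ∑ n ∈ Ico a (b + 1), c n * z n = c b * ∑ n ∈ Ico a (b + 1), z n -
      ∑ n ∈ Ico a b, (c (n + 1) - c n) * ∑ k ∈ Ico a (n + 1), z k := by
  induction b, hab using Nat.le_induction with
  | base => simp
  | succ b hab ih =>
    rw [Finset.sum_Ico_succ_top (by omega), ih, Finset.sum_Ico_succ_top hab
      (fun n => (c (n + 1) - c n) * ∑ k ∈ Ico a (n + 1), z k),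
      Finset.sum_Ico_succ_top (by omega : a ≤ b + 1) z]
    ring

lemma norm_sum_mul_le_of_partial {c z : ℕ → ℂ} {a b : ℕ} (hab : a ≤ b) {B : ℝ}
    (hB : ∀ k, k ≤ b + 1 → ‖∑ n ∈ Ico a k, z n‖ ≤ B) :
    ‖∑ n ∈ Ico a (b + 1), c n * z n‖ ≤ B * (‖c b‖ + ∑ n ∈ Ico a b, ‖c (n + 1) - c n‖) := by
  rw [sum_mul_eq_sub_sum_partial c z hab]
  refine (norm_sub_le _ _).trans ?_
  rw [mul_add, Finset.mul_sum _ _ B, norm_mul (c b), mul_comm ‖c b‖]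
  refine add_le_add (mul_le_mul_of_nonneg_right (hB _ le_rfl) (norm_nonneg _))
    ((norm_sum_le _ _).trans (Finset.sum_le_sum fun n hn => ?_))
  rw [norm_mul, mul_comm]
  rw [mem_Ico] at hn
  exact mul_le_mul_of_nonneg_right (hB _ (by omega)) (norm_nonneg _)

lemma two_mul_le_sin_pi_mul {x ρ : ℝ} (hρ : 0 < ρ) (h1 : ρ ≤ x) (h2 : x ≤ 1 - ρ) :
    2 * ρ ≤ Real.sin (Real.pi * x) := by
  have hpi := Real.pi_pos
  have key : ∀ y : ℝ, ρ ≤ y → y ≤ 1 / 2 → 2 * ρ ≤ Real.sin (Real.pi * y) := by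
    intro y hy1 hy2
    have := Real.mul_le_sin (x := Real.pi * y) (by nlinarith) (by nlinarith)
    have h3 : 2 / Real.pi * (Real.pi * y) = 2 * y := by field_simp
    linarith
  rcases le_total x (1 / 2) with h | h
  · exact key x h1 h
  · have := key (1 - x) (by linarith) (by linarith)
    rwa [show Real.pi * (1 - x) = Real.pi - Real.pi * x by ring, Real.sin_pi_sub] at this

/-- The Kusmin–Landau inequality, in terms of the first differences of the phase. -/
lemma kusmin_landau {f : ℕ → ℝ} {a b : ℕ} {ρ : ℝ} (ν : ℤ) (hρ : 0 < ρ)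
    (hmono : ∀ n, a ≤ n → n + 1 < b → f (n + 1) - f n ≤ f (n + 2) - f (n + 1))
    (hlo : ∀ n ∈ Ico a b, ν + ρ ≤ f (n + 1) - f n)
    (hhi : ∀ n ∈ Ico a b, f (n + 1) - f n ≤ ν + 1 - ρ) :
    ‖∑ n ∈ Ico a b, e (f n)‖ ≤ 2 / ρ := by
  rcases Nat.lt_or_ge a b with hab | hab
  swap
  · rw [Finset.Ico_eq_empty (by omega)]
    simp; positivity
  obtain ⟨b, rfl⟩ : ∃ b', b = b' + 1 := ⟨b - 1, by omega⟩
  have hab' : a ≤ b := by omega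
  set x : ℕ → ℝ := fun n => f (n + 1) - f n - ν with hx
  have hx1 : ∀ n ∈ Ico a (b + 1),
    ρ ≤ x n := fun n hn => by have := hlo n hn; simp only [hx]; linarith
  have hx2 : ∀ n ∈ Ico a (b + 1), x n ≤ 1 - ρ := fun n hn => by
    have := hhi n hn; simp only [hx]; linarith
  have hsin : ∀ n ∈ Ico a (b + 1), 2 * ρ ≤ Real.sin (Real.pi * x n) := fun n hn =>
    two_mul_le_sin_pi_mul hρ (hx1 n hn) (hx2 n hn)
  have hρ2 : ρ ≤ 1 / 2 := by
    have := hx1 a (by simp; omega)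
    have := hx2 a (by simp; omega)
    linarith
  set k : ℕ → ℝ := fun n => Real.cos (Real.pi * x n) / Real.sin (Real.pi * x n) with hk
  set c : ℕ → ℂ := fun n => 1 / 2 + Complex.I / 2 * (k n : ℂ) with hc
  have hkb : ∀ n ∈ Ico a (b + 1), |k n| ≤ 1 / (2 * ρ) := by
    intro n hn
    have h := hsin n hn
    rw [hk, abs_div, abs_of_pos (a := Real.sin _) (by linarith)]
    exact div_le_div₀ zero_le_one (Real.abs_cos_le_one _) (by positivity) h
  have hterm : ∀ n ∈ Ico a (b + 1), e (f n) = c n * (e (f n) - e (f (n + 1))) := by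
    intro n hn
    have h := hsin n hn
    have hs : ((Real.sin (Real.pi * x n) : ℝ) : ℂ) ≠ 0 := by
      exact_mod_cast (by linarith : (0:ℝ) < Real.sin (Real.pi * x n)).ne'
    have h1 : e (f (n + 1)) = e (f n) * e (x n) := by
      rw [hx]
      simp only
      rw [e_sub_intCast, ← e_add]
      congr 1; ring
    rw [h1, e_eq_cos_add_sin (x n), Real.cos_two_mul, Real.sin_two_mul, hc, hk]
    push_cast at hs ⊢
    set S := Complex.sin (Real.pi * x n)
    set K := Complex.cos (Real.pi * x n)
    have hSK : S ^ 2 + K ^ 2 = 1 := Complex.sin_sq_add_cos_sq _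
    field_simp
    linear_combination (2 * K * Complex.I * e (f n)) * hSK +
      (2 * S * K ^ 2 * e (f n)) * Complex.I_sq
  rw [Finset.sum_congr rfl hterm]
  have hpart : ∀ m, m ≤ b + 1 → ‖∑ n ∈ Ico a m, (e (f n) - e (f (n + 1)))‖ ≤ 2 := by
    intro m _
    rcases Nat.lt_or_ge m a with h | h
    · rw [Finset.Ico_eq_empty (by omega)]; simp
    · have : ∑ n ∈ Ico a m, (e (f n) - e (f (n + 1))) = -(e (f m) - e (f a)) := by
        rw [← Finset.sum_Ico_sub (fun n => e (f n)) h, ← Finset.sum_neg_distrib]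
        exact Finset.sum_congr rfl fun _ _ => by ring
      rw [this, norm_neg]
      refine (norm_sub_le _ _).trans ?_
      rw [norm_e, norm_e]; norm_num
  refine (norm_sum_mul_le_of_partial hab' hpart).trans ?_
  have hanti : ∀ n ∈ Ico a b, k (n + 1) ≤ k n := by
    intro n hn
    rw [mem_Ico] at hn
    have m1 : n ∈ Ico a (b + 1) := by simp; omega
    have m2 : n + 1 ∈ Ico a (b + 1) := by simp; omega
    have h1 := hsin n m1
    have h2 := hsin _ m2
    have hm : x n ≤ x (n + 1) := by
      have := hmono n hn.1 (by omega)
      simp only [hx]; linarith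
    rw [hk]
    simp only
    rw [div_le_div_iff₀ (by linarith) (by linarith), ← sub_nonneg]
    have : Real.cos (Real.pi * x n) * Real.sin (Real.pi * x (n + 1)) -
        Real.cos (Real.pi * x (n + 1)) * Real.sin (Real.pi * x n) =
        Real.sin (Real.pi * x (n + 1) - Real.pi * x n) := by
      rw [Real.sin_sub]; ring
    rw [this]
    have := hx1 n m1
    have := hx2 _ m2
    have := Real.pi_pos
    apply Real.sin_nonneg_of_nonneg_of_le_pi <;> nlinarith
  have hcb : ‖c b‖ ≤ 1 / 2 + 1 / (4 * ρ) := by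
    have := hkb b (by simp; omega)
    refine (norm_add_le _ _).trans ?_
    rw [norm_mul, Complex.norm_real, Real.norm_eq_abs]
    simp only [norm_div, Complex.norm_I, norm_one, Complex.norm_ofNat]
    have h4 : 1 / (4 * ρ) = 1 / 2 * (1 / (2 * ρ)) := by field_simp; norm_num
    rw [h4]; gcongr
  have hvar : ∑ n ∈ Ico a b, ‖c (n + 1) - c n‖ ≤ 1 / (2 * ρ) := by
    have h1 : ∀ n ∈ Ico a b, ‖c (n + 1) - c n‖ = -(k (n + 1) / 2 - k n / 2) := by
      intro n hn
      have : c (n + 1) - c n = Complex.I / 2 * ((k (n + 1) - k n : ℝ) : ℂ) := by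
        simp only [hc]; push_cast; ring
      rw [this, norm_mul, Complex.norm_real, Real.norm_eq_abs,
        abs_of_nonpos (by linarith [hanti n hn])]
      simp only [norm_div, Complex.norm_I, Complex.norm_ofNat]
      ring
    rw [Finset.sum_congr rfl h1, Finset.sum_neg_distrib,
      Finset.sum_Ico_sub (fun n => k n / 2) hab']
    have h2 := abs_le.1 (hkb a (by simp; omega))
    have h3 := abs_le.1 (hkb b (by simp; omega))
    linarith
  have h5 : 1 / (4 * ρ) = 1 / 2 * (1 / (2 * ρ)) := by field_simp; norm_num
  have h6 : 1 ≤ 1 / (2 * ρ) := by rw [le_div_iff₀ (by positivity)]; linarith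
  have h7 : 2 / ρ = 4 * (1 / (2 * ρ)) := by field_simp; norm_num
  rw [h7]
  nlinarith

lemma card_le_of_separated {ι : Type*} (S : Finset ι) (f : ι → ℝ) {s A ℓ : ℝ} (hs : 0 < s)
    (hℓ : 0 ≤ ℓ) (hlo : ∀ i ∈ S, A ≤ f i) (hhi : ∀ i ∈ S, f i ≤ A + ℓ)
    (hsep : ∀ i ∈ S, ∀ j ∈ S, i ≠ j → s ≤ |f i - f j|) : (#S : ℝ) ≤ ℓ / s + 1 := by
  have h1 : #S ≤ #(Finset.range (⌊ℓ / s⌋₊ + 1)) := by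
    apply Finset.card_le_card_of_injOn (fun i => ⌊(f i - A) / s⌋₊)
    · intro i hi
      simp only [Finset.coe_range, Set.mem_Iio]
      refine Nat.lt_succ_of_le (Nat.floor_le_floor ?_)
      gcongr
      linarith [hhi i hi]
    · intro i hi j hj hij
      by_contra hne
      have h := hsep i hi j hj hne
      have hi0 : 0 ≤ (f i - A) / s := div_nonneg (by linarith [hlo i hi]) hs.le
      have hj0 : 0 ≤ (f j - A) / s := div_nonneg (by linarith [hlo j hj]) hs.le
      have a1 := Nat.floor_le hi0
      have a2 := Nat.lt_floor_add_one ((f i - A) / s)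
      have b1 := Nat.floor_le hj0
      have b2 := Nat.lt_floor_add_one ((f j - A) / s)
      simp only at hij
      rw [hij] at a1 a2
      have : |(f i - A) / s - (f j - A) / s| < 1 := by rw [abs_lt]; constructor <;> linarith
      rw [← sub_div, abs_div, abs_of_pos hs, div_lt_one hs] at this
      rw [show f i - A - (f j - A) = f i - f j by ring] at this
      linarith
  rw [Finset.card_range] at h1
  have h2 := Nat.floor_le (div_nonneg hℓ hs.le)
  have h3 : (#S : ℝ) ≤ (⌊ℓ / s⌋₊ + 1 : ℕ) := by exact_mod_cast h1
  push_cast at h3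
  linarith

lemma exists_filter_eq_Ico (a b : ℕ) (P : ℕ → Prop) [DecidablePred P]
    (hP : ∀ i ∈ Ico a b, ∀ j ∈ Ico a b, ∀ k ∈ Ico a b, i ≤ j → j ≤ k → P i → P k → P j) :
    ∃ a' b', a ≤ a' ∧ (Ico a b).filter P = Ico a' b' := by
  rcases ((Ico a b).filter P).eq_empty_or_nonempty with h | h
  · exact ⟨a, a, le_rfl, by rw [h]; simp⟩
  · have h1 := mem_filter.1 (Finset.min'_mem _ h)
    have h2 := mem_filter.1 (Finset.max'_mem _ h)
    refine ⟨((Ico a b).filter P).min' h, ((Ico a b).filter P).max' h + 1,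
      (mem_Ico.1 h1.1).1, ?_⟩
    ext n
    constructor
    · intro hn
      rw [mem_Ico, Nat.lt_succ_iff]
      exact ⟨Finset.min'_le _ _ hn, Finset.le_max' _ _ hn⟩
    · intro hn
      rw [mem_Ico, Nat.lt_succ_iff] at hn
      have m1 := mem_Ico.1 h1.1
      have m2 := mem_Ico.1 h2.1
      have hmem : n ∈ Ico a b := mem_Ico.2 ⟨by omega, by omega⟩
      exact mem_filter.2 ⟨hmem, hP _ h1.1 _ hmem _ h2.1 hn.1 hn.2 h1.2 h2.2⟩

/-- Van der Corput's second derivative test, in terms of second differences of the phase. -/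
lemma second_derivative_test {f : ℕ → ℝ} {a b : ℕ} {lam A : ℝ} (hlam : 0 < lam) (hA : 1 ≤ A)
    (hlo : ∀ n ∈ Ico a b, lam ≤ (f (n + 2) - f (n + 1)) - (f (n + 1) - f n))
    (hhi : ∀ n ∈ Ico a b, (f (n + 2) - f (n + 1)) - (f (n + 1) - f n) ≤ A * lam) :
    ‖∑ n ∈ Ico a b, e (f n)‖ ≤ 10 * A * ((b - a : ℕ) * √lam + 1 / √lam) := by
  set r := √lam with hr
  have hr0 : 0 < r := Real.sqrt_pos.2 hlam
  have hr2 : r * r = lam := Real.mul_self_sqrt hlam.le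
  have htriv : ‖∑ n ∈ Ico a b, e (f n)‖ ≤ (b - a : ℕ) := by
    refine (norm_sum_le _ _).trans ?_
    simp [norm_e]
  have hd0 : (0 : ℝ) ≤ (b - a : ℕ) := Nat.cast_nonneg _
  have hinv : 0 < 1 / r := by positivity
  rcases lt_or_ge (1 / 2) r with hbig | hsmall
  · have h1 : ((b - a : ℕ) : ℝ) ≤ 2 * ((b - a : ℕ) * r) := by nlinarith
    have h2 : 2 * ((b - a : ℕ) * r) ≤ 10 * A * ((b - a : ℕ) * r + 1 / r) := by
      have : 0 ≤ (b - a : ℕ) * r := by positivity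
      nlinarith
    linarith
  rcases Nat.lt_or_ge a b with hab | hab
  swap
  · rw [Finset.Ico_eq_empty (by omega)]
    simp only [sum_empty, norm_zero]; positivity
  set g : ℕ → ℝ := fun n => f (n + 1) - f n with hg
  have hstep : ∀ n ∈ Ico a b, lam ≤ g (n + 1) - g n ∧ g (n + 1) - g n ≤ A * lam := fun n hn =>
    ⟨hlo n hn, hhi n hn⟩
  have hgrow : ∀ i j, a ≤ i → i ≤ j → j ≤ b → lam * (j - i) ≤ g j - g i ∧
      g j - g i ≤ A * lam * (j - i) := by
    intro i j hai hij hjb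
    induction j, hij using Nat.le_induction with
    | base => simp
    | succ j hij ih =>
      have h1 := ih (by omega)
      have h2 := hstep j (mem_Ico.2 ⟨by omega, by omega⟩)
      push_cast
      constructor <;> linarith
  have hmono : ∀ i j, a ≤ i → i ≤ j → j ≤ b → g i ≤ g j := by
    intro i j h1 h2 h3
    have h4 := (hgrow i j h1 h2 h3).1
    have h5 : (0 : ℝ) ≤ j - i := by rw [sub_nonneg]; exact_mod_cast h2
    nlinarith
  have hsepg : ∀ i ∈ Ico a b, ∀ j ∈ Ico a b, i ≠ j → lam ≤ |g i - g j| := by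
    have key : ∀ i j, a ≤ i → i < j → j < b → lam ≤ g j - g i := by
      intro i j h1 h2 h3
      have h4 := (hgrow i j h1 h2.le h3.le).1
      have h5 : (1 : ℝ) ≤ j - i := by
        rw [le_sub_iff_add_le]; exact_mod_cast (by omega : 1 + i ≤ j)
      nlinarith
    intro i hi j hj hij
    rw [mem_Ico] at hi hj
    rcases lt_or_gt_of_ne hij with h | h
    · rw [abs_sub_comm]; exact (key i j hi.1 h hj.2).trans (le_abs_self _)
    · exact (key j i hj.1 h hi.2).trans (le_abs_self _)
  set T : Finset ℤ := Finset.Icc ⌊g a⌋ ⌊g a + A * lam * (b - a : ℕ)⌋ with hT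
  have hmaps : ∀ n ∈ Ico a b, ⌊g n⌋ ∈ T := by
    intro n hn
    rw [mem_Ico] at hn
    rw [hT, Finset.mem_Icc]
    refine ⟨Int.floor_le_floor (hmono a n le_rfl hn.1 hn.2.le), Int.floor_le_floor ?_⟩
    have h1 := (hgrow a n le_rfl hn.1 hn.2.le).2
    have h2 : (n : ℝ) - a ≤ (b - a : ℕ) := by
      rw [Nat.cast_sub hab.le]; gcongr; exact hn.2.le
    have h3 : A * lam * (n - a) ≤ A * lam * (b - a : ℕ) := by gcongr
    linarith
  have hcardT : (#T : ℝ) ≤ A * lam * (b - a : ℕ) + 2 := by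
    rw [hT, Int.card_Icc]
    have h1 := Int.lt_floor_add_one (g a)
    have h2 := Int.floor_le (g a + A * lam * (b - a : ℕ))
    have h3 : (0 : ℝ) ≤ A * lam * (b - a : ℕ) := by positivity
    have h4 : (0:ℤ) ≤ ⌊g a + A * lam * (b - a : ℕ)⌋ + 1 - ⌊g a⌋ := by
      have := Int.floor_le_floor (a := g a) (b := g a + A * lam * (b - a : ℕ)) (by linarith)
      omega
    have h5 : (((⌊g a + A * lam * (b - a : ℕ)⌋ + 1 - ⌊g a⌋).toNat : ℤ) : ℝ) =
        ((⌊g a + A * lam * (b - a : ℕ)⌋ + 1 - ⌊g a⌋ : ℤ) : ℝ) := by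
      rw [Int.toNat_of_nonneg h4]
    rw [Int.cast_natCast] at h5
    rw [h5]
    push_cast
    linarith
  have hfib : ∀ ν ∈ T, ‖∑ n ∈ (Ico a b).filter (fun n => ⌊g n⌋ = ν), e (f n)‖ ≤ 5 / r := by
    intro ν _
    set S := (Ico a b).filter (fun n => ⌊g n⌋ = ν) with hS
    have hSmem : ∀ n ∈ S, n ∈ Ico a b ∧ (ν : ℝ) ≤ g n ∧ g n < ν + 1 := by
      intro n hn
      rw [hS, mem_filter] at hn
      refine ⟨hn.1, ?_, ?_⟩
      · rw [← hn.2]; exact Int.floor_le _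
      · rw [← hn.2]; exact Int.lt_floor_add_one _
    have hlamr : r / lam = 1 / r := by rw [← hr2]; field_simp
    have hc1 : (#(S.filter (fun n => g n < ν + r)) : ℝ) ≤ 1 / r + 1 := by
      rw [← hlamr]
      refine card_le_of_separated _ g hlam hr0.le (A := ν) ?_ ?_ ?_
      · intro i hi; exact (hSmem i (mem_filter.1 hi).1).2.1
      · intro i hi; exact (mem_filter.1 hi).2.le
      · intro i hi j hj hij
        exact hsepg i (hSmem i (mem_filter.1 hi).1).1 j (hSmem j (mem_filter.1 hj).1).1 hij
    have hc2 : (#((S.filter (fun n => ¬ g n < ν + r)).filter (fun n => ν + 1 - r < g n)) : ℝ)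
        ≤ 1 / r + 1 := by
      rw [← hlamr]
      refine card_le_of_separated _ g hlam hr0.le (A := ν + 1 - r) ?_ ?_ ?_
      · intro i hi; exact (mem_filter.1 hi).2.le
      · intro i hi
        have := (hSmem i (mem_filter.1 (mem_filter.1 hi).1).1).2.2
        linarith
      · intro i hi j hj hij
        exact hsepg i (hSmem i (mem_filter.1 (mem_filter.1 hi).1).1).1 j
          (hSmem j (mem_filter.1 (mem_filter.1 hj).1).1).1 hij
    have hc3 : ‖∑ n ∈ (S.filter (fun n => ¬ g n < ν + r)).filter (fun n => ¬ ν + 1 - r < g n),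
        e (f n)‖ ≤ 2 / r := by
      have hset : (S.filter (fun n => ¬ g n < ν + r)).filter (fun n => ¬ ν + 1 - r < g n) =
          (Ico a b).filter (fun n => ν + r ≤ g n ∧ g n ≤ ν + 1 - r) := by
        ext n
        simp only [hS, mem_filter, not_lt]
        constructor
        · rintro ⟨⟨⟨h1, _⟩, h2⟩, h3⟩; exact ⟨h1, h2, h3⟩
        · rintro ⟨h1, h2, h3⟩
          exact ⟨⟨⟨h1, Int.floor_eq_iff.2 ⟨by linarith, by linarith⟩⟩, h2⟩, h3⟩
      obtain ⟨a', b', ha', hEq⟩ := exists_filter_eq_Ico a b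
        (fun n => ν + r ≤ g n ∧ g n ≤ ν + 1 - r) (by
          intro i hi j hj k hk hij hjk h1 h2
          rw [mem_Ico] at hi hj hk
          exact ⟨h1.1.trans (hmono i j hi.1 hij hj.2.le),
            (hmono j k hj.1 hjk hk.2.le).trans h2.2⟩)
      have hmem : ∀ n ∈ Ico a' b', n ∈ Ico a b ∧ ν + r ≤ g n ∧ g n ≤ ν + 1 - r := by
        intro n hn; rw [← hEq] at hn; exact mem_filter.1 hn
      rw [hset, hEq]
      refine kusmin_landau ν hr0 ?_ (fun n hn => (hmem n hn).2.1) (fun n hn => (hmem n hn).2.2)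
      intro n h1 h2
      have h3 := (hmem n (mem_Ico.2 ⟨h1, by omega⟩)).1
      rw [mem_Ico] at h3
      exact hmono n (n + 1) h3.1 (by omega) (by omega)
    have hn1 : ∀ s : Finset ℕ, ‖∑ n ∈ s, e (f n)‖ ≤ #s := by
      intro s
      refine (norm_sum_le _ _).trans ?_
      simp [norm_e]
    rw [← Finset.sum_filter_add_sum_filter_not S (fun n => g n < ν + r),
      ← Finset.sum_filter_add_sum_filter_not (S.filter (fun n => ¬ g n < ν + r))
        (fun n => ν + 1 - r < g n)]
    refine (norm_add_le _ _).trans ?_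
    refine (add_le_add ((hn1 _).trans hc1) ((norm_add_le _ _).trans
      (add_le_add ((hn1 _).trans hc2) hc3))).trans ?_
    have : 2 ≤ 1 / r := by rw [le_div_iff₀ hr0]; linarith
    have h2 : 2 / r = 2 * (1 / r) := by ring
    have h5 : 5 / r = 5 * (1 / r) := by ring
    rw [h2, h5]; linarith
  rw [← Finset.sum_fiberwise_of_maps_to hmaps]
  refine (norm_sum_le _ _).trans ((Finset.sum_le_sum hfib).trans ?_)
  rw [Finset.sum_const, nsmul_eq_mul]
  have h5 : 0 < 5 / r := by positivity
  have h6 : A * lam * (b - a : ℕ) * (5 / r) = 5 * A * ((b - a : ℕ) * r) := by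
    rw [← hr2]; field_simp
  calc (#T : ℝ) * (5 / r) ≤ (A * lam * (b - a : ℕ) + 2) * (5 / r) := by gcongr
    _ = 5 * A * ((b - a : ℕ) * r) + 10 * (1 / r) := by rw [add_mul, h6]; ring
    _ ≤ _ := by
      have : 0 ≤ A * ((b - a : ℕ) * r) := by positivity
      nlinarith

lemma second_derivative_test_neg {f : ℕ → ℝ} {a b : ℕ} {lam A : ℝ} (hlam : 0 < lam) (hA : 1 ≤ A)
    (hlo : ∀ n ∈ Ico a b, lam ≤ -((f (n + 2) - f (n + 1)) - (f (n + 1) - f n)))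
    (hhi : ∀ n ∈ Ico a b, -((f (n + 2) - f (n + 1)) - (f (n + 1) - f n)) ≤ A * lam) :
    ‖∑ n ∈ Ico a b, e (f n)‖ ≤ 10 * A * ((b - a : ℕ) * √lam + 1 / √lam) := by
  have h : ‖∑ n ∈ Ico a b, e (f n)‖ = ‖∑ n ∈ Ico a b, e (-f n)‖ := by
    rw [← RCLike.norm_conj, map_sum]
    simp_rw [conj_e]
  rw [h]
  refine second_derivative_test (f := fun n => -f n) hlam hA ?_ ?_
  · intro n hn; have := hlo n hn; linarith
  · intro n hn; have := hhi n hn; linarith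

/-- A second difference is bounded by the bounds of the second derivative. -/
lemma second_difference_mem {s s' s'' : ℝ → ℝ} {x lo hi : ℝ}
    (h1 : ∀ y ∈ Set.Icc x (x + 2), HasDerivAt s (s' y) y)
    (h2 : ∀ y ∈ Set.Icc x (x + 2), HasDerivAt s' (s'' y) y)
    (hlo : ∀ y ∈ Set.Icc x (x + 2), lo ≤ s'' y) (hhi : ∀ y ∈ Set.Icc x (x + 2), s'' y ≤ hi) :
    lo ≤ (s (x + 2) - s (x + 1)) - (s (x + 1) - s x) ∧
      (s (x + 2) - s (x + 1)) - (s (x + 1) - s x) ≤ hi := by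
  have hD : ∀ y ∈ Set.Icc x (x + 1),
    HasDerivAt (fun y => s (y + 1) - s y) (s' (y + 1) - s' y) y := by
    intro y hy
    exact ((h1 (y + 1) ⟨by linarith [hy.1], by linarith [hy.2]⟩).comp_add_const y 1).sub
      (h1 y ⟨hy.1, by linarith [hy.2]⟩)
  obtain ⟨u, hu, hu'⟩ := exists_hasDerivAt_eq_slope (fun y => s (y + 1) - s y)
    (fun y => s' (y + 1) - s' y) (show x < x + 1 by linarith)
    (fun y hy => (hD y hy).continuousAt.continuousWithinAt)
    (fun y hy => hD y ⟨hy.1.le, hy.2.le⟩)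
  obtain ⟨v, hv, hv'⟩ := exists_hasDerivAt_eq_slope s' s'' (show u < u + 1 by linarith)
    (fun y hy => (h2 y ⟨by linarith [hy.1, hu.1],
      by linarith [hy.2, hu.2]⟩).continuousAt.continuousWithinAt)
    (fun y hy => h2 y ⟨by linarith [hy.1, hu.1], by linarith [hy.2, hu.2]⟩)
  have e1 : (s (x + 2) - s (x + 1)) - (s (x + 1) - s x) = s'' v := by
    rw [hv']
    have : u + 1 - u = 1 := by ring
    rw [this, div_one, hu', show x + 1 - x = 1 by ring, div_one, show x + 1 + 1 = x + 2 by ring]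
  have hvm : v ∈ Set.Icc x (x + 2) := ⟨by linarith [hv.1, hu.1], by linarith [hv.2, hu.2]⟩
  rw [e1]
  exact ⟨hlo v hvm, hhi v hvm⟩

lemma mem_dyN {Y : ℝ} {m : ℕ} : m ∈ dyN Y ↔ Y / 2 ≤ (m : ℝ) ∧ (m : ℝ) < Y := by
  simp only [dyN, mem_filter, mem_range, and_iff_right_iff_imp]
  rintro ⟨-, h⟩
  have h1 : (m : ℝ) < ⌈Y⌉₊ := h.trans_le (Nat.le_ceil Y)
  have h2 : m < ⌈Y⌉₊ := by exact_mod_cast h1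
  omega

lemma mem_dyZ {Y : ℝ} {l : ℤ} : l ∈ dyZ Y ↔ l ≠ 0 ∧ Y / 2 ≤ |(l : ℝ)| ∧ |(l : ℝ)| < Y := by
  simp only [dyZ, mem_filter, mem_Icc, and_iff_right_iff_imp]
  rintro ⟨-, -, h⟩
  have h1 : |(l : ℝ)| < ⌈Y⌉₊ := h.trans_le (Nat.le_ceil Y)
  have h2 : |l| < (⌈Y⌉₊ : ℤ) := by exact_mod_cast h1
  exact abs_le.1 h2.le

/-- An order-convex part of a dyadic block is an interval. -/
lemma exists_dyN_filter_eq_Ico (Y : ℝ) (P : ℕ → Prop) [DecidablePred P]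
    (hP : ∀ i j k : ℕ, i ≤ j → j ≤ k → P i → P k → P j) :
    ∃ a b, (dyN Y).filter P = Ico a b := by
  obtain ⟨a, b, -, h⟩ := exists_filter_eq_Ico 0 (⌈Y⌉₊ + 1)
    (fun m => (Y / 2 ≤ (m : ℝ) ∧ (m : ℝ) < Y) ∧ P m) (by
      rintro i - j - k - hij hjk ⟨⟨h1, -⟩, h3⟩ ⟨⟨-, h5⟩, h6⟩
      have hij' : (i : ℝ) ≤ j := by exact_mod_cast hij
      have hjk' : (j : ℝ) ≤ k := by exact_mod_cast hjk
      exact ⟨⟨by linarith, by linarith⟩, hP i j k hij hjk h3 h6⟩)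
  refine ⟨a, b, ?_⟩
  rw [← h, dyN, filter_filter]
  congr 1
  ext; simp

lemma card_dyN_le {Y : ℝ} (hY : 1 ≤ Y) : (#(dyN Y) : ℝ) ≤ 2 * Y := by
  have h := card_le_of_separated (dyN Y) (fun m => (m : ℝ)) (A := 0) (ℓ := Y) one_pos (by linarith)
    (fun i _ => by positivity) (fun i hi => by have := (mem_dyN.1 hi).2; linarith)
    (fun i _ j _ hij => by
      have : (1 : ℤ) ≤ |(i : ℤ) - j| := Int.one_le_abs (sub_ne_zero.2 (by exact_mod_cast hij))
      exact_mod_cast this)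
  linarith

lemma card_dyZ_le {Y : ℝ} (hY : 1 ≤ Y) : (#(dyZ Y) : ℝ) ≤ 3 * Y := by
  have h := card_le_of_separated (dyZ Y) (fun m => (m : ℝ)) (A := -Y) (ℓ := 2 * Y) one_pos
    (by linarith)
    (fun i hi => by have := (abs_lt.1 (mem_dyZ.1 hi).2.2).1; linarith)
    (fun i hi => by have := (abs_lt.1 (mem_dyZ.1 hi).2.2).2; linarith)
    (fun i _ j _ hij => by
      have : (1 : ℤ) ≤ |i - j| := Int.one_le_abs (sub_ne_zero.2 (by exact_mod_cast hij))
      exact_mod_cast this)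
  linarith

lemma card_Ico_le_of_dyadic {a b : ℕ} {P : ℝ} (hP : 1 ≤ P)
    (hab : ∀ n ∈ Ico a b, P / 2 ≤ (n : ℝ) ∧ (n : ℝ) < P) : ((b - a : ℕ) : ℝ) ≤ 2 * P := by
  have h : Ico a b ⊆ dyN P := fun n hn => mem_dyN.2 (hab n hn)
  have h1 := card_le_card h
  rw [Nat.card_Ico] at h1
  exact (Nat.cast_le.2 h1).trans (card_dyN_le hP)

lemma hasDerivAt_mul_rpow {D p y : ℝ} (hy : 0 < y) :
    HasDerivAt (fun x : ℝ => D * x ^ p) (D * p * y ^ (p - 1)) y := by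
  have := (Real.hasDerivAt_rpow_const (x := y) (p := p) (Or.inl hy.ne')).const_mul D
  rwa [← mul_assoc] at this

/-- The second derivative test for the phase `β n + D n ^ γ` on a dyadic block. -/
lemma exists_norm_sum_e_rpow_le {γ : ℝ} (h0 : 0 < γ) (h1 : γ < 1) :
    ∃ C : ℝ, 0 < C ∧ ∀ (a b : ℕ) (P β D : ℝ), 1 ≤ P → D ≠ 0 →
      (∀ n ∈ Ico a b, P / 2 ≤ (n : ℝ) ∧ (n : ℝ) < P) →
      ‖∑ n ∈ Ico a b, e (β * n + D * (n : ℝ) ^ γ)‖ ≤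
        C * (√(|D| * P ^ γ) + P / √(|D| * P ^ γ)) := by
  set κ := γ * (1 - γ) * (3 : ℝ) ^ (γ - 2) with hκ
  have hg : 0 < γ * (1 - γ) := mul_pos h0 (by linarith)
  have hκ0 : 0 < κ := by positivity
  set A := (6 : ℝ) ^ (2 - γ) with hA
  have hA1 : 1 ≤ A := Real.one_le_rpow (by norm_num) (by linarith)
  refine ⟨10 * A * (2 * √κ + 1 / √κ), by positivity, ?_⟩
  intro a b P β D hP hD hab
  have hP0 : 0 < P := by linarith
  set F := |D| * P ^ γ with hF
  have hD0 : 0 < |D| := abs_pos.2 hD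
  have hF0 : 0 < F := by positivity
  set lam := |D| * (γ * (1 - γ)) * (3 * P) ^ (γ - 2) with hlam
  have hlam0 : 0 < lam := by positivity
  have hlamF : lam = κ * F / P ^ 2 := by
    rw [hlam, hκ, hF, Real.mul_rpow (by norm_num) hP0.le, Real.rpow_sub hP0, Real.rpow_two]
    ring
  have hsq : √lam = √κ * √F / P := by
    rw [hlamF, Real.sqrt_div (by positivity), Real.sqrt_mul hκ0.le, Real.sqrt_sq hP0.le]
  have hAl : |D| * (γ * (1 - γ)) * (P / 2) ^ (γ - 2) = A * lam := by
    rw [hlam, hA, show (P / 2 : ℝ) = (6 : ℝ)⁻¹ * (3 * P) by ring,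
      Real.mul_rpow (by norm_num) (by positivity), Real.inv_rpow (by norm_num),
      ← Real.rpow_neg (by norm_num), neg_sub]
    ring
  have hmem : ∀ E : ℝ, 0 < E → ∀ n ∈ Ico a b,
      E * (γ * (1 - γ)) * (3 * P) ^ (γ - 2) ≤
        -((E * ((n + 2 : ℕ) : ℝ) ^ γ - E * ((n + 1 : ℕ) : ℝ) ^ γ) -
          (E * ((n + 1 : ℕ) : ℝ) ^ γ - E * (n : ℝ) ^ γ)) ∧
        -((E * ((n + 2 : ℕ) : ℝ) ^ γ - E * ((n + 1 : ℕ) : ℝ) ^ γ) -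
          (E * ((n + 1 : ℕ) : ℝ) ^ γ - E * (n : ℝ) ^ γ)) ≤
        E * (γ * (1 - γ)) * (P / 2) ^ (γ - 2) := by
    intro E hE n hn
    obtain ⟨hn1, hn2⟩ := hab n hn
    have hpos : ∀ y ∈ Set.Icc (n : ℝ) (n + 2), 0 < y := fun y hy => by linarith [hy.1]
    have h := second_difference_mem (s := fun y => E * y ^ γ) (s' := fun y => E * γ * y ^ (γ - 1))
      (s'' := fun y => E * γ * (γ - 1) * y ^ (γ - 1 - 1)) (x := n)
      (lo := -(E * (γ * (1 - γ)) * (P / 2) ^ (γ - 2)))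
      (hi := -(E * (γ * (1 - γ)) * (3 * P) ^ (γ - 2)))
      (fun y hy => hasDerivAt_mul_rpow (hpos y hy)) (fun y hy => hasDerivAt_mul_rpow (hpos y hy))
      (fun y hy => by
        have h2 : y ^ (γ - 2) ≤ (P / 2) ^ (γ - 2) :=
          Real.rpow_le_rpow_of_nonpos (by positivity) (by linarith [hy.1]) (by linarith)
        have h3 := mul_le_mul_of_nonneg_left h2 (mul_pos hE hg).le
        rw [show γ - 1 - 1 = γ - 2 by ring]
        linarith)
      (fun y hy => by
        have h2 : (3 * P) ^ (γ - 2) ≤ y ^ (γ - 2) :=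
          Real.rpow_le_rpow_of_nonpos (hpos y hy) (by linarith [hy.2]) (by linarith)
        have h3 := mul_le_mul_of_nonneg_left h2 (mul_pos hE hg).le
        rw [show γ - 1 - 1 = γ - 2 by ring]
        linarith)
    push_cast
    constructor <;> [have := h.2; have := h.1] <;> linarith
  have hbound : ‖∑ n ∈ Ico a b, e (β * n + D * (n : ℝ) ^ γ)‖ ≤
      10 * A * ((b - a : ℕ) * √lam + 1 / √lam) := by
    rcases lt_or_gt_of_ne hD with hneg | hpos
    · have habs : |D| = -D := abs_of_neg hneg
      refine second_derivative_test (f := fun n : ℕ => β * n + D * (n : ℝ) ^ γ) hlam0 hA1 ?_ ?_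
      · intro n hn
        have h := (hmem (-D) (by linarith) n hn).1
        rw [hlam, habs]
        push_cast at h ⊢
        linarith
      · intro n hn
        have h := (hmem (-D) (by linarith) n hn).2
        rw [← hAl, habs]
        push_cast at h ⊢
        linarith
    · have habs : |D| = D := abs_of_pos hpos
      refine second_derivative_test_neg (f := fun n : ℕ => β * n + D * (n : ℝ) ^ γ) hlam0 hA1 ?_ ?_
      · intro n hn
        have h := (hmem D hpos n hn).1
        rw [hlam, habs]
        push_cast at h ⊢
        linarith
      · intro n hn
        have h := (hmem D hpos n hn).2
        rw [← hAl, habs]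
        push_cast at h ⊢
        linarith
  refine hbound.trans ?_
  rw [mul_assoc (10 * A)]
  refine mul_le_mul_of_nonneg_left ?_ (by positivity)
  have hcard := card_Ico_le_of_dyadic hP hab
  have hκs : 0 < √κ := Real.sqrt_pos.2 hκ0
  have hFs : 0 < √F := Real.sqrt_pos.2 hF0
  have e1 : ((b - a : ℕ) : ℝ) * √lam ≤ 2 * √κ * √F := by
    calc ((b - a : ℕ) : ℝ) * √lam ≤ (2 * P) * √lam := by gcongr
      _ = 2 * √κ * √F := by rw [hsq]; field_simp
  have e2 : 1 / √lam = 1 / √κ * (P / √F) := by rw [hsq]; field_simp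
  rw [e2]
  have e3 : 0 ≤ 2 * √κ * (P / √F) := by positivity
  have e4 : 0 ≤ 1 / √κ * √F := by positivity
  linarith

lemma Nat.eq_of_cross_mul_eq_of_gcd_eq {a b c d : ℕ} (hd : 0 < d) (hk : 0 < a.gcd b)
    (hg : a.gcd b = c.gcd d) (h : a * d = c * b) : a = c ∧ b = d := by
  have h1 : a.gcd b * d = a.gcd b * b := by
    rw [← Nat.gcd_mul_right, h, hg, mul_comm b d, Nat.gcd_mul_right]
  have h2 : d = b := Nat.eq_of_mul_eq_mul_left hk h1
  subst h2
  exact ⟨Nat.eq_of_mul_eq_mul_right hd h, rfl⟩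

/-- Pairs with a given gcd have well-spaced ratios. -/
lemma sq_div_sq_le_abs_sub_ratio {V : ℝ} {k : ℕ} (hk : 0 < k) {p q : ℕ × ℕ}
    (hp : p ∈ dyN V ×ˢ dyN V) (hq : q ∈ dyN V ×ˢ dyN V) (hpk : p.1.gcd p.2 = k)
    (hqk : q.1.gcd q.2 = k) (hV : 0 < V) (hpq : p ≠ q) :
    (k : ℝ) ^ 2 / V ^ 2 ≤ |(p.1 : ℝ) / p.2 - (q.1 : ℝ) / q.2| := by
  obtain ⟨-, hp2⟩ := mem_product.1 hp
  obtain ⟨-, hq2⟩ := mem_product.1 hq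
  rw [mem_dyN] at hp2 hq2
  have hp0 : (0 : ℝ) < p.2 := by linarith
  have hq0 : (0 : ℝ) < q.2 := by linarith
  have hdvd : ((k : ℤ) * k) ∣ (p.1 : ℤ) * q.2 - (q.1 : ℤ) * p.2 := by
    have a1 : (k : ℤ) ∣ p.1 := by exact_mod_cast hpk ▸ Nat.gcd_dvd_left _ _
    have a2 : (k : ℤ) ∣ p.2 := by exact_mod_cast hpk ▸ Nat.gcd_dvd_right _ _
    have a3 : (k : ℤ) ∣ q.1 := by exact_mod_cast hqk ▸ Nat.gcd_dvd_left _ _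
    have a4 : (k : ℤ) ∣ q.2 := by exact_mod_cast hqk ▸ Nat.gcd_dvd_right _ _
    exact dvd_sub (mul_dvd_mul a1 a4) (mul_dvd_mul a3 a2)
  have hne : (p.1 : ℤ) * q.2 - (q.1 : ℤ) * p.2 ≠ 0 := by
    intro h0
    apply hpq
    have h1 : p.1 * q.2 = q.1 * p.2 := by exact_mod_cast sub_eq_zero.1 h0
    have := Nat.eq_of_cross_mul_eq_of_gcd_eq (by exact_mod_cast hq0) (hpk ▸ hk)
      (hpk.trans hqk.symm) h1
    exact Prod.ext this.1 this.2
  have hle : (k : ℤ) * k ≤ |(p.1 : ℤ) * q.2 - (q.1 : ℤ) * p.2| :=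
    Int.le_of_dvd (abs_pos.2 hne) ((dvd_abs _ _).2 hdvd)
  have hle' : (k : ℝ) * k ≤ |(p.1 : ℝ) * q.2 - (q.1 : ℝ) * p.2| := by exact_mod_cast hle
  rw [div_sub_div _ _ hp0.ne' hq0.ne', abs_div, abs_of_pos (mul_pos hp0 hq0),
    div_le_div_iff₀ (by positivity) (by positivity), mul_comm (p.2 : ℝ) q.1]
  gcongr ?_ * ?_
  · rw [sq]; exact hle'
  · rw [sq]; gcongr <;> linarith

lemma card_multiples_dyN_le {N : ℝ} {j : ℕ} (hj : 0 < j) (hjN : (j : ℝ) ≤ N) :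
    (#((dyN N).filter (j ∣ ·)) : ℝ) ≤ 2 * N / j := by
  have hj0 : (0 : ℝ) < j := by exact_mod_cast hj
  have h := card_le_of_separated ((dyN N).filter (j ∣ ·)) (fun m => (m : ℝ)) (A := 0) (ℓ := N) hj0
    (by linarith) (fun i _ => by positivity)
    (fun i hi => by have := (mem_dyN.1 (mem_filter.1 hi).1).2; linarith)
    (fun a ha b hb hab => by
      have h1 : (j : ℤ) ∣ (a : ℤ) - b := dvd_sub (by exact_mod_cast (mem_filter.1 ha).2)
        (by exact_mod_cast (mem_filter.1 hb).2)
      have h2 : (j : ℤ) ≤ |(a : ℤ) - b| :=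
        Int.le_of_dvd (abs_pos.2 (sub_ne_zero.2 (by exact_mod_cast hab))) ((dvd_abs _ _).2 h1)
      exact_mod_cast h2)
  have h2 : 1 ≤ N / j := (one_le_div hj0).2 hjN
  rw [mul_div_assoc]
  linarith

/-- The pairs in a dyadic block with gcd equal to `j`. -/
def gcdPairs (s : Finset ℕ) (j : ℕ) : Finset (ℕ × ℕ) :=
  (s ×ˢ s).filter fun p => p.1.gcd p.2 = j

lemma card_gcdPairs_dyN_le {N : ℝ} {j : ℕ} (hj : 0 < j) (hjN : (j : ℝ) ≤ N) :
    (#(gcdPairs (dyN N) j) : ℝ) ≤ 4 * (N / j) ^ 2 := by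
  have h1 : gcdPairs (dyN N) j ⊆ (dyN N).filter (j ∣ ·) ×ˢ (dyN N).filter (j ∣ ·) := by
    intro p hp
    obtain ⟨hp1, hp2⟩ := mem_filter.1 hp
    obtain ⟨hp3, hp4⟩ := mem_product.1 hp1
    exact mem_product.2 ⟨mem_filter.2 ⟨hp3, hp2 ▸ Nat.gcd_dvd_left _ _⟩,
      mem_filter.2 ⟨hp4, hp2 ▸ Nat.gcd_dvd_right _ _⟩⟩
  have h2 := card_le_card h1
  rw [card_product] at h2
  have h3 : (#(gcdPairs (dyN N) j) : ℝ) ≤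
      #((dyN N).filter (j ∣ ·)) * #((dyN N).filter (j ∣ ·)) := by exact_mod_cast h2
  have h4 := card_multiples_dyN_le hj hjN
  refine h3.trans ((mul_le_mul h4 h4 (by positivity) (le_trans (by positivity) h4)).trans
    (le_of_eq ?_))
  ring

lemma card_filter_near_le {ι κ : Type*} (A : Finset ι) (B : Finset κ) (f : ι → ℝ) (g : κ → ℝ)
    {s ℓ : ℝ} (hs : 0 < s) (hℓ : 0 ≤ ℓ) (hsep : ∀ i ∈ A, ∀ j ∈ A, i ≠ j → s ≤ |f i - f j|) :
    (#((A ×ˢ B).filter fun p => |f p.1 - g p.2| ≤ ℓ) : ℝ) ≤ #B * (2 * ℓ / s + 1) := by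
  rw [card_filter, sum_product_right]
  push_cast
  rw [← nsmul_eq_mul]
  refine sum_le_card_nsmul _ _ _ fun b _ => ?_
  have h := card_le_of_separated (A.filter fun a => |f a - g b| ≤ ℓ) f (A := g b - ℓ)
    (ℓ := 2 * ℓ) hs (by linarith) (fun i hi => by linarith [(abs_le.1 (mem_filter.1 hi).2).1])
    (fun i hi => by linarith [(abs_le.1 (mem_filter.1 hi).2).2])
    (fun i hi j hj => hsep i (mem_filter.1 hi).1 j (mem_filter.1 hj).1)
  rw [card_filter] at h
  push_cast at h
  exact h

lemma mul_abs_sub_le_abs_rpow_sub {γ x y : ℝ} (h0 : 0 < γ) (h1 : γ ≤ 1) (hx : 0 < x) (hx2 : x ≤ 2)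
    (hy : 0 < y) (hy2 : y ≤ 2) : γ / 2 * |x - y| ≤ |x ^ γ - y ^ γ| := by
  have key : ∀ x y : ℝ, 0 < x → y ≤ 2 → x ≤ y → γ / 2 * (y - x) ≤ y ^ γ - x ^ γ := by
    intro x y hx hy2 hxy
    have hy : 0 < y := hx.trans_le hxy
    have hb := rpow_one_add_le_one_add_mul_self (s := x / y - 1)
      (by have := div_pos hx hy; linarith) h0.le h1
    rw [add_sub_cancel, Real.div_rpow hx.le hy.le, div_le_iff₀ (by positivity)] at hb
    have h3 : y ^ (γ - 1) ≥ 1 / 2 := by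
      calc (1 / 2 : ℝ) = (2 : ℝ) ^ (-1 : ℝ) := by rw [Real.rpow_neg_one]; norm_num
        _ ≤ 2 ^ (γ - 1) := Real.rpow_le_rpow_of_exponent_le (by norm_num) (by linarith)
        _ ≤ y ^ (γ - 1) := Real.rpow_le_rpow_of_nonpos hy hy2 (by linarith)
    have h4 : (1 + γ * (x / y - 1)) * y ^ γ = y ^ γ + γ * (y ^ (γ - 1) * (x - y)) := by
      rw [Real.rpow_sub_one hy.ne']; field_simp
    rw [h4] at hb
    have h5 : 1 / 2 * (y - x) ≤ y ^ (γ - 1) * (y - x) :=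
      mul_le_mul_of_nonneg_right h3 (by linarith)
    nlinarith
  rcases le_total x y with h | h
  · rw [abs_sub_comm, abs_of_nonneg (sub_nonneg.2 h), abs_sub_comm]
    exact (key x y hx hy2 h).trans (le_abs_self _)
  · rw [abs_of_nonneg (sub_nonneg.2 h)]
    exact (key y x hy hx2 h).trans (le_abs_self _)

/-- The number of coincidences `h n ^ γ ≈ h' n' ^ γ` over dyadic blocks. -/
lemma card_near_coincidences_le {γ : ℝ} (h0 : 0 < γ) (h1 : γ ≤ 1) {V N Δ : ℝ} (hV : 1 ≤ V)
    (hN : 1 ≤ N) (hΔ : 0 ≤ Δ) :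
    (#(((dyN V ×ˢ dyN N) ×ˢ (dyN V ×ˢ dyN N)).filter fun p =>
      |(p.1.1 : ℝ) * (p.1.2 : ℝ) ^ γ - p.2.1 * (p.2.2 : ℝ) ^ γ| ≤ Δ * (V * N ^ γ)) : ℝ) ≤
      64 / γ * (V * N + Δ * (V * N) ^ 2) *
        ((∑ k ∈ Icc 1 ⌊V⌋₊, 1 / (k : ℝ)) * ∑ j ∈ Icc 1 ⌊N⌋₊, 1 / (j : ℝ)) := by
  have hV0 : 0 < V := by linarith
  have hN0 : 0 < N := by linarith
  set T := ((dyN V ×ˢ dyN N) ×ˢ (dyN V ×ˢ dyN N)).filter fun p =>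
      |(p.1.1 : ℝ) * (p.1.2 : ℝ) ^ γ - p.2.1 * (p.2.2 : ℝ) ^ γ| ≤ Δ * (V * N ^ γ) with hT
  set R : ℕ → ℕ → Finset ((ℕ × ℕ) × (ℕ × ℕ)) := fun k j =>
    (gcdPairs (dyN V) k ×ˢ gcdPairs (dyN N) j).filter fun p =>
      |(p.1.1 : ℝ) / p.1.2 - ((p.2.1 : ℝ) / p.2.2) ^ γ| ≤ 4 * Δ with hR
  have hpos : ∀ {Y : ℝ}, 1 ≤ Y → ∀ {m : ℕ}, m ∈ dyN Y → 0 < (m : ℝ) := by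
    intro Y hY m hm
    have := (mem_dyN.1 hm).1
    linarith
  have hgcd : ∀ {Y : ℝ}, 1 ≤ Y → ∀ {a b : ℕ}, a ∈ dyN Y → b ∈ dyN Y → a.gcd b ∈ Icc 1 ⌊Y⌋₊ := by
    intro Y hY a b ha _
    have ha0 : 0 < a := by exact_mod_cast hpos hY ha
    refine mem_Icc.2 ⟨Nat.gcd_pos_of_pos_left _ ha0, Nat.le_floor ?_⟩
    have : ((a.gcd b : ℕ) : ℝ) ≤ a := by exact_mod_cast Nat.gcd_le_left _ ha0
    linarith [(mem_dyN.1 ha).2]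
  have hfib : ∀ k ∈ Icc 1 ⌊V⌋₊, ∀ j ∈ Icc 1 ⌊N⌋₊, (#(R k j) : ℝ) ≤
      64 / γ * (V * N + Δ * (V * N) ^ 2) * (1 / k * (1 / j)) := by
    intro k hk j hj
    rw [mem_Icc] at hk hj
    have hk0 : (0 : ℝ) < k := by exact_mod_cast hk.1
    have hj0 : (0 : ℝ) < j := by exact_mod_cast hj.1
    have hk1 : (1 : ℝ) ≤ k := by exact_mod_cast hk.1
    have hj1 : (1 : ℝ) ≤ j := by exact_mod_cast hj.1
    have hkV : (k : ℝ) ≤ V := (Nat.le_floor_iff hV0.le).1 hk.2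
    have hjN : (j : ℝ) ≤ N := (Nat.le_floor_iff hN0.le).1 hj.2
    have cA := card_gcdPairs_dyN_le hk.1 hkV
    have cB := card_gcdPairs_dyN_le hj.1 hjN
    have b1 : (#(R k j) : ℝ) ≤ 4 * (N / j) ^ 2 * (2 * (4 * Δ) / (k ^ 2 / V ^ 2) + 1) := by
      refine (card_filter_near_le (gcdPairs (dyN V) k) (gcdPairs (dyN N) j)
        (fun p : ℕ × ℕ => (p.1 : ℝ) / p.2) (fun p : ℕ × ℕ => ((p.1 : ℝ) / p.2) ^ γ)
        (s := k ^ 2 / V ^ 2) (ℓ := 4 * Δ) (by positivity) (by positivity) ?_).trans ?_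
      · intro p hp q hq hpq
        obtain ⟨p1, p2⟩ := mem_filter.1 hp
        obtain ⟨q1, q2⟩ := mem_filter.1 hq
        exact sq_div_sq_le_abs_sub_ratio hk.1 p1 q1 p2 q2 hV0 hpq
      · gcongr
    have b2 : (#(R k j) : ℝ) ≤
        4 * (V / k) ^ 2 * (2 * (4 * Δ) / (γ / 2 * (j ^ 2 / N ^ 2)) + 1) := by
      have hsw : #(R k j) = #((gcdPairs (dyN N) j ×ˢ gcdPairs (dyN V) k).filter fun p =>
          |((p.1.1 : ℝ) / p.1.2) ^ γ - (p.2.1 : ℝ) / p.2.2| ≤ 4 * Δ) := by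
        refine card_bij (fun p _ => p.swap) ?_ ?_ ?_
        · intro p hp
          simp only [hR, mem_filter, mem_product] at hp
          simp only [mem_filter, mem_product, Prod.fst_swap, Prod.snd_swap]
          rw [abs_sub_comm]
          exact ⟨hp.1.symm, hp.2⟩
        · intro p _ q _ h
          exact Prod.swap_injective h
        · intro p hp
          simp only [mem_filter, mem_product] at hp
          refine ⟨p.swap, ?_, Prod.swap_swap p⟩
          simp only [hR, mem_filter, mem_product, Prod.fst_swap, Prod.snd_swap]
          rw [abs_sub_comm]
          exact ⟨hp.1.symm, hp.2⟩
      rw [hsw]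
      refine (card_filter_near_le (gcdPairs (dyN N) j) (gcdPairs (dyN V) k)
        (fun p : ℕ × ℕ => ((p.1 : ℝ) / p.2) ^ γ) (fun p : ℕ × ℕ => (p.1 : ℝ) / p.2)
        (s := γ / 2 * (j ^ 2 / N ^ 2)) (ℓ := 4 * Δ) (by positivity) (by positivity) ?_).trans ?_
      · intro p hp q hq hpq
        obtain ⟨p1, p2⟩ := mem_filter.1 hp
        obtain ⟨q1, q2⟩ := mem_filter.1 hq
        have hsp := sq_div_sq_le_abs_sub_ratio hj.1 p1 q1 p2 q2 hN0 hpq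
        have hrat : ∀ r : ℕ × ℕ,
          r ∈ dyN N ×ˢ dyN N → 0 < (r.1 : ℝ) / r.2 ∧ (r.1 : ℝ) / r.2 ≤ 2 := by
          intro r hr
          obtain ⟨r1, r2⟩ := mem_product.1 hr
          have r3 := hpos hN r1
          have r4 := hpos hN r2
          refine ⟨by positivity, ?_⟩
          rw [div_le_iff₀ r4]
          linarith [(mem_dyN.1 r1).2, (mem_dyN.1 r2).1]
        refine (mul_le_mul_of_nonneg_left hsp (by positivity)).trans ?_
        exact mul_abs_sub_le_abs_rpow_sub h0 h1 (hrat p p1).1 (hrat p p1).2 (hrat q q1).1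
          (hrat q q1).2
      · gcongr
    have e1 : 4 * (N / j) ^ 2 * (2 * (4 * Δ) / (k ^ 2 / V ^ 2) + 1) =
        32 * (Δ * (V / k * (N / j)) ^ 2) + 4 * (N / j) ^ 2 := by field_simp; ring
    have e2 : 4 * (V / k) ^ 2 * (2 * (4 * Δ) / (γ / 2 * (j ^ 2 / N ^ 2)) + 1) =
        64 / γ * (Δ * (V / k * (N / j)) ^ 2) + 4 * (V / k) ^ 2 := by field_simp; ring
    rw [e1] at b1
    rw [e2] at b2
    have hγ' : 64 ≤ 64 / γ := by rw [le_div_iff₀ h0]; linarith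
    set v := V / k with hv
    set w := N / j with hw
    have hv0 : 0 < v := by positivity
    have hw0 : 0 < w := by positivity
    have hq0 : 0 ≤ Δ * (v * w) ^ 2 := by positivity
    have b3 : (#(R k j) : ℝ) ≤ 64 / γ * (Δ * (v * w) ^ 2) + 4 * (v * w) := by
      rcases le_total v w with hvw | hvw
      · have : v ^ 2 ≤ v * w := by rw [sq]; gcongr
        linarith
      · have : w ^ 2 ≤ v * w := by rw [sq]; gcongr
        have : 32 * (Δ * (v * w) ^ 2) ≤ 64 / γ * (Δ * (v * w) ^ 2) :=
          mul_le_mul_of_nonneg_right (by linarith) hq0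
        linarith
    refine b3.trans ?_
    have e3 : v * w = V * N * (1 / k * (1 / j)) := by rw [hv, hw]; field_simp
    have hu0 : 0 < 1 / (k : ℝ) * (1 / j) := by positivity
    have hu1 : 1 / (k : ℝ) * (1 / j) ≤ 1 := by
      rw [one_div, one_div]
      exact mul_le_one₀ (inv_le_one_of_one_le₀ hk1) (by positivity) (inv_le_one_of_one_le₀ hj1)
    rw [e3]
    set u := 1 / (k : ℝ) * (1 / j)
    have hVN : 0 < V * N := by positivity
    have f1 : Δ * (V * N * u) ^ 2 ≤ Δ * (V * N) ^ 2 * u := by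
      have : Δ * (V * N * u) ^ 2 = Δ * (V * N) ^ 2 * u * u := by ring
      rw [this]
      exact mul_le_of_le_one_right (by positivity) hu1
    have f2 := mul_le_mul_of_nonneg_left f1 (show 0 ≤ 64 / γ by positivity)
    have f3 : 4 * (V * N * u) ≤ 64 / γ * (V * N * u) :=
      mul_le_mul_of_nonneg_right (by linarith) (by positivity)
    linarith
  have hsum : (#T : ℝ) ≤ ∑ k ∈ Icc 1 ⌊V⌋₊, ∑ j ∈ Icc 1 ⌊N⌋₊, (#(R k j) : ℝ) := by
    have hmaps : ∀ p ∈ T, ((p.1.1.gcd p.2.1, p.2.2.gcd p.1.2) : ℕ × ℕ) ∈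
        Icc 1 ⌊V⌋₊ ×ˢ Icc 1 ⌊N⌋₊ := by
      intro p hp
      simp only [hT, mem_filter, mem_product] at hp
      exact mem_product.2 ⟨hgcd hV hp.1.1.1 hp.1.2.1, hgcd hN hp.1.2.2 hp.1.1.2⟩
    rw [card_eq_sum_card_fiberwise hmaps, sum_product]
    push_cast
    refine sum_le_sum fun k _ => sum_le_sum fun j _ => ?_
    rw [Nat.cast_le]
    refine card_le_card_of_injOn (fun p => ((p.1.1, p.2.1), (p.2.2, p.1.2))) ?_ ?_
    · intro p hp
      simp only [hT, coe_filter, mem_filter, mem_product, Set.mem_ofPred_eq, Prod.mk.injEq] at hp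
      obtain ⟨⟨⟨⟨m1, m2⟩, m3, m4⟩, hp2⟩, hk, hj⟩ := hp
      simp only [hR, gcdPairs, coe_filter, mem_filter, mem_product, Set.mem_ofPred_eq]
      refine ⟨⟨⟨⟨m1, m3⟩, hk⟩, ⟨m4, m2⟩, hj⟩, ?_⟩
      have p1 := hpos hV m1
      have p2 := hpos hN m2
      have p3 := hpos hV m3
      have p4 := hpos hN m4
      have hD : 0 < (p.2.1 : ℝ) * (p.1.2 : ℝ) ^ γ := by positivity
      have e1 : (p.1.1 : ℝ) / p.2.1 - ((p.2.2 : ℝ) / p.1.2) ^ γ =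
          ((p.1.1 : ℝ) * (p.1.2 : ℝ) ^ γ - p.2.1 * (p.2.2 : ℝ) ^ γ) /
            ((p.2.1 : ℝ) * (p.1.2 : ℝ) ^ γ) := by
        rw [Real.div_rpow p4.le p2.le]
        field_simp
      rw [e1, abs_div, abs_of_pos hD, div_le_iff₀ hD]
      refine hp2.trans ?_
      have l1 : V ≤ 2 * p.2.1 := by linarith [(mem_dyN.1 m3).1]
      have l2 : N ^ γ ≤ 2 * (p.1.2 : ℝ) ^ γ := by
        calc N ^ γ ≤ (2 * p.1.2) ^ γ := by
              apply Real.rpow_le_rpow hN0.le _ h0.le; linarith [(mem_dyN.1 m2).1]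
          _ = 2 ^ γ * (p.1.2 : ℝ) ^ γ := Real.mul_rpow (by norm_num) p2.le
          _ ≤ 2 * (p.1.2 : ℝ) ^ γ := by
            gcongr
            calc (2 : ℝ) ^ γ ≤ 2 ^ (1 : ℝ) :=
                  Real.rpow_le_rpow_of_exponent_le (by norm_num) h1
              _ = 2 := Real.rpow_one 2
      calc Δ * (V * N ^ γ) ≤ Δ * (2 * p.2.1 * (2 * (p.1.2 : ℝ) ^ γ)) := by gcongr
        _ = 4 * Δ * (p.2.1 * (p.1.2 : ℝ) ^ γ) := by ring
    · rintro ⟨⟨a, b⟩, c, d⟩ _ ⟨⟨a', b'⟩, c', d'⟩ _ h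
      simp only [Prod.mk.injEq] at h ⊢
      tauto
  refine hsum.trans ((sum_le_sum fun k hk => sum_le_sum fun j hj => hfib k hk j hj).trans
    (le_of_eq ?_))
  rw [sum_mul_sum, mul_sum]
  refine sum_congr rfl fun k _ => ?_
  rw [mul_sum]

lemma sum_one_div_le_one_add_log {V : ℝ} (hV : 1 ≤ V) :
    ∑ k ∈ Icc 1 ⌊V⌋₊, 1 / (k : ℝ) ≤ 1 + Real.log V := by
  have h := harmonic_floor_le_one_add_log V hV
  rw [harmonic_eq_sum_Icc] at h
  push_cast at h
  simpa only [one_div] using h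

lemma norm_sq_sum_eq {ι : Type*} (s : Finset ι) (z : ι → ℂ) :
    ((‖∑ p ∈ s, z p‖ ^ 2 : ℝ) : ℂ) = ∑ q ∈ s ×ˢ s, z q.1 * (starRingEnd ℂ) (z q.2) := by
  rw [sum_product]
  simp only
  rw [← sum_mul_sum, ← map_sum, RCLike.mul_conj]
  push_cast
  rfl

/-- A bilinear form is controlled by correlations inside the classes of a partition. -/
lemma norm_sq_bilinear_le_classes {ι κ : Type*} (A : Finset ι) (B : Finset κ) (K : ℕ)
    (cl : κ → ℕ) (hcl : ∀ p ∈ B, cl p < K) (a : ι → ℂ) (ha : ∀ m ∈ A, ‖a m‖ ≤ 1)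
    (z : ι → κ → ℂ) :
    ‖∑ m ∈ A, a m * ∑ p ∈ B, z m p‖ ^ 2 ≤ #A * K *
      ∑ q ∈ (B ×ˢ B).filter (fun q => cl q.1 = cl q.2),
        ‖∑ m ∈ A, z m q.1 * (starRingEnd ℂ) (z m q.2)‖ := by
  have h1 : ‖∑ m ∈ A, a m * ∑ p ∈ B, z m p‖ ≤ ∑ m ∈ A, ‖∑ p ∈ B, z m p‖ := by
    refine (norm_sum_le _ _).trans (sum_le_sum fun m hm => ?_)
    rw [norm_mul]
    exact mul_le_of_le_one_left (norm_nonneg _) (ha m hm)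
  have h2 : ∀ m, ‖∑ p ∈ B, z m p‖ ^ 2 ≤
      K * ∑ k ∈ range K, ‖∑ p ∈ B.filter (fun p => cl p = k), z m p‖ ^ 2 := by
    intro m
    have e1 : ∑ p ∈ B, z m p = ∑ k ∈ range K, ∑ p ∈ B.filter (fun p => cl p = k), z m p :=
      (sum_fiberwise_of_maps_to (fun p hp => mem_range.2 (hcl p hp)) _).symm
    have h3 : ‖∑ p ∈ B, z m p‖ ≤ ∑ k ∈ range K, ‖∑ p ∈ B.filter (fun p => cl p = k), z m p‖ := by
      rw [e1]; exact norm_sum_le _ _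
    refine (pow_le_pow_left₀ (norm_nonneg _) h3 2).trans ?_
    have := sq_sum_le_card_mul_sum_sq (s := range K)
      (f := fun k => ‖∑ p ∈ B.filter (fun p => cl p = k), z m p‖)
    rwa [card_range] at this
  have h4 : ∀ k, ∑ m ∈ A, ‖∑ p ∈ B.filter (fun p => cl p = k), z m p‖ ^ 2 ≤
      ∑ q ∈ (B.filter fun p => cl p = k) ×ˢ (B.filter fun p => cl p = k),
        ‖∑ m ∈ A, z m q.1 * (starRingEnd ℂ) (z m q.2)‖ := by
    intro k
    have e2 : ((∑ m ∈ A, ‖∑ p ∈ B.filter (fun p => cl p = k), z m p‖ ^ 2 : ℝ) : ℂ) =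
        ∑ q ∈ (B.filter fun p => cl p = k) ×ˢ (B.filter fun p => cl p = k),
          ∑ m ∈ A, z m q.1 * (starRingEnd ℂ) (z m q.2) := by
      rw [sum_comm]
      push_cast
      refine sum_congr rfl fun m _ => ?_
      rw [← norm_sq_sum_eq]
      push_cast
      rfl
    have h5 : ∑ m ∈ A, ‖∑ p ∈ B.filter (fun p => cl p = k), z m p‖ ^ 2 =
        ‖((∑ m ∈ A, ‖∑ p ∈ B.filter (fun p => cl p = k), z m p‖ ^ 2 : ℝ) : ℂ)‖ := by
      rw [Complex.norm_real, Real.norm_of_nonneg (by positivity)]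
    rw [h5, e2]
    exact norm_sum_le _ _
  calc ‖∑ m ∈ A, a m * ∑ p ∈ B, z m p‖ ^ 2
      ≤ (∑ m ∈ A, ‖∑ p ∈ B, z m p‖) ^ 2 := pow_le_pow_left₀ (norm_nonneg _) h1 2
    _ ≤ #A * ∑ m ∈ A, ‖∑ p ∈ B, z m p‖ ^ 2 := sq_sum_le_card_mul_sum_sq
    _ ≤ #A * ∑ m ∈ A, K * ∑ k ∈ range K, ‖∑ p ∈ B.filter (fun p => cl p = k), z m p‖ ^ 2 := by
        gcongr with m _
        exact h2 m
    _ = #A * K * ∑ k ∈ range K, ∑ m ∈ A, ‖∑ p ∈ B.filter (fun p => cl p = k), z m p‖ ^ 2 := by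
        rw [← mul_sum, sum_comm, mul_assoc]
    _ ≤ #A * K * ∑ k ∈ range K,
          ∑ q ∈ (B.filter fun p => cl p = k) ×ˢ (B.filter fun p => cl p = k),
            ‖∑ m ∈ A, z m q.1 * (starRingEnd ℂ) (z m q.2)‖ := by
        gcongr with k _
        exact h4 k
    _ = _ := by
        congr 1
        have hm : ∀ q ∈ (B ×ˢ B).filter (fun q => cl q.1 = cl q.2), cl q.1 ∈ range K :=
          fun q hq => mem_range.2 (hcl _ (mem_product.1 (mem_filter.1 hq).1).1)
        rw [← sum_fiberwise_of_maps_to hm]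
        refine sum_congr rfl fun k _ => sum_congr ?_ fun _ _ => rfl
        ext q
        simp only [mem_product, mem_filter]
        constructor
        · rintro ⟨⟨h1, h2⟩, h3, h4⟩
          exact ⟨⟨⟨h1, h3⟩, h2.trans h4.symm⟩, h2⟩
        · rintro ⟨⟨⟨h1, h3⟩, h2⟩, h4⟩
          exact ⟨⟨h1, h4⟩, h3, h2 ▸ h4⟩

/-- The trilinear sum with positive frequencies `h`. -/
noncomputable def triSum (γ X M N V β : ℝ) (a d : ℕ → ℂ) : ℂ :=
  ∑ m ∈ dyN M, ∑ n ∈ (dyN N).filter (fun n => X / 2 ≤ ((m * n : ℕ) : ℝ) ∧ ((m * n : ℕ) : ℝ) < X),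
    ∑ h ∈ dyN V, a m * d h * e (β * m * n + h * ((m : ℝ) * n) ^ γ)

lemma dyN_pos {Y : ℝ} (hY : 1 ≤ Y) {m : ℕ} (hm : m ∈ dyN Y) : 0 < (m : ℝ) := by
  have := (mem_dyN.1 hm).1
  linarith

set_option maxHeartbeats 1000000 in
/-- Bound for the trilinear sum through the spacing of the points `h n ^ γ`. -/
lemma exists_norm_triSum_sq_le_of_spacing {γ : ℝ} (h0 : 0 < γ) (h1 : γ < 1) :
    ∃ C : ℝ, 0 < C ∧ ∀ (X M N V β Q : ℝ) (a d : ℕ → ℂ), 1 ≤ M → 1 ≤ N → 1 ≤ V → 1 ≤ Q →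
      Q ≤ V * N → (∀ m ∈ dyN M, ‖a m‖ ≤ 1) → (∀ h ∈ dyN V, ‖d h‖ ≤ 1) →
      ‖triSum γ X M N V β a d‖ ^ 2 ≤ C * ((1 + Real.log V) * (1 + Real.log N)) *
        ((V * N) ^ 2 * M * (M / Q + √(Q * (M * N) ^ γ / N) + M * √(N / (M * N) ^ γ))) := by
  obtain ⟨C1, hC1, hexp⟩ := exists_norm_sum_e_rpow_le h0 h1
  set C2 : ℝ := 64 / γ with hC2
  have hC20 : 0 < C2 := by positivity
  refine ⟨16 * C2 + 16 * C2 * C1, by positivity, ?_⟩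
  intro X M N V β Q a d hM hN hV hQ hQP ha hd
  have hM0 : 0 < M := by linarith
  have hN0 : 0 < N := by linarith
  have hV0 : 0 < V := by linarith
  have hQ0 : 0 < Q := by linarith
  set P := V * N with hP
  have hP0 : 0 < P := by positivity
  set Lg := (1 + Real.log V) * (1 + Real.log N) with hLg
  have hLg0 : 0 ≤ Lg :=
    mul_nonneg (by linarith [Real.log_nonneg hV]) (by linarith [Real.log_nonneg hN])
  set Y := V * N ^ γ with hY
  have hY0 : 0 < Y := by positivity
  set K := ⌊P / Q⌋₊ with hK
  have hPQ : 1 ≤ P / Q := (one_le_div hQ0).2 hQP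
  have hK1 : 1 ≤ K := Nat.le_floor (by exact_mod_cast hPQ)
  have hK0 : (0 : ℝ) < K := by exact_mod_cast hK1
  have hKle : (K : ℝ) ≤ P / Q := Nat.floor_le (by positivity)
  have hKge : P / Q ≤ 2 * K := by
    have := (Nat.lt_floor_add_one (P / Q)).le
    have h2 : (1 : ℝ) ≤ K := by exact_mod_cast hK1
    linarith
  set y : ℕ × ℕ → ℝ := fun p => p.1 * (p.2 : ℝ) ^ γ with hy
  set B := dyN V ×ˢ dyN N with hB
  have hyB : ∀ p ∈ B, 0 < y p ∧ y p < Y := by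
    intro p hp
    obtain ⟨hp1, hp2⟩ := mem_product.1 hp
    have q1 := dyN_pos hV hp1
    have q2 := dyN_pos hN hp2
    refine ⟨by positivity, ?_⟩
    exact mul_lt_mul_of_pos_of_nonneg' (mem_dyN.1 hp1).2
      (Real.rpow_le_rpow q2.le (mem_dyN.1 hp2).2.le h0.le) (by positivity) hV0.le
  set cl : ℕ × ℕ → ℕ := fun p => ⌊K * (y p / Y)⌋₊ with hcl
  have hclK : ∀ p ∈ B, cl p < K := by
    intro p hp
    obtain ⟨q1, q2⟩ := hyB p hp
    rw [hcl, Nat.floor_lt (by positivity)]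
    exact mul_lt_of_lt_one_right hK0 ((div_lt_one hY0).2 q2)
  have hnear : ∀ p ∈ B, ∀ q ∈ B, cl p = cl q → |y p - y q| ≤ 1 / K * Y := by
    intro p hp q hq h
    obtain ⟨p1, p2⟩ := hyB p hp
    obtain ⟨q1, q2⟩ := hyB q hq
    have f1 := Nat.floor_le (show 0 ≤ K * (y p / Y) by positivity)
    have f2 := Nat.lt_floor_add_one (K * (y p / Y))
    have f3 := Nat.floor_le (show 0 ≤ K * (y q / Y) by positivity)
    have f4 := Nat.lt_floor_add_one (K * (y q / Y))
    have h' : (⌊K * (y p / Y)⌋₊ : ℝ) = ⌊K * (y q / Y)⌋₊ := by exact_mod_cast h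
    have f5 : |K * (y p / Y) - K * (y q / Y)| ≤ 1 := by rw [abs_le]; constructor <;> linarith
    have f6 : y p - y q = (K * (y p / Y) - K * (y q / Y)) * (1 / K * Y) := by field_simp
    rw [f6, abs_mul, abs_of_pos (show 0 < 1 / K * Y by positivity)]
    exact mul_le_of_le_one_left (by positivity) f5
  set z : ℕ → ℕ × ℕ → ℂ := fun m p =>
    if X / 2 ≤ ((m * p.2 : ℕ) : ℝ) ∧ ((m * p.2 : ℕ) : ℝ) < X then
      d p.1 * e (β * m * p.2 + p.1 * ((m : ℝ) * p.2) ^ γ) else 0 with hz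
  have hT : triSum γ X M N V β a d = ∑ m ∈ dyN M, a m * ∑ p ∈ B, z m p := by
    rw [triSum]
    refine sum_congr rfl fun m _ => ?_
    rw [hB, sum_product_right, sum_filter, mul_sum]
    refine sum_congr rfl fun n _ => ?_
    simp only [hz]
    split_ifs with hc
    · rw [mul_sum]
      exact sum_congr rfl fun h _ => by ring
    · simp
  set F := Y * M ^ γ with hF
  have hF0 : 0 < F := by positivity
  set Δ := 1 / (Q * K) with hΔ
  have hΔ0 : 0 < Δ := by positivity
  have htriv : ∀ q ∈ B ×ˢ B, ‖∑ m ∈ dyN M, z m q.1 * (starRingEnd ℂ) (z m q.2)‖ ≤ 2 * M := by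
    intro q hq
    obtain ⟨hq1, hq2⟩ := mem_product.1 hq
    have hz1 : ∀ p ∈ B, ∀ m, ‖z m p‖ ≤ 1 := by
      intro p hp m
      simp only [hz]
      split_ifs
      · rw [norm_mul, norm_e, mul_one]
        exact hd _ (mem_product.1 hp).1
      · simp
    refine (norm_sum_le_of_le (n := fun _ => (1 : ℝ)) _ fun m _ => ?_).trans ?_
    · rw [norm_mul, RCLike.norm_conj]
      exact mul_le_one₀ (hz1 _ hq1 m) (norm_nonneg _) (hz1 _ hq2 m)
    · rw [sum_const, nsmul_eq_mul, mul_one]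
      exact card_dyN_le hM
  have hosc : ∀ q ∈ B ×ˢ B, Δ * Y < |y q.1 - y q.2| → |y q.1 - y q.2| ≤ 1 / K * Y →
      ‖∑ m ∈ dyN M, z m q.1 * (starRingEnd ℂ) (z m q.2)‖ ≤
        C1 * (√(1 / K * F) + M / √(Δ * F)) := by
    intro q hq hlo hhi
    obtain ⟨hq1, hq2⟩ := mem_product.1 hq
    set c1 : ℕ → Prop := fun m => (X / 2 ≤ ((m * q.1.2 : ℕ) : ℝ) ∧ ((m * q.1.2 : ℕ) : ℝ) < X) ∧
      (X / 2 ≤ ((m * q.2.2 : ℕ) : ℝ) ∧ ((m * q.2.2 : ℕ) : ℝ) < X) with hc1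
    classical
    obtain ⟨u, v, huv⟩ := exists_dyN_filter_eq_Ico M c1 (by
      rintro i j k hij hjk ⟨⟨i1, -⟩, i2, -⟩ ⟨⟨-, k1⟩, -, k2⟩
      have w1 : ∀ n : ℕ, ((i * n : ℕ) : ℝ) ≤ ((j * n : ℕ) : ℝ) := fun n => by
        exact_mod_cast Nat.mul_le_mul_right n hij
      have w2 : ∀ n : ℕ, ((j * n : ℕ) : ℝ) ≤ ((k * n : ℕ) : ℝ) := fun n => by
        exact_mod_cast Nat.mul_le_mul_right n hjk
      exact ⟨⟨i1.trans (w1 _), (w2 _).trans_lt k1⟩, i2.trans (w1 _), (w2 _).trans_lt k2⟩)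
    have hD : y q.1 - y q.2 ≠ 0 := by
      intro h
      rw [h, abs_zero] at hlo
      have : 0 < Δ * Y := by positivity
      linarith
    have e1 : ∑ m ∈ dyN M, z m q.1 * (starRingEnd ℂ) (z m q.2) =
        (d q.1.1 * (starRingEnd ℂ) (d q.2.1)) * ∑ m ∈ Ico u v,
          e ((β * (q.1.2 - q.2.2)) * m + (y q.1 - y q.2) * (m : ℝ) ^ γ) := by
      rw [← huv, sum_filter, mul_sum]
      refine sum_congr rfl fun m _ => ?_
      simp only [hz]
      by_cases t1 : X / 2 ≤ ((m * q.1.2 : ℕ) : ℝ) ∧ ((m * q.1.2 : ℕ) : ℝ) < X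
      · by_cases t2 : X / 2 ≤ ((m * q.2.2 : ℕ) : ℝ) ∧ ((m * q.2.2 : ℕ) : ℝ) < X
        · have hsplit : β * (q.1.2 - q.2.2) * m + (y q.1 - y q.2) * (m : ℝ) ^ γ =
            (β * m * q.1.2 + q.1.1 * ((m : ℝ) * q.1.2) ^ γ) +
              -(β * m * q.2.2 + q.2.1 * ((m : ℝ) * q.2.2) ^ γ) := by
            rw [Real.mul_rpow (by positivity) (by positivity),
              Real.mul_rpow (by positivity) (by positivity)]
            simp only [hy]
            ring
          rw [if_pos t1, if_pos t2, if_pos ⟨t1, t2⟩, map_mul, conj_e, hsplit, e_add _ (-_)]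
          ring
        · rw [if_neg t2, if_neg (show ¬(_ ∧ _) from fun h => t2 h.2)]
          simp only [map_zero, mul_zero]
      · rw [if_neg t1, if_neg (show ¬(_ ∧ _) from fun h => t1 h.1)]
        simp only [zero_mul, mul_zero]
    have hcoef : ‖d q.1.1 * (starRingEnd ℂ) (d q.2.1)‖ ≤ 1 := by
      rw [norm_mul, RCLike.norm_conj]
      exact mul_le_one₀ (hd _ (mem_product.1 hq1).1) (norm_nonneg _) (hd _ (mem_product.1 hq2).1)
    rw [e1, norm_mul]
    refine (mul_le_of_le_one_left (norm_nonneg _) hcoef).trans ((hexp u v M _ _ hM hD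
      fun n hn => ?_).trans ?_)
    · rw [← huv] at hn
      exact mem_dyN.1 (mem_filter.1 hn).1
    · have g1 : |y q.1 - y q.2| * M ^ γ ≤ 1 / K * F := by
        rw [hF, ← mul_assoc]; gcongr
      have g2 : Δ * F ≤ |y q.1 - y q.2| * M ^ γ := by
        rw [hF, ← mul_assoc]; gcongr
      have g3 : 0 < √(Δ * F) := Real.sqrt_pos.2 (by positivity)
      gcongr
  have hcount : ∀ D : ℝ, 0 ≤ D → (#((B ×ˢ B).filter fun q => |y q.1 - y q.2| ≤ D * Y) : ℝ) ≤
      C2 * (P + D * P ^ 2) * Lg := by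
    intro D hD
    refine (card_near_coincidences_le h0 h1.le hV hN hD).trans ?_
    refine mul_le_mul_of_nonneg_left (mul_le_mul (sum_one_div_le_one_add_log hV)
      (sum_one_div_le_one_add_log hN) (sum_nonneg fun _ _ => by positivity)
      (by linarith [Real.log_nonneg hV])) (by positivity)
  set E := C1 * (√(1 / K * F) + M / √(Δ * F)) with hE
  have hE0 : 0 ≤ E := by positivity
  have hsum : ∑ q ∈ (B ×ˢ B).filter (fun q => cl q.1 = cl q.2),
      ‖∑ m ∈ dyN M, z m q.1 * (starRingEnd ℂ) (z m q.2)‖ ≤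
      (C2 * (P + Δ * P ^ 2) * Lg) * (2 * M) + (C2 * (P + 1 / K * P ^ 2) * Lg) * E := by
    calc _ ≤ ∑ q ∈ (B ×ˢ B).filter (fun q => cl q.1 = cl q.2),
          ((if |y q.1 - y q.2| ≤ Δ * Y then 2 * M else 0) +
            (if |y q.1 - y q.2| ≤ 1 / K * Y then E else 0)) := by
          refine sum_le_sum fun q hq => ?_
          obtain ⟨hq1, hq2⟩ := mem_filter.1 hq
          have hq3 := hnear _ (mem_product.1 hq1).1 _ (mem_product.1 hq1).2 hq2
          rw [if_pos hq3]
          split_ifs with hs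
          · linarith [htriv q hq1]
          · rw [zero_add]
            exact hosc q hq1 (not_le.1 hs) hq3
      _ ≤ ∑ q ∈ B ×ˢ B, ((if |y q.1 - y q.2| ≤ Δ * Y then 2 * M else 0) +
            (if |y q.1 - y q.2| ≤ 1 / K * Y then E else 0)) := by
          refine sum_le_sum_of_subset_of_nonneg (filter_subset _ _) fun q _ _ => ?_
          split_ifs <;> positivity
      _ = (#((B ×ˢ B).filter fun q => |y q.1 - y q.2| ≤ Δ * Y) : ℝ) * (2 * M) +
            (#((B ×ˢ B).filter fun q => |y q.1 - y q.2| ≤ 1 / K * Y) : ℝ) * E := by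
          rw [sum_add_distrib, ← sum_filter, ← sum_filter, sum_const, sum_const, nsmul_eq_mul,
            nsmul_eq_mul]
      _ ≤ _ := by
          have := hcount Δ hΔ0.le
          have := hcount (1 / K) (by positivity)
          gcongr
  have hbil := norm_sq_bilinear_le_classes (dyN M) B K cl hclK a ha z
  rw [hT]
  refine hbil.trans ?_
  have hs1 : √(1 / K * F) ≤ 2 * √(Q * (M * N) ^ γ / N) := by
    rw [show (2 : ℝ) = √4 by rw [show (4 : ℝ) = 2 ^ 2 by norm_num]; simp,
      ← Real.sqrt_mul (by norm_num)]
    apply Real.sqrt_le_sqrt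
    have : 1 / (K : ℝ) ≤ 2 * Q / P := by
      rw [div_le_div_iff₀ hK0 hP0]
      rw [div_le_iff₀ hQ0] at hKge
      linarith
    calc 1 / (K : ℝ) * F ≤ 2 * Q / P * F := by gcongr
      _ = 2 * (Q * (M * N) ^ γ / N) := by
        rw [hF, hY, hP, Real.mul_rpow hM0.le hN0.le]; field_simp
      _ ≤ 4 * (Q * (M * N) ^ γ / N) := by gcongr; norm_num
  have hs2 : M / √(Δ * F) ≤ M * √(N / (M * N) ^ γ) := by
    rw [div_eq_mul_inv, ← Real.sqrt_inv]
    gcongr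
    have : P⁻¹ ≤ Δ := by
      rw [hΔ, one_div]
      apply inv_anti₀ (by positivity)
      rw [le_div_iff₀ hQ0] at hKle
      linarith
    calc (Δ * F)⁻¹ ≤ (P⁻¹ * F)⁻¹ := by gcongr
      _ = N / (M * N) ^ γ := by
        rw [hF, hY, hP, Real.mul_rpow hM0.le hN0.le]; field_simp
  set A1 := √(Q * (M * N) ^ γ / N) with hA1
  set A2 := M * √(N / (M * N) ^ γ) with hA2
  have hA10 : 0 ≤ A1 := Real.sqrt_nonneg _
  have hA20 : 0 ≤ A2 := by positivity
  have hE2 : E ≤ 2 * C1 * (A1 + A2) := by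
    calc E ≤ C1 * (2 * A1 + A2) := by rw [hE]; gcongr
      _ ≤ 2 * C1 * (A1 + A2) := by nlinarith
  have hKP : K * P ≤ P ^ 2 / Q := by
    calc K * P ≤ P / Q * P := by gcongr
      _ = P ^ 2 / Q := by ring
  have hKP2 : K * P ≤ P ^ 2 := hKP.trans (div_le_self (by positivity) hQ)
  calc (#(dyN M) : ℝ) * K * ∑ q ∈ (B ×ˢ B).filter (fun q => cl q.1 = cl q.2),
        ‖∑ m ∈ dyN M, z m q.1 * (starRingEnd ℂ) (z m q.2)‖
      ≤ 2 * M * K * ((C2 * (P + Δ * P ^ 2) * Lg) * (2 * M) +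
          (C2 * (P + 1 / K * P ^ 2) * Lg) * (2 * C1 * (A1 + A2))) := by
        have := card_dyN_le hM
        gcongr
        refine hsum.trans ?_
        gcongr
    _ = 4 * C2 * Lg * M * (M * (K * P + P ^ 2 / Q)) +
          4 * C2 * C1 * Lg * M * ((K * P + P ^ 2) * (A1 + A2)) := by
        rw [hΔ]; field_simp; ring
    _ ≤ 4 * C2 * Lg * M * (M * (P ^ 2 / Q + P ^ 2 / Q)) +
          4 * C2 * C1 * Lg * M * ((P ^ 2 + P ^ 2) * (A1 + A2)) := by
        gcongr
    _ = 8 * C2 * Lg * (P ^ 2 * M * (M / Q)) + 8 * C2 * C1 * Lg * (P ^ 2 * M * (A1 + A2)) := by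
        ring
    _ ≤ (16 * C2 + 16 * C2 * C1) * Lg * (P ^ 2 * M * (M / Q)) +
          (16 * C2 + 16 * C2 * C1) * Lg * (P ^ 2 * M * (A1 + A2)) := by
        have u1 : 0 < C2 * C1 := by positivity
        gcongr <;> linarith
    _ = _ := by ring

/-- Bound for the trilinear sum from the sum over `n` alone. -/
lemma exists_norm_triSum_le_of_long {γ : ℝ} (h0 : 0 < γ) (h1 : γ < 1) :
    ∃ C : ℝ, 0 < C ∧ ∀ (X M N V β : ℝ) (a d : ℕ → ℂ), 1 ≤ M → 1 ≤ N → 1 ≤ V →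
      (∀ m ∈ dyN M, ‖a m‖ ≤ 1) → (∀ h ∈ dyN V, ‖d h‖ ≤ 1) →
      ‖triSum γ X M N V β a d‖ ≤
        C * (V * M * (√(V * (M * N) ^ γ) + N / √(V * (M * N) ^ γ))) := by
  obtain ⟨C1, hC1, hexp⟩ := exists_norm_sum_e_rpow_le h0 h1
  refine ⟨8 * C1, by positivity, ?_⟩
  intro X M N V β a d hM hN hV ha hd
  have hM0 : 0 < M := by linarith
  have hN0 : 0 < N := by linarith
  have hV0 : 0 < V := by linarith
  set F := V * (M * N) ^ γ with hF
  have hF0 : 0 < F := by positivity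
  set E := C1 * (2 * √F + 2 * (N / √F)) with hE
  have hE0 : 0 ≤ E := by positivity
  have hinner : ∀ m ∈ dyN M, ∀ h ∈ dyN V,
      ‖∑ n ∈ (dyN N).filter (fun n => X / 2 ≤ ((m * n : ℕ) : ℝ) ∧ ((m * n : ℕ) : ℝ) < X),
        e (β * m * n + h * ((m : ℝ) * n) ^ γ)‖ ≤ E := by
    intro m hm h hh
    have hm0 := dyN_pos hM hm
    have hh0 := dyN_pos hV hh
    obtain ⟨u, v, huv⟩ := exists_dyN_filter_eq_Ico N
      (fun n => X / 2 ≤ ((m * n : ℕ) : ℝ) ∧ ((m * n : ℕ) : ℝ) < X) (by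
        rintro i j k hij hjk ⟨i1, -⟩ ⟨-, k1⟩
        have w1 : ((m * i : ℕ) : ℝ) ≤ ((m * j : ℕ) : ℝ) := by
          exact_mod_cast Nat.mul_le_mul_left m hij
        have w2 : ((m * j : ℕ) : ℝ) ≤ ((m * k : ℕ) : ℝ) := by
          exact_mod_cast Nat.mul_le_mul_left m hjk
        exact ⟨i1.trans w1, w2.trans_lt k1⟩)
    rw [huv]
    have hG : |(h : ℝ) * (m : ℝ) ^ γ| * N ^ γ = h * (m : ℝ) ^ γ * N ^ γ := by
      rw [abs_of_pos (by positivity)]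
    have g1 : |(h : ℝ) * (m : ℝ) ^ γ| * N ^ γ ≤ F := by
      rw [hG, hF, Real.mul_rpow hM0.le hN0.le, ← mul_assoc]
      gcongr
      · exact (mem_dyN.1 hh).2.le
      · exact (mem_dyN.1 hm).2.le
    have g2 : F / 4 ≤ |(h : ℝ) * (m : ℝ) ^ γ| * N ^ γ := by
      have l1 : V ≤ 2 * h := by linarith [(mem_dyN.1 hh).1]
      have l2 : M ^ γ ≤ 2 * (m : ℝ) ^ γ := by
        calc M ^ γ ≤ (2 * m) ^ γ :=
              Real.rpow_le_rpow hM0.le (by linarith [(mem_dyN.1 hm).1]) h0.le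
          _ = 2 ^ γ * (m : ℝ) ^ γ := Real.mul_rpow (by norm_num) hm0.le
          _ ≤ 2 * (m : ℝ) ^ γ := by
            gcongr
            calc (2 : ℝ) ^ γ ≤ 2 ^ (1 : ℝ) :=
                  Real.rpow_le_rpow_of_exponent_le (by norm_num) h1.le
              _ = 2 := Real.rpow_one 2
      have l3 : V * M ^ γ ≤ 2 * h * (2 * (m : ℝ) ^ γ) := by gcongr
      rw [hG, hF, Real.mul_rpow hM0.le hN0.le]
      have l4 := mul_le_mul_of_nonneg_right l3 (show 0 ≤ N ^ γ by positivity)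
      linarith
    have hsum : ∑ n ∈ Ico u v, e (β * m * n + h * ((m : ℝ) * n) ^ γ) =
        ∑ n ∈ Ico u v, e ((β * m) * n + (h * (m : ℝ) ^ γ) * (n : ℝ) ^ γ) := by
      refine sum_congr rfl fun n _ => ?_
      rw [Real.mul_rpow hm0.le (by positivity), mul_assoc (h : ℝ)]
    rw [hsum]
    refine (hexp u v N _ _ hN (by positivity) fun n hn => ?_).trans ?_
    · rw [← huv] at hn
      exact mem_dyN.1 (mem_filter.1 hn).1
    · have s1 : √(F / 4) = √F / 2 := by
        rw [Real.sqrt_div' _ (by norm_num), show (4 : ℝ) = 2 ^ 2 by norm_num]; simp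
      have s2 : √F / 2 ≤ √(|(h : ℝ) * (m : ℝ) ^ γ| * N ^ γ) := s1 ▸ Real.sqrt_le_sqrt g2
      have s3 : 0 < √F := Real.sqrt_pos.2 hF0
      have s4 : √(|(h : ℝ) * (m : ℝ) ^ γ| * N ^ γ) ≤ √F := Real.sqrt_le_sqrt g1
      rw [hE]
      gcongr
      · linarith
      · calc N / √(|(h : ℝ) * (m : ℝ) ^ γ| * N ^ γ) ≤ N / (√F / 2) := by gcongr
          _ = 2 * (N / √F) := by field_simp
  have hT : triSum γ X M N V β a d = ∑ m ∈ dyN M, ∑ h ∈ dyN V, a m * d h *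
      ∑ n ∈ (dyN N).filter (fun n => X / 2 ≤ ((m * n : ℕ) : ℝ) ∧ ((m * n : ℕ) : ℝ) < X),
        e (β * m * n + h * ((m : ℝ) * n) ^ γ) := by
    rw [triSum]
    refine sum_congr rfl fun m _ => ?_
    rw [sum_comm]
    simp_rw [mul_sum]
  rw [hT]
  calc _ ≤ ∑ m ∈ dyN M, ∑ h ∈ dyN V, E := by
        refine norm_sum_le_of_le _ fun m hm => norm_sum_le_of_le _ fun h hh => ?_
        rw [norm_mul, norm_mul]
        refine (mul_le_of_le_one_left (norm_nonneg _)
          (mul_le_one₀ (ha m hm) (norm_nonneg _) (hd h hh))).trans (hinner m hm h hh)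
    _ = #(dyN M) * (#(dyN V) * E) := by simp
    _ ≤ 2 * M * (2 * V * E) := by
        have := card_dyN_le hM
        have := card_dyN_le hV
        gcongr
    _ = 8 * C1 * (V * M * (√F + N / √F)) := by rw [hE]; ring

lemma hasDerivAt_max_zero_sq (t : ℝ) : HasDerivAt (fun t : ℝ => max 0 t ^ 2) (2 * max 0 t) t := by
  have h : ∀ s : ℝ, |max 0 s ^ 2 - max 0 t ^ 2 - (s - t) * (2 * max 0 t)| ≤ (s - t) ^ 2 := by
    intro s
    rcases le_total 0 s with hs | hs <;> rcases le_total 0 t with ht | ht <;>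
      simp only [hs, ht, max_eq_left, max_eq_right] <;> rw [abs_le] <;> constructor <;> nlinarith
  rw [hasDerivAt_iff_isLittleO]
  refine Asymptotics.IsBigO.trans_isLittleO (g := fun s => (s - t) ^ 2) ?_ ?_
  · refine Asymptotics.IsBigO.of_bound 1 (Filter.Eventually.of_forall fun s => ?_)
    rw [Real.norm_eq_abs, Real.norm_eq_abs, abs_of_nonneg (sq_nonneg (s - t)), one_mul,
      smul_eq_mul]
    exact h s
  · have h2 : Filter.Tendsto (fun s : ℝ => s - t) (nhds t) (nhds 0) := by
      have : Filter.Tendsto (fun s : ℝ => s - t) (nhds t) (nhds (t - t)) :=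
        (continuous_id.sub continuous_const).tendsto t
      rwa [sub_self] at this
    exact (Asymptotics.isLittleO_pow_id (𝕜 := ℝ) (n := 2) (by norm_num)).comp_tendsto h2

/-- A continuously differentiable weight supported on `[1/4, 2]` and at least `1` on `[1/2, 1]`. -/
noncomputable def bump (u : ℝ) : ℝ := 8 * max 0 ((u - 1 / 4) * (2 - u)) ^ 2

/-- The derivative of `bump`. -/
noncomputable def bump' (u : ℝ) : ℝ := 16 * max 0 ((u - 1 / 4) * (2 - u)) * (9 / 4 - 2 * u)

lemma hasDerivAt_bump (u : ℝ) : HasDerivAt bump (bump' u) u := by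
  have h1 : HasDerivAt (fun u : ℝ => (u - 1 / 4) * (2 - u)) (1 * (2 - u) + (u - 1 / 4) * -1) u :=
    ((hasDerivAt_id u).sub_const _).mul ((hasDerivAt_id u).const_sub _)
  have h2 := ((hasDerivAt_max_zero_sq ((u - 1 / 4) * (2 - u))).comp u h1).const_mul 8
  exact h2.congr_deriv (by unfold bump'; ring)

lemma continuous_bump : Continuous bump := by unfold bump; fun_prop

lemma continuous_bump' : Continuous bump' := by unfold bump'; fun_prop

lemma bump_nonneg (u : ℝ) : 0 ≤ bump u := by unfold bump; positivity

lemma one_le_bump {u : ℝ} (h1 : 1 / 2 ≤ u) (h2 : u ≤ 1) : 1 ≤ bump u := by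
  have h : 3 / 8 ≤ max 0 ((u - 1 / 4) * (2 - u)) := le_max_of_le_right (by nlinarith)
  unfold bump
  nlinarith

lemma bump_eq_zero {u : ℝ} (h : u ≤ 1 / 4 ∨ 2 ≤ u) : bump u = 0 := by
  have : (u - 1 / 4) * (2 - u) ≤ 0 := by rcases h with h | h <;> nlinarith
  rw [bump, max_eq_left this]; norm_num

lemma bump'_eq_zero {u : ℝ} (h : u ≤ 1 / 4 ∨ 2 ≤ u) : bump' u = 0 := by
  have : (u - 1 / 4) * (2 - u) ≤ 0 := by rcases h with h | h <;> nlinarith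
  rw [bump', max_eq_left this]; norm_num

lemma bump_eq_of_mem {u : ℝ} (h1 : 1 / 4 ≤ u) (h2 : u ≤ 2) :
    bump u = 8 * ((u - 1 / 4) * (2 - u)) ^ 2 := by
  have : 0 ≤ (u - 1 / 4) * (2 - u) := mul_nonneg (by linarith) (by linarith)
  rw [bump, max_eq_right this]

lemma bump'_eq_of_mem {u : ℝ} (h1 : 1 / 4 ≤ u) (h2 : u ≤ 2) :
    bump' u = 16 * ((u - 1 / 4) * (2 - u)) * (9 / 4 - 2 * u) := by
  have : 0 ≤ (u - 1 / 4) * (2 - u) := mul_nonneg (by linarith) (by linarith)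
  rw [bump', max_eq_right this]

/-- The projection to `[1/4, 2]`. -/
noncomputable def clampBump (u : ℝ) : ℝ := max (1 / 4) (min 2 u)

lemma clampBump_mem (u : ℝ) : 1 / 4 ≤ clampBump u ∧ clampBump u ≤ 2 :=
  ⟨le_max_left _ _, max_le (by norm_num) (min_le_left _ _)⟩

lemma abs_clampBump_sub_le (u v : ℝ) : |clampBump u - clampBump v| ≤ |u - v| := by
  unfold clampBump
  rw [max_comm (1 / 4), max_comm (1 / 4), min_comm 2 u, min_comm 2 v]
  exact (abs_max_sub_max_le_abs _ _ _).trans (abs_inf_sub_inf_le_abs _ _ _)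

lemma comp_clampBump {f : ℝ → ℝ} (hf : ∀ u, u ≤ 1 / 4 ∨ 2 ≤ u → f u = 0) (u : ℝ) :
    f (clampBump u) = f u := by
  unfold clampBump
  rcases le_total u (1 / 4) with h | h
  · rw [min_eq_right (by linarith), max_eq_left h, hf u (Or.inl h), hf _ (Or.inl le_rfl)]
  · rcases le_total u 2 with h2 | h2
    · rw [min_eq_right h2, max_eq_right h]
    · rw [min_eq_left h2, max_eq_right (by norm_num), hf u (Or.inr h2), hf _ (Or.inr le_rfl)]

lemma abs_bump_sub_le (u v : ℝ) : |bump u - bump v| ≤ 100 * |u - v| := by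
  rw [← comp_clampBump (fun _ => bump_eq_zero) u, ← comp_clampBump (fun _ => bump_eq_zero) v]
  refine le_trans ?_ (mul_le_mul_of_nonneg_left (abs_clampBump_sub_le u v) (by norm_num))
  obtain ⟨a1, a2⟩ := clampBump_mem u
  obtain ⟨b1, b2⟩ := clampBump_mem v
  generalize clampBump u = x at *
  generalize clampBump v = y at *
  rw [bump_eq_of_mem a1 a2, bump_eq_of_mem b1 b2]
  have e1 : 8 * ((x - 1 / 4) * (2 - x)) ^ 2 - 8 * ((y - 1 / 4) * (2 - y)) ^ 2 =
      (8 * (((x - 1 / 4) * (2 - x)) + ((y - 1 / 4) * (2 - y))) * (9 / 4 - x - y)) * (x - y) := by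
    ring
  rw [e1, abs_mul]
  refine mul_le_mul_of_nonneg_right ?_ (abs_nonneg _)
  rw [abs_mul, abs_mul]
  have l1 : |((x - 1 / 4) * (2 - x)) + ((y - 1 / 4) * (2 - y))| ≤ 2 := by
    rw [abs_le]; constructor <;> nlinarith [sq_nonneg (x - 9 / 8), sq_nonneg (y - 9 / 8),
      mul_nonneg (sub_nonneg.2 a1) (sub_nonneg.2 a2),
        mul_nonneg (sub_nonneg.2 b1) (sub_nonneg.2 b2)]
  have l2 : |9 / 4 - x - y| ≤ 2 := by rw [abs_le]; constructor <;> linarith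
  rw [abs_of_pos (by norm_num : (0 : ℝ) < 8)]
  nlinarith [abs_nonneg (((x - 1 / 4) * (2 - x)) + ((y - 1 / 4) * (2 - y))),
    abs_nonneg (9 / 4 - x - y)]

lemma abs_bump'_sub_le (u v : ℝ) : |bump' u - bump' v| ≤ 100 * |u - v| := by
  rw [← comp_clampBump (fun _ => bump'_eq_zero) u, ← comp_clampBump (fun _ => bump'_eq_zero) v]
  refine le_trans ?_ (mul_le_mul_of_nonneg_left (abs_clampBump_sub_le u v) (by norm_num))
  obtain ⟨a1, a2⟩ := clampBump_mem u
  obtain ⟨b1, b2⟩ := clampBump_mem v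
  generalize clampBump u = x at *
  generalize clampBump v = y at *
  rw [bump'_eq_of_mem a1 a2, bump'_eq_of_mem b1 b2]
  have e1 : 16 * ((x - 1 / 4) * (2 - x)) * (9 / 4 - 2 * x) -
      16 * ((y - 1 / 4) * (2 - y)) * (9 / 4 - 2 * y) =
      (16 * ((9 / 4 - x - y) * (9 / 4 - 2 * x) - 2 * ((y - 1 / 4) * (2 - y)))) * (x - y) := by
    ring
  rw [e1, abs_mul]
  refine mul_le_mul_of_nonneg_right ?_ (abs_nonneg _)
  have l1 : 0 ≤ (y - 1 / 4) * (2 - y) := mul_nonneg (by linarith) (by linarith)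
  have l2 : (y - 1 / 4) * (2 - y) ≤ 49 / 64 := by nlinarith [sq_nonneg (y - 9 / 8)]
  have l3 : |(9 / 4 - x - y) * (9 / 4 - 2 * x)| ≤ 7 / 4 * (7 / 4) := by
    rw [abs_mul]
    refine mul_le_mul ?_ ?_ (abs_nonneg _) (by norm_num) <;> rw [abs_le] <;> constructor <;>
      linarith
  have l4 := abs_le.1 l3
  rw [abs_le]; constructor <;> linarith

lemma bump_le (u : ℝ) : |bump u| ≤ 8 := by
  rw [abs_of_nonneg (bump_nonneg u), ← comp_clampBump (fun _ => bump_eq_zero) u]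
  obtain ⟨a1, a2⟩ := clampBump_mem u
  rw [bump_eq_of_mem a1 a2]
  have l1 : 0 ≤ (clampBump u - 1 / 4) * (2 - clampBump u) := mul_nonneg (by linarith) (by linarith)
  have l2 : (clampBump u - 1 / 4) * (2 - clampBump u) ≤ 1 := by
    nlinarith [sq_nonneg (clampBump u - 9 / 8)]
  nlinarith

lemma bump'_le (u : ℝ) : |bump' u| ≤ 100 := by
  rw [← comp_clampBump (fun _ => bump'_eq_zero) u]
  obtain ⟨a1, a2⟩ := clampBump_mem u
  rw [bump'_eq_of_mem a1 a2, abs_mul, abs_mul]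
  have l1 : 0 ≤ (clampBump u - 1 / 4) * (2 - clampBump u) := mul_nonneg (by linarith) (by linarith)
  have l2 : (clampBump u - 1 / 4) * (2 - clampBump u) ≤ 1 := by
    nlinarith [sq_nonneg (clampBump u - 9 / 8)]
  have l3 : |9 / 4 - 2 * clampBump u| ≤ 7 / 4 := by rw [abs_le]; constructor <;> linarith
  rw [abs_of_nonneg l1, abs_of_pos (by norm_num : (0 : ℝ) < 16)]
  nlinarith [abs_nonneg (9 / 4 - 2 * clampBump u)]

lemma hasDerivAt_e {f : ℝ → ℝ} {f' x : ℝ} (hf : HasDerivAt f f' x) :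
    HasDerivAt (fun x => e (f x)) (2 * Real.pi * Complex.I * f' * e (f x)) x := by
  have h := (hf.ofReal_comp.const_mul (2 * Real.pi * Complex.I)).cexp
  simp only [e]
  exact h.congr_deriv (by ring)

lemma continuous_e : Continuous e := by unfold e; fun_prop

/-- Partial summation against a Lipschitz function of a monotone sequence. -/
lemma norm_sum_lipschitz_mul_le {Z : ℕ → ℝ} {φ : ℕ → ℝ} {g : ℝ → ℝ} {a b : ℕ} {z1 B G L : ℝ}
    (hZ : ∀ n, a ≤ n → n + 1 < b → Z (n + 1) ≤ Z n)
    (hZ0 : ∀ n ∈ Ico a b, 0 ≤ Z n) (hZ1 : ∀ n ∈ Ico a b, Z n ≤ z1)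
    (hB : ∀ k ≤ b, ‖∑ n ∈ Ico a k, e (φ n)‖ ≤ B) (hL : 0 ≤ L) (hG : 0 ≤ G) (hz1 : 0 ≤ z1)
    (hg : ∀ n ∈ Ico a b, |g (Z n)| ≤ G)
    (hlip : ∀ n ∈ Ico a b, ∀ m ∈ Ico a b, |g (Z n) - g (Z m)| ≤ L * |Z n - Z m|) :
    ‖∑ n ∈ Ico a b, (g (Z n) : ℂ) * e (φ n)‖ ≤ B * (G + L * z1) := by
  have hB0 : 0 ≤ B := (norm_nonneg _).trans (hB a |> fun h => by
    by_cases hab : a ≤ b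
    · exact h hab
    · have := hB b le_rfl
      rw [Ico_eq_empty (by omega)] at this ⊢
      exact this)
  rcases Nat.lt_or_ge a b with hab | hab
  swap
  · rw [Ico_eq_empty (by omega), sum_empty, norm_zero]; positivity
  obtain ⟨c, rfl⟩ : ∃ c, b = c + 1 := ⟨b - 1, by omega⟩
  have hac : a ≤ c := by omega
  refine (norm_sum_mul_le_of_partial (c := fun n => (g (Z n) : ℂ))
    (z := fun n => e (φ n)) hac hB).trans
    (mul_le_mul_of_nonneg_left (add_le_add ?_ ?_) hB0)
  · rw [Complex.norm_real]
    exact hg c (mem_Ico.2 ⟨hac, by omega⟩)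
  · have htel : ∀ c, a ≤ c → ∑ n ∈ Ico a c, (Z n - Z (n + 1)) = Z a - Z c := by
      intro c hc
      induction c, hc using Nat.le_induction with
      | base => simp
      | succ c hc ih => rw [sum_Ico_succ_top hc, ih]; ring
    calc ∑ n ∈ Ico a c, ‖(g (Z (n + 1)) : ℂ) - g (Z n)‖
        ≤ ∑ n ∈ Ico a c, L * (Z n - Z (n + 1)) := by
          refine sum_le_sum fun n hn => ?_
          rw [mem_Ico] at hn
          rw [← Complex.ofReal_sub, Complex.norm_real, Real.norm_eq_abs]
          refine (hlip _ (mem_Ico.2 ⟨by omega, by omega⟩) _ (mem_Ico.2 ⟨by omega, by omega⟩)).trans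
            (le_of_eq ?_)
          rw [abs_sub_comm, abs_of_nonneg (sub_nonneg.2 (hZ n hn.1 (by omega)))]
      _ = L * (Z a - Z c) := by rw [← mul_sum, htel c hac]
      _ ≤ L * z1 := by
          refine mul_le_mul_of_nonneg_left ?_ hL
          have := hZ1 a (mem_Ico.2 ⟨le_rfl, by omega⟩)
          have := hZ0 c (mem_Ico.2 ⟨hac, by omega⟩)
          linarith

/-- The normalised stationary phase, with its critical point at `1`. -/
noncomputable def statPhase (γ y : ℝ) : ℝ := y ^ γ - γ * y

/-- The derivative of `statPhase`. -/
noncomputable def statPhase' (γ y : ℝ) : ℝ := γ * y ^ (γ - 1) - γ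

lemma hasDerivAt_statPhase {γ y : ℝ} (hy : 0 < y) :
    HasDerivAt (statPhase γ) (statPhase' γ y) y := by
  have h1 := (Real.hasDerivAt_rpow_const (x := y) (p := γ) (Or.inl hy.ne')).sub
    ((hasDerivAt_id y).const_mul γ)
  exact h1.congr_deriv (by simp [statPhase'])

lemma hasDerivAt_statPhase' {γ y : ℝ} (hy : 0 < y) :
    HasDerivAt (statPhase' γ) (γ * (γ - 1) * y ^ (γ - 2)) y := by
  have h1 := (hasDerivAt_mul_rpow (D := γ) (p := γ - 1) hy).sub_const γ
  exact h1.congr_deriv (by rw [show γ - 1 - 1 = γ - 2 by ring])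

lemma le_abs_statPhase' {γ y C0 : ℝ} (h0 : 0 < γ) (h1 : γ < 1) (hy : 0 < y) (hC0 : 1 ≤ C0)
    (hyC : y ≤ C0) : γ * (1 - γ) / C0 * |y - 1| ≤ |statPhase' γ y| := by
  have hg : 0 < γ * (1 - γ) := mul_pos h0 (by linarith)
  have hC : 0 < C0 := by linarith
  have e1 : statPhase' γ y = γ * (y ^ (γ - 1) - 1) := by rw [statPhase']; ring
  rcases le_total y 1 with h | h
  · have hb := rpow_one_add_le_one_add_mul_self (s := y - 1) (p := 1 - γ) (by linarith)
      (by linarith) (by linarith)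
    rw [add_sub_cancel] at hb
    have hpos : 0 < y ^ (1 - γ) := by positivity
    have h2 : 1 + (1 - γ) * (1 - y) ≤ y ^ (γ - 1) := by
      rw [show γ - 1 = -(1 - γ) by ring, Real.rpow_neg hy.le, ← one_div, le_div_iff₀ hpos]
      nlinarith [mul_nonneg (show 0 ≤ 1 - γ by linarith) (show 0 ≤ 1 - y by linarith)]
    rw [e1, abs_of_nonpos (by linarith : y - 1 ≤ 0), abs_of_nonneg
      (mul_nonneg h0.le (by
        nlinarith [mul_nonneg (show 0 ≤ 1 - γ by linarith) (show 0 ≤ 1 - y by linarith)]))]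
    have h3 : γ * (1 - γ) / C0 ≤ γ * (1 - γ) := div_le_self hg.le hC0
    have h4 := mul_le_mul_of_nonneg_right h3 (show 0 ≤ -(y - 1) by linarith)
    have h5 := mul_le_mul_of_nonneg_left h2 h0.le
    linarith
  · have hb := rpow_one_add_le_one_add_mul_self (s := 1 / y - 1) (p := 1 - γ)
      (by have : 0 < 1 / y := by positivity
          linarith) (by linarith) (by linarith)
    rw [add_sub_cancel, one_div, Real.inv_rpow hy.le, ← Real.rpow_neg hy.le, neg_sub] at hb
    have h3 : (y - 1) / C0 ≤ 1 - y⁻¹ := by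
      rw [show 1 - y⁻¹ = (y - 1) / y by field_simp]
      exact div_le_div_of_nonneg_left (by linarith) hy hyC
    have h4 : (1 - γ) * ((y - 1) / C0) ≤ (1 - γ) * (1 - y⁻¹) :=
      mul_le_mul_of_nonneg_left h3 (by linarith)
    have h5 : 0 ≤ (1 - γ) * ((y - 1) / C0) :=
      mul_nonneg (by linarith) (div_nonneg (by linarith) hC.le)
    rw [e1, abs_of_nonneg (by linarith : 0 ≤ y - 1), abs_of_nonpos
      (by nlinarith)]
    have h6 : γ * (1 - γ) / C0 * (y - 1) = γ * ((1 - γ) * ((y - 1) / C0)) := by ring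
    rw [h6]
    have h7 : (1 - γ) * ((y - 1) / C0) ≤ 1 - y ^ (γ - 1) := by linarith
    have := mul_le_mul_of_nonneg_left h7 h0.le
    linarith

lemma le_statPhase {γ y c0 : ℝ} (h1 : γ < 1) (hc0 : 0 < c0) (hy : c0 ≤ y)
    (hy2 : y ≤ 3 / 2) : c0 * (1 - γ) / 2 ≤ statPhase γ y := by
  have hy0 : 0 < y := hc0.trans_le hy
  have hb : 1 - (1 - γ) * (y - 1) ≤ y ^ (γ - 1) := by
    have := Real.add_one_le_exp (Real.log y * (γ - 1))
    rw [← Real.rpow_def_of_pos hy0] at this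
    have h2 := Real.log_le_sub_one_of_pos hy0
    nlinarith
  have h3 : statPhase γ y = y * (y ^ (γ - 1) - γ) := by
    rw [statPhase, Real.rpow_sub_one hy0.ne']; field_simp
  rw [h3]
  have h4 : (1 - γ) / 2 ≤ y ^ (γ - 1) - γ := by nlinarith
  calc c0 * (1 - γ) / 2 = c0 * ((1 - γ) / 2) := by ring
    _ ≤ y * (y ^ (γ - 1) - γ) := mul_le_mul hy h4 (by linarith) hy0.le

lemma continuousOn_statPhase {γ : ℝ} {s : Set ℝ} (hs : ∀ y ∈ s, 0 < y) :
    ContinuousOn (statPhase γ) s :=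
  fun y hy => (hasDerivAt_statPhase (hs y hy)).continuousAt.continuousWithinAt

lemma continuousOn_statPhase' {γ : ℝ} {s : Set ℝ} (hs : ∀ y ∈ s, 0 < y) :
    ContinuousOn (statPhase' γ) s :=
  fun y hy => (hasDerivAt_statPhase' (hs y hy)).continuousAt.continuousWithinAt

lemma continuousOn_sum_mul_e_statPhase {γ ω : ℝ} {t : Finset ℕ} {Z : ℕ → ℝ} {g : ℕ → ℝ → ℝ}
    {s : Set ℝ} (hg : ∀ n, Continuous (g n)) (hs : ∀ y ∈ s, 0 < y) :
    ContinuousOn (fun y => ∑ n ∈ t, (g n y : ℂ) * e (ω * statPhase γ y * Z n)) s := by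
  have := continuousOn_statPhase (γ := γ) hs
  have he := continuous_e
  refine continuousOn_finsetSum _ fun n _ => ?_
  exact (Complex.continuous_ofReal.comp (hg n)).continuousOn.mul
    (he.comp_continuousOn ((continuousOn_const.mul this).mul continuousOn_const))

lemma integral_inv_sq_sub_one {p r : ℝ} (hpr : p ≤ r) (h1 : ∀ y ∈ Set.Icc p r, y ≠ 1) :
    ∫ y in p..r, 1 / (y - 1) ^ 2 = 1 / (p - 1) - 1 / (r - 1) := by
  have hne : ∀ y ∈ Set.uIcc p r, y - 1 ≠ 0 := fun y hy => by
    rw [Set.uIcc_of_le hpr] at hy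
    exact sub_ne_zero.2 (h1 y hy)
  rw [intervalIntegral.integral_eq_sub_of_hasDerivAt (f := fun y => -(y - 1)⁻¹)]
  · ring
  · intro y hy
    exact (((hasDerivAt_id y).sub_const 1).inv (hne y hy)).neg.congr_deriv (by
      simp [neg_div])
  · refine ContinuousOn.intervalIntegrable (continuousOn_const.div ?_ fun y hy => ?_)
    · fun_prop
    · exact pow_ne_zero _ (hne y hy)

set_option maxHeartbeats 1000000 in
/-- Integration by parts for a sum of oscillatory integrals, away from the stationary point. -/
lemma norm_integral_sum_le_of_avoids {γ ω κ W D T p r : ℝ} {t : Finset ℕ} {Z : ℕ → ℝ}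
    (hω : 0 < ω) (hκ : 0 < κ) (hW : 0 ≤ W) (hD : 0 ≤ D) (hT : 0 ≤ T) (hp : 0 < p) (hpr : p ≤ r)
    (h1 : ∀ y ∈ Set.Icc p r, y ≠ 1) (hyD : ∀ y ∈ Set.Icc p r, |y - 1| ≤ D)
    (hv : ∀ y ∈ Set.Icc p r, κ * |y - 1| ≤ |statPhase' γ y|)
    (hv' : ∀ y ∈ Set.Icc p r, |γ * (γ - 1) * y ^ (γ - 2)| ≤ W)
    (hA : ∀ y ∈ Set.Icc p r, ‖∑ n ∈ t, (bump (Z n * y) : ℂ) * e (ω * statPhase γ y * Z n)‖ ≤ T)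
    (hA' : ∀ y ∈ Set.Icc p r,
      ‖∑ n ∈ t, ((Z n * bump' (Z n * y) : ℝ) : ℂ) * e (ω * statPhase γ y * Z n)‖ ≤ T) :
    ‖∫ y in p..r, ∑ n ∈ t, ((Z n * bump (Z n * y) : ℝ) : ℂ) * e (ω * statPhase γ y * Z n)‖ ≤
      T / ω * (1 / κ + D / κ + W / κ ^ 2) * (1 / |p - 1| + 1 / |r - 1|) := by
  set A : ℝ → ℂ := fun y => ∑ n ∈ t, (bump (Z n * y) : ℂ) * e (ω * statPhase γ y * Z n) with hAdef
  set A' : ℝ → ℂ := fun y =>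
    ∑ n ∈ t, ((Z n * bump' (Z n * y) : ℝ) : ℂ) * e (ω * statPhase γ y * Z n) with hA'def
  set S : ℝ → ℂ := fun y =>
    ∑ n ∈ t, ((Z n * bump (Z n * y) : ℝ) : ℂ) * e (ω * statPhase γ y * Z n) with hSdef
  set v' : ℝ → ℝ := statPhase' γ with hv'def
  set v'' : ℝ → ℝ := fun y => γ * (γ - 1) * y ^ (γ - 2) with hv''def
  have hpos : ∀ y ∈ Set.Icc p r, 0 < y := fun y hy => hp.trans_le hy.1
  have habs : ∀ y ∈ Set.Icc p r, 0 < |y - 1| := fun y hy => abs_pos.2 (sub_ne_zero.2 (h1 y hy))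
  have hvpos : ∀ y ∈ Set.Icc p r, 0 < |v' y| := fun y hy =>
    (mul_pos hκ (habs y hy)).trans_le (hv y hy)
  have hvne : ∀ y ∈ Set.Icc p r, (v' y : ℂ) ≠ 0 := fun y hy =>
    Complex.ofReal_ne_zero.2 (abs_pos.1 (hvpos y hy))
  set R : ℝ → ℂ := fun y => A' y / v' y - A y * v'' y / (v' y : ℂ) ^ 2 with hRdef
  set U : ℝ → ℂ := fun y => A y / v' y with hUdef
  have hbumpc : ∀ n, Continuous fun y => bump (Z n * y) := fun n =>
    continuous_bump.comp (continuous_const.mul continuous_id)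
  have hbumpc' : ∀ n, Continuous fun y => Z n * bump' (Z n * y) := fun n =>
    continuous_const.mul (continuous_bump'.comp (continuous_const.mul continuous_id))
  have hAc : ContinuousOn A (Set.Icc p r) := continuousOn_sum_mul_e_statPhase hbumpc hpos
  have hA'c : ContinuousOn A' (Set.Icc p r) := continuousOn_sum_mul_e_statPhase hbumpc' hpos
  have hSc : ContinuousOn S (Set.Icc p r) :=
    continuousOn_sum_mul_e_statPhase (fun n => continuous_const.mul (hbumpc n)) hpos
  have hv'c : ContinuousOn (fun y => (v' y : ℂ)) (Set.Icc p r) :=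
    Complex.continuous_ofReal.comp_continuousOn (continuousOn_statPhase' hpos)
  have hv''c : ContinuousOn (fun y => (v'' y : ℂ)) (Set.Icc p r) :=
    Complex.continuous_ofReal.comp_continuousOn (continuousOn_const.mul
      (continuousOn_id.rpow_const fun y hy => Or.inl (hpos y hy).ne'))
  have hRc : ContinuousOn R (Set.Icc p r) :=
    (hA'c.div hv'c hvne).sub
      ((hAc.mul hv''c).div (hv'c.pow 2) fun y hy => pow_ne_zero _ (hvne y hy))
  have hderivA : ∀ y ∈ Set.Icc p r,
      HasDerivAt A (A' y + 2 * Real.pi * Complex.I * ω * v' y * S y) y := by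
    intro y hy
    have h := HasDerivAt.fun_sum (u := t) (x := y)
      (A := fun n y => (bump (Z n * y) : ℂ) * e (ω * statPhase γ y * Z n))
      (A' := fun n => ((Z n * bump' (Z n * y) : ℝ) : ℂ) * e (ω * statPhase γ y * Z n)
        + 2 * Real.pi * Complex.I * ω * v' y *
          (((Z n * bump (Z n * y) : ℝ) : ℂ) * e (ω * statPhase γ y * Z n))) (fun n _ => ?_)
    · refine h.congr_deriv ?_
      rw [sum_add_distrib, ← mul_sum]
    · have hb : HasDerivAt (fun y => bump (Z n * y)) (bump' (Z n * y) * Z n) y :=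
        (hasDerivAt_bump (Z n * y)).comp y
          (((hasDerivAt_id y).const_mul (Z n)).congr_deriv (mul_one _))
      have he := hasDerivAt_e (((hasDerivAt_statPhase (γ := γ) (hpos y hy)).const_mul ω).mul_const
        (Z n))
      refine (hb.ofReal_comp.mul he).congr_deriv ?_
      push_cast
      ring
  have hderivU : ∀ y ∈ Set.Icc p r,
      HasDerivAt U (R y + 2 * Real.pi * Complex.I * ω * S y) y := by
    intro y hy
    refine ((hderivA y hy).div (hasDerivAt_statPhase' (γ := γ) (hpos y hy)).ofReal_comp
      (hvne y hy)).congr_deriv ?_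
    have := hvne y hy
    simp only [hRdef, ← hv'def]
    rw [show γ * (γ - 1) * y ^ (γ - 2) = v'' y from rfl]
    field_simp
    ring
  have hI : Set.uIcc p r = Set.Icc p r := Set.uIcc_of_le hpr
  have hRi : IntervalIntegrable R MeasureTheory.volume p r :=
    ContinuousOn.intervalIntegrable (by rwa [hI])
  have hSi : IntervalIntegrable S MeasureTheory.volume p r :=
    ContinuousOn.intervalIntegrable (by rwa [hI])
  have hftc : ∫ y in p..r, (R y + 2 * Real.pi * Complex.I * ω * S y) = U r - U p :=
    intervalIntegral.integral_eq_sub_of_hasDerivAt (by rw [hI]; exact hderivU)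
      (hRi.add (hSi.const_mul _))
  rw [intervalIntegral.integral_add hRi (hSi.const_mul _),
    intervalIntegral.integral_const_mul] at hftc
  have hUb : ∀ y ∈ Set.Icc p r, ‖U y‖ ≤ T / κ * (1 / |y - 1|) := by
    intro y hy
    simp only [hUdef]
    rw [norm_div, Complex.norm_real, Real.norm_eq_abs]
    calc ‖A y‖ / |v' y| ≤ T / (κ * |y - 1|) :=
          div_le_div₀ hT (hA y hy) (mul_pos hκ (habs y hy)) (hv y hy)
      _ = _ := by rw [div_mul_div_comm, mul_one]
  have hRb : ∀ y ∈ Set.Icc p r, ‖R y‖ ≤ T * (D / κ + W / κ ^ 2) * (1 / (y - 1) ^ 2) := by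
    intro y hy
    have e1 : ‖A' y / v' y‖ ≤ T * D / (κ * (y - 1) ^ 2) := by
      rw [norm_div, Complex.norm_real, Real.norm_eq_abs]
      calc ‖A' y‖ / |v' y| ≤ T / (κ * |y - 1|) :=
            div_le_div₀ hT (hA' y hy) (mul_pos hκ (habs y hy)) (hv y hy)
        _ = T * |y - 1| / (κ * (y - 1) ^ 2) := by
            have := (habs y hy).ne'
            rw [← sq_abs (y - 1)]
            field_simp
        _ ≤ _ := by
            gcongr
            exact hyD y hy
    have e2 : ‖A y * v'' y / (v' y : ℂ) ^ 2‖ ≤ T * W / (κ ^ 2 * (y - 1) ^ 2) := by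
      rw [norm_div, norm_mul, norm_pow, Complex.norm_real, Complex.norm_real, Real.norm_eq_abs,
        Real.norm_eq_abs]
      refine div_le_div₀ (mul_nonneg hT hW) (mul_le_mul (hA y hy) (hv' y hy) (abs_nonneg _) hT)
        (mul_pos (by positivity) (by rw [← sq_abs]; exact pow_pos (habs y hy) 2)) ?_
      rw [← sq_abs (y - 1), ← mul_pow]
      exact pow_le_pow_left₀ (mul_nonneg hκ.le (abs_nonneg _)) (hv y hy) 2
    calc ‖R y‖ ≤ T * D / (κ * (y - 1) ^ 2) + T * W / (κ ^ 2 * (y - 1) ^ 2) :=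
          (norm_sub_le _ _).trans (add_le_add e1 e2)
      _ = _ := by
          have := sub_ne_zero.2 (h1 y hy)
          field_simp
  have hRint : ‖∫ y in p..r, R y‖ ≤
      T * (D / κ + W / κ ^ 2) * (1 / |p - 1| + 1 / |r - 1|) := by
    have hgi : IntervalIntegrable (fun y => T * (D / κ + W / κ ^ 2) * (1 / (y - 1) ^ 2))
        MeasureTheory.volume p r := by
      refine ContinuousOn.intervalIntegrable (continuousOn_const.mul (continuousOn_const.div ?_ ?_))
      · fun_prop
      · intro y hy
        rw [hI] at hy
        exact pow_ne_zero _ (sub_ne_zero.2 (h1 y hy))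
    refine (intervalIntegral.norm_integral_le_of_norm_le hpr (Filter.Eventually.of_forall
      fun y hy => hRb y ⟨hy.1.le, hy.2⟩) hgi).trans ?_
    rw [intervalIntegral.integral_const_mul, integral_inv_sq_sub_one hpr h1]
    refine mul_le_mul_of_nonneg_left ?_ (by positivity)
    have q1 : 1 / (p - 1) ≤ 1 / |p - 1| := by
      rw [← abs_one, ← abs_div, abs_one]; exact le_abs_self _
    have q2 : -(1 / (r - 1)) ≤ 1 / |r - 1| := by
      rw [← abs_one, ← abs_div, abs_one]; exact neg_le_abs _
    linarith
  have hpi : 1 ≤ 2 * Real.pi := by linarith [Real.pi_gt_three]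
  have key : 2 * Real.pi * ω * ‖∫ y in p..r, S y‖ ≤
      T * (1 / κ + D / κ + W / κ ^ 2) * (1 / |p - 1| + 1 / |r - 1|) := by
    have hn : 2 * Real.pi * ω * ‖∫ y in p..r, S y‖ = ‖U r - U p - ∫ y in p..r, R y‖ := by
      rw [← hftc, add_sub_cancel_left, norm_mul]
      congr 1
      simp [abs_of_pos hω, abs_of_pos Real.pi_pos]
    rw [hn]
    have hUr := hUb r ⟨hpr, le_rfl⟩
    have hUp := hUb p ⟨le_rfl, hpr⟩
    calc ‖U r - U p - ∫ y in p..r, R y‖ ≤ ‖U r‖ + ‖U p‖ + ‖∫ y in p..r, R y‖ :=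
          (norm_sub_le _ _).trans (add_le_add_left (norm_sub_le _ _) _)
      _ ≤ T / κ * (1 / |r - 1|) + T / κ * (1 / |p - 1|) +
          T * (D / κ + W / κ ^ 2) * (1 / |p - 1| + 1 / |r - 1|) := by gcongr
      _ = _ := by ring
  have h5 : ω * ‖∫ y in p..r, S y‖ ≤ 2 * Real.pi * ω * ‖∫ y in p..r, S y‖ := by
    have : 0 ≤ ω * ‖∫ y in p..r, S y‖ := by positivity
    nlinarith
  rw [show T / ω * (1 / κ + D / κ + W / κ ^ 2) * (1 / |p - 1| + 1 / |r - 1|) =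
    T * (1 / κ + D / κ + W / κ ^ 2) * (1 / |p - 1| + 1 / |r - 1|) / ω by ring, le_div_iff₀ hω]
  linarith

lemma abs_mul_comp_sub_le {f : ℝ → ℝ} {z w y z1 Y : ℝ} (hf : ∀ u, |f u| ≤ 100)
    (hf' : ∀ u v, |f u - f v| ≤ 100 * |u - v|) (hw : 0 ≤ w) (hw1 : w ≤ z1)
    (hy : 0 ≤ y) (hyY : y ≤ Y) :
    |z * f (z * y) - w * f (w * y)| ≤ (100 + 100 * Y * z1) * |z - w| := by
  have e1 : z * f (z * y) - w * f (w * y) =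
      (z - w) * f (z * y) + w * (f (z * y) - f (w * y)) := by ring
  have h3 : |f (z * y) - f (w * y)| ≤ 100 * Y * |z - w| := by
    refine (hf' _ _).trans ?_
    rw [← sub_mul, abs_mul, abs_of_nonneg hy]
    nlinarith [mul_le_mul_of_nonneg_left hyY (abs_nonneg (z - w))]
  calc |z * f (z * y) - w * f (w * y)|
      ≤ |z - w| * |f (z * y)| + w * |f (z * y) - f (w * y)| := by
        rw [e1]
        refine (abs_add_le _ _).trans (le_of_eq ?_)
        rw [abs_mul, abs_mul, abs_of_nonneg hw]
    _ ≤ |z - w| * 100 + z1 * (100 * Y * |z - w|) := by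
        gcongr
        · exact hf _
        · exact hw.trans hw1
    _ = _ := by ring

lemma abs_comp_sub_le {f : ℝ → ℝ} {z w y Y : ℝ}
    (hf' : ∀ u v, |f u - f v| ≤ 100 * |u - v|) (hy : 0 ≤ y) (hyY : y ≤ Y) :
    |f (z * y) - f (w * y)| ≤ 100 * Y * |z - w| := by
  refine (hf' _ _).trans ?_
  rw [← sub_mul, abs_mul, abs_of_nonneg hy]
  nlinarith [mul_le_mul_of_nonneg_left hyY (abs_nonneg (z - w))]

lemma norm_sum_mul_e_le_card {t : Finset ℕ} {g φ : ℕ → ℝ} {K N : ℝ} (hK : 0 ≤ K)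
    (hN : (#t : ℝ) ≤ N) (hg : ∀ n ∈ t, |g n| ≤ K) : ‖∑ n ∈ t, (g n : ℂ) * e (φ n)‖ ≤ N * K := by
  refine (norm_sum_le_of_le t (f := fun n => (g n : ℂ) * e (φ n)) (n := fun _ => K)
    fun n hn => ?_).trans ?_
  · rw [norm_mul, norm_e, mul_one, Complex.norm_real]
    exact hg n hn
  · rw [sum_const, nsmul_eq_mul]
    gcongr

set_option maxHeartbeats 1000000 in
/-- The sum of oscillatory integrals near the stationary point. -/
lemma exists_norm_integral_sum_le {γ z0 z1 : ℝ} (h0 : 0 < γ) (h1 : γ < 1) (hz0 : 0 < z0)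
    (hz0' : z0 ≤ 1) (hz1 : 1 ≤ z1) : ∃ C, 0 < C ∧ ∀ (a b : ℕ) (Z : ℕ → ℝ) (ω ε B N : ℝ),
      (∀ n, a ≤ n → n + 1 < b → Z (n + 1) ≤ Z n) → (∀ n ∈ Ico a b, 0 ≤ Z n) →
      (∀ n ∈ Ico a b, Z n ≤ z1) → 0 < ω → 0 < ε → ε ≤ 1 / 2 → (#(Ico a b) : ℝ) ≤ N →
      (∀ y ∈ Set.Icc (1 / (4 * z1)) (3 / 2), ∀ k ≤ b,
        ‖∑ n ∈ Ico a k, e (ω * statPhase γ y * Z n)‖ ≤ B) →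
      ‖∫ y in (1 / (4 * z1))..(2 / z0), ∑ n ∈ Ico a b,
        ((Z n * bump (Z n * y) : ℝ) : ℂ) * e (ω * statPhase γ y * Z n)‖ ≤
        C * (ε * B + B / (ω * ε) + N / ω) := by
  set c0 : ℝ := 1 / (4 * z1) with hc0
  set C0 : ℝ := 2 / z0 with hC0
  have hc0pos : 0 < c0 := by positivity
  have hc04 : c0 ≤ 1 / 4 := by
    rw [hc0]; exact one_div_le_one_div_of_le (by norm_num) (by linarith)
  have hC02 : 2 ≤ C0 := by rw [hC0, le_div_iff₀ hz0]; linarith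
  set κ : ℝ := γ * (1 - γ) / C0 with hκ
  set W : ℝ := γ * (1 - γ) * c0 ^ (γ - 2) with hW
  have h1γ : 0 < 1 - γ := by linarith
  have hκpos : 0 < κ := by positivity
  have hWpos : 0 < W := by positivity
  set Q : ℝ := 1 / κ + C0 / κ + W / κ ^ 2 with hQ
  have hQpos : 0 < Q := by positivity
  set K : ℝ := (100 + 100 * C0 * z1) * (1 + 2 * z1) with hK
  have hKpos : 0 < K := by positivity
  refine ⟨4 * K * Q + 2 * K, by positivity, fun a b Z ω ε B N hanti hZ0 hZ1 hω hε hε2 hN hB => ?_⟩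
  have hB0 : 0 ≤ B := (norm_nonneg _).trans (hB c0 ⟨le_rfl, by linarith⟩ b le_rfl)
  have hN0 : 0 ≤ N := (Nat.cast_nonneg _).trans hN
  have hz1' : 0 ≤ z1 := by linarith
  have hKa : 100 + 100 * C0 * z1 ≤ K := by
    rw [hK]; nlinarith [mul_nonneg (show 0 ≤ 100 + 100 * C0 * z1 by positivity) hz1']
  have hKb : 100 * z1 + (100 + 100 * C0 * z1) * z1 ≤ K := by
    rw [hK]
    have : 0 ≤ C0 * z1 * z1 := by positivity
    have : 0 ≤ C0 * z1 := by positivity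
    nlinarith
  have hb100 : ∀ u, |bump u| ≤ 100 := fun u => (bump_le u).trans (by norm_num)
  have hplain : ∀ y ∈ Set.Icc c0 (3 / 2),
      ‖∑ n ∈ Ico a b, (bump (Z n * y) : ℂ) * e (ω * statPhase γ y * Z n)‖ ≤ B * K := by
    intro y hy
    refine (norm_sum_lipschitz_mul_le (g := fun z => bump (z * y)) (φ := fun n =>
      ω * statPhase γ y * Z n) (G := 100) (L := 100 * C0) hanti hZ0 hZ1 (hB y hy) (by positivity)
      (by norm_num) hz1' (fun n _ => hb100 _) fun n _ m _ => abs_comp_sub_le abs_bump_sub_le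
        (by linarith [hy.1]) (by linarith [hy.2])).trans ?_
    gcongr
  have hwt : ∀ f : ℝ → ℝ, (∀ u, |f u| ≤ 100) → (∀ u v, |f u - f v| ≤ 100 * |u - v|) →
      ∀ y ∈ Set.Icc c0 (3 / 2),
      ‖∑ n ∈ Ico a b, ((Z n * f (Z n * y) : ℝ) : ℂ) * e (ω * statPhase γ y * Z n)‖ ≤ B * K := by
    intro f hf hf' y hy
    refine (norm_sum_lipschitz_mul_le (g := fun z => z * f (z * y)) (φ := fun n =>
      ω * statPhase γ y * Z n) (G := 100 * z1) (L := 100 + 100 * C0 * z1) hanti hZ0 hZ1 (hB y hy)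
      (by positivity) (by positivity) hz1' (fun n hn => ?_) fun n _ m hm =>
        abs_mul_comp_sub_le hf hf' (hZ0 m hm) (hZ1 m hm)
        (by linarith [hy.1]) (by linarith [hy.2])).trans ?_
    · rw [abs_mul, abs_of_nonneg (hZ0 n hn), mul_comm]
      exact mul_le_mul (hf _) (hZ1 n hn) (hZ0 n hn) (by norm_num)
    · gcongr
  have hv : ∀ y, 0 < y → y ≤ C0 → κ * |y - 1| ≤ |statPhase' γ y| := fun y hy hyC =>
    le_abs_statPhase' h0 h1 hy (by linarith) hyC
  have hv' : ∀ y, c0 ≤ y → |γ * (γ - 1) * y ^ (γ - 2)| ≤ W := by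
    intro y hy
    have hy0 : 0 < y := hc0pos.trans_le hy
    rw [show γ * (γ - 1) * y ^ (γ - 2) = -(γ * (1 - γ) * y ^ (γ - 2)) by ring, abs_neg,
      abs_of_nonneg (by positivity), hW]
    have := Real.rpow_le_rpow_of_nonpos hc0pos hy (by linarith : γ - 2 ≤ 0)
    gcongr
  have hD : ∀ y, 0 < y → y ≤ C0 → |y - 1| ≤ C0 := fun y hy hyC =>
    abs_le.2 ⟨by linarith, by linarith⟩
  have hε' : 2 ≤ 1 / ε := by rw [le_div_iff₀ hε]; linarith
  set S : ℝ → ℂ := fun y => ∑ n ∈ Ico a b, ((Z n * bump (Z n * y) : ℝ) : ℂ) *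
    e (ω * statPhase γ y * Z n) with hS
  have hint : ∀ p r, c0 ≤ p → p ≤ r → IntervalIntegrable S MeasureTheory.volume p r := by
    intro p r hp hpr
    refine ContinuousOn.intervalIntegrable ?_
    rw [Set.uIcc_of_le hpr]
    exact continuousOn_sum_mul_e_statPhase (g := fun n y => Z n * bump (Z n * y)) (fun n =>
      continuous_const.mul (continuous_bump.comp (continuous_const.mul continuous_id)))
      fun y hy => hc0pos.trans_le (hp.trans hy.1)
  have hleft : ‖∫ y in c0..(1 - ε), S y‖ ≤ B * K / ω * Q * (2 / ε) := by
    refine (norm_integral_sum_le_of_avoids hω hκpos hWpos.le (by linarith : 0 ≤ C0)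
      (mul_nonneg hB0 hKpos.le) hc0pos (by linarith) (fun y hy => ne_of_lt (by linarith [hy.2]))
      (fun y hy => hD y (by linarith [hy.1]) (by linarith [hy.2]))
      (fun y hy => hv y (by linarith [hy.1]) (by linarith [hy.2])) (fun y hy => hv' y hy.1)
      (fun y hy => hplain y ⟨hy.1, by linarith [hy.2]⟩)
      (fun y hy => hwt bump' bump'_le abs_bump'_sub_le y ⟨hy.1, by linarith [hy.2]⟩)).trans ?_
    refine mul_le_mul_of_nonneg_left ?_ (by positivity)
    rw [abs_of_neg (by linarith : c0 - 1 < 0), show 1 - ε - 1 = -ε by ring, abs_neg, abs_of_pos hε]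
    have : 1 / -(c0 - 1) ≤ 2 := by rw [div_le_iff₀ (by linarith)]; linarith
    rw [show 2 / ε = 1 / ε + 1 / ε by ring]
    linarith
  have hright : ‖∫ y in (1 + ε)..(3 / 2), S y‖ ≤ B * K / ω * Q * (2 / ε) := by
    refine (norm_integral_sum_le_of_avoids hω hκpos hWpos.le (by linarith : 0 ≤ C0)
      (mul_nonneg hB0 hKpos.le) (by linarith) (by linarith)
        (fun y hy => ne_of_gt (by linarith [hy.1]))
      (fun y hy => hD y (by linarith [hy.1]) (by linarith [hy.2]))
      (fun y hy => hv y (by linarith [hy.1]) (by linarith [hy.2]))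
      (fun y hy => hv' y (by linarith [hy.1]))
      (fun y hy => hplain y ⟨by linarith [hy.1], hy.2⟩)
      (fun y hy => hwt bump' bump'_le abs_bump'_sub_le y ⟨by linarith [hy.1], hy.2⟩)).trans ?_
    refine mul_le_mul_of_nonneg_left ?_ (by positivity)
    rw [show (1 + ε - 1 : ℝ) = ε by ring, abs_of_pos hε, show (3 / 2 - 1 : ℝ) = 1 / 2 by norm_num,
      abs_of_pos (by norm_num), show 2 / ε = 1 / ε + 1 / ε by ring]
    linarith
  have hfar : ‖∫ y in (3 / 2)..C0, S y‖ ≤ N * K / ω * Q * 4 := by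
    refine (norm_integral_sum_le_of_avoids hω hκpos hWpos.le (by linarith : 0 ≤ C0)
      (mul_nonneg hN0 hKpos.le) (by norm_num) (by linarith)
        (fun y hy => ne_of_gt (by linarith [hy.1]))
      (fun y hy => hD y (by linarith [hy.1]) (by linarith [hy.2]))
      (fun y hy => hv y (by linarith [hy.1]) (by linarith [hy.2]))
      (fun y hy => hv' y (by linarith [hy.1])) (fun y hy => ?_) (fun y hy => ?_)).trans ?_
    · exact norm_sum_mul_e_le_card hKpos.le hN fun n _ => (hb100 _).trans
        (le_trans (le_add_of_nonneg_right (by positivity)) hKa)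
    · refine norm_sum_mul_e_le_card hKpos.le hN fun n hn => le_trans ?_
        (le_trans (le_add_of_nonneg_right (by positivity)) hKb)
      rw [abs_mul, abs_of_nonneg (hZ0 n hn), mul_comm]
      exact mul_le_mul (bump'_le _) (hZ1 n hn) (hZ0 n hn) (by norm_num)
    · refine mul_le_mul_of_nonneg_left ?_ (by positivity)
      rw [show (3 / 2 - 1 : ℝ) = 1 / 2 by norm_num, abs_of_pos (by norm_num : (0:ℝ) < 1 / 2),
        abs_of_pos (by linarith : 0 < C0 - 1)]
      have : 1 / (C0 - 1) ≤ 2 := by rw [div_le_iff₀ (by linarith)]; linarith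
      linarith
  have hmid : ‖∫ y in (1 - ε)..(1 + ε), S y‖ ≤ B * K * (2 * ε) := by
    refine (intervalIntegral.norm_integral_le_of_norm_le_const (C := B * K) fun y hy => ?_).trans
      (le_of_eq ?_)
    · rw [Set.uIoc_of_le (by linarith)] at hy
      exact hwt bump hb100 abs_bump_sub_le y ⟨by linarith [hy.1], by linarith [hy.2]⟩
    · rw [show 1 + ε - (1 - ε) = 2 * ε by ring, abs_of_pos (by linarith)]
  have hsplit : ∫ y in c0..C0, S y = (∫ y in c0..(1 - ε), S y) + (∫ y in (1 - ε)..(1 + ε), S y) +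
      (∫ y in (1 + ε)..(3 / 2), S y) + ∫ y in (3 / 2)..C0, S y := by
    have i1 := hint c0 (1 - ε) le_rfl (by linarith)
    have i2 := hint (1 - ε) (1 + ε) (by linarith) (by linarith)
    have i3 := hint (1 + ε) (3 / 2) (by linarith) (by linarith)
    have i4 := hint (3 / 2) C0 (by linarith) (by linarith)
    rw [intervalIntegral.integral_add_adjacent_intervals i1 i2,
      intervalIntegral.integral_add_adjacent_intervals (i1.trans i2) i3,
      intervalIntegral.integral_add_adjacent_intervals ((i1.trans i2).trans i3) i4]
  rw [hsplit]
  have htri := norm_add₄_le (a := ∫ y in c0..(1 - ε), S y) (b := ∫ y in (1 - ε)..(1 + ε), S y)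
    (c := ∫ y in (1 + ε)..(3 / 2), S y) (d := ∫ y in (3 / 2)..C0, S y)
  have p1 : B * K / ω * Q * (2 / ε) = 2 * K * Q * (B / (ω * ε)) := by field_simp
  have p2 : N * K / ω * Q * 4 = 4 * K * Q * (N / ω) := by field_simp
  rw [p1] at hleft hright
  rw [p2] at hfar
  have q1 : 0 ≤ ε * B := by positivity
  have q2 : 0 ≤ B / (ω * ε) := by positivity
  have q3 : 0 ≤ N / ω := by positivity
  have q4 : 0 ≤ K * Q := by positivity
  have r1 := mul_nonneg q4 q1
  have r2 := mul_nonneg hKpos.le q2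
  have r3 := mul_nonneg hKpos.le q3
  calc _ ≤ _ := htri
    _ ≤ 2 * K * Q * (B / (ω * ε)) + B * K * (2 * ε) + 2 * K * Q * (B / (ω * ε)) +
        4 * K * Q * (N / ω) := by gcongr
    _ ≤ _ := by
      rw [← sub_nonneg]
      have : (4 * K * Q + 2 * K) * (ε * B + B / (ω * ε) + N / ω) -
        (2 * K * Q * (B / (ω * ε)) + B * K * (2 * ε) + 2 * K * Q * (B / (ω * ε)) +
        4 * K * Q * (N / ω)) = 4 * (K * Q * (ε * B)) + 2 * (K * (B / (ω * ε))) +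
          2 * (K * (N / ω)) := by ring
      rw [this]
      positivity

/-- Integration by parts against an oscillating exponential, with vanishing boundary terms. -/
lemma integral_mul_e_eq {w w' φ φ' φ'' : ℝ → ℝ} {p r : ℝ} (hpr : p ≤ r)
    (hw : ∀ u ∈ Set.Icc p r, HasDerivAt w (w' u) u)
    (hφ : ∀ u ∈ Set.Icc p r, HasDerivAt φ (φ' u) u)
    (hφ' : ∀ u ∈ Set.Icc p r, HasDerivAt φ' (φ'' u) u)
    (hne : ∀ u ∈ Set.Icc p r, φ' u ≠ 0) (hwp : w p = 0) (hwr : w r = 0)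
    (hw'c : ContinuousOn w' (Set.Icc p r)) (hφ''c : ContinuousOn φ'' (Set.Icc p r)) :
    2 * Real.pi * Complex.I * ∫ u in p..r, (w u : ℂ) * e (φ u) =
      -∫ u in p..r, ((w' u / φ' u - w u * φ'' u / φ' u ^ 2 : ℝ) : ℂ) * e (φ u) := by
  have hI : Set.uIcc p r = Set.Icc p r := Set.uIcc_of_le hpr
  have hwc : ContinuousOn w (Set.Icc p r) := fun u hu => (hw u hu).continuousAt.continuousWithinAt
  have hφc : ContinuousOn φ (Set.Icc p r) := fun u hu => (hφ u hu).continuousAt.continuousWithinAt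
  have hφ'c : ContinuousOn φ' (Set.Icc p r) :=
    fun u hu => (hφ' u hu).continuousAt.continuousWithinAt
  have hec : ContinuousOn (fun u => e (φ u)) (Set.Icc p r) := continuous_e.comp_continuousOn hφc
  have hcast : ∀ {f : ℝ → ℝ}, ContinuousOn f (Set.Icc p r) →
      ContinuousOn (fun u => (f u : ℂ)) (Set.Icc p r) := fun hf =>
    Complex.continuous_ofReal.comp_continuousOn hf
  have hd : ∀ u ∈ Set.uIcc p r, HasDerivAt (fun u => ((w u / φ' u : ℝ) : ℂ) * e (φ u))
      (((w' u / φ' u - w u * φ'' u / φ' u ^ 2 : ℝ) : ℂ) * e (φ u) +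
        2 * Real.pi * Complex.I * ((w u : ℂ) * e (φ u))) u := by
    intro u hu
    rw [hI] at hu
    refine (((hw u hu).div (hφ' u hu) (hne u hu)).ofReal_comp.mul
      (hasDerivAt_e (hφ u hu))).congr_deriv ?_
    have : (φ' u : ℂ) ≠ 0 := Complex.ofReal_ne_zero.2 (hne u hu)
    simp only [Pi.div_apply]
    push_cast
    field_simp
  have i1 : IntervalIntegrable (fun u => ((w' u / φ' u - w u * φ'' u / φ' u ^ 2 : ℝ) : ℂ) *
      e (φ u)) MeasureTheory.volume p r := by
    refine ContinuousOn.intervalIntegrable ?_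
    rw [hI]
    exact (hcast ((hw'c.div hφ'c hne).sub ((hwc.mul hφ''c).div (hφ'c.pow 2) fun u hu =>
      pow_ne_zero _ (hne u hu)))).mul hec
  have i2 : IntervalIntegrable (fun u => (w u : ℂ) * e (φ u)) MeasureTheory.volume p r := by
    refine ContinuousOn.intervalIntegrable ?_
    rw [hI]
    exact (hcast hwc).mul hec
  have h := intervalIntegral.integral_eq_sub_of_hasDerivAt hd (i1.add (i2.const_mul _))
  rw [intervalIntegral.integral_add i1 (i2.const_mul _), intervalIntegral.integral_const_mul,
    hwp, hwr] at h
  simp only [zero_div, Complex.ofReal_zero, zero_mul, sub_zero] at h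
  exact eq_neg_of_add_eq_zero_right h

lemma norm_integral_mul_e_le {w w' w'' φ φ' φ'' ψ : ℝ → ℝ} {p r W K Λ : ℝ} (hpr : p ≤ r)
    (hΛ : 0 < Λ) (hK : 0 ≤ K)
    (hw : ∀ u ∈ Set.Icc p r, HasDerivAt w (w' u) u)
    (hw' : ∀ u ∈ Set.Icc p r, HasDerivAt w' (w'' u) u)
    (hφ : ∀ u ∈ Set.Icc p r, HasDerivAt φ (φ' u) u)
    (hφ' : ∀ u ∈ Set.Icc p r, HasDerivAt φ' (φ'' u) u)
    (hφ'' : ∀ u ∈ Set.Icc p r, HasDerivAt φ'' (ψ u) u)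
    (hw''c : ContinuousOn w'' (Set.Icc p r)) (hψc : ContinuousOn ψ (Set.Icc p r))
    (hwp : w p = 0) (hwr : w r = 0) (hwp' : w' p = 0) (hwr' : w' r = 0)
    (bw : ∀ u ∈ Set.Icc p r, |w u| ≤ W) (bw' : ∀ u ∈ Set.Icc p r, |w' u| ≤ W)
    (bw'' : ∀ u ∈ Set.Icc p r, |w'' u| ≤ W) (bφ' : ∀ u ∈ Set.Icc p r, Λ ≤ |φ' u|)
    (bφ'' : ∀ u ∈ Set.Icc p r, |φ'' u| ≤ K * Λ) (bψ : ∀ u ∈ Set.Icc p r, |ψ u| ≤ K * Λ) :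
    ‖∫ u in p..r, (w u : ℂ) * e (φ u)‖ ≤ 4 * W * (1 + K) ^ 2 * (r - p) / Λ ^ 2 := by
  have hne : ∀ u ∈ Set.Icc p r, φ' u ≠ 0 := fun u hu =>
    abs_pos.1 (hΛ.trans_le (bφ' u hu))
  have hcont : ∀ {f f' : ℝ → ℝ}, (∀ u ∈ Set.Icc p r, HasDerivAt f (f' u) u) →
      ContinuousOn f (Set.Icc p r) := fun h u hu => (h u hu).continuousAt.continuousWithinAt
  have hW : 0 ≤ W := (abs_nonneg _).trans (bw p ⟨le_rfl, hpr⟩)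
  have e1 := integral_mul_e_eq hpr hw hφ hφ' hne hwp hwr (hcont hw') (hcont hφ'')
  have hd : ∀ u ∈ Set.Icc p r, HasDerivAt (fun u => w' u / φ' u - w u * φ'' u / φ' u ^ 2)
      (w'' u / φ' u - 2 * w' u * φ'' u / φ' u ^ 2 - w u * ψ u / φ' u ^ 2 +
        2 * w u * φ'' u ^ 2 / φ' u ^ 3) u := by
    intro u hu
    have hn := hne u hu
    refine (((hw' u hu).div (hφ' u hu) hn).sub (((hw u hu).mul (hφ'' u hu)).div
      ((hφ' u hu).pow 2) (pow_ne_zero 2 hn))).congr_deriv ?_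
    simp only [Pi.mul_apply, Pi.pow_apply]
    field_simp
    push_cast
    ring
  have hc' := hcont hφ'
  have e2 := integral_mul_e_eq hpr hd hφ hφ' hne (by simp [hwp, hwp']) (by simp [hwr, hwr'])
    ((((hw''c.div hc' hne).sub (((continuousOn_const.mul (hcont hw')).mul (hcont hφ'')).div
      (hc'.pow 2) fun u hu => pow_ne_zero _ (hne u hu))).sub (((hcont hw).mul hψc).div
      (hc'.pow 2) fun u hu => pow_ne_zero _ (hne u hu))).add (((continuousOn_const.mul
      (hcont hw)).mul ((hcont hφ'').pow 2)).div (hc'.pow 3) fun u hu => pow_ne_zero _ (hne u hu)))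
    (hcont hφ'')
  set F : ℝ → ℝ := fun u => (w'' u / φ' u - 2 * w' u * φ'' u / φ' u ^ 2 - w u * ψ u / φ' u ^ 2 +
    2 * w u * φ'' u ^ 2 / φ' u ^ 3) / φ' u -
    (w' u / φ' u - w u * φ'' u / φ' u ^ 2) * φ'' u / φ' u ^ 2 with hF
  have bF : ∀ u ∈ Set.Icc p r, |F u| ≤ 4 * W * (1 + K) ^ 2 / Λ ^ 2 := by
    intro u hu
    have hn := hne u hu
    have hrep : F u = w'' u * (1 / φ' u) ^ 2 - 3 * (w' u * (φ'' u / φ' u) * (1 / φ' u) ^ 2) -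
        w u * (ψ u / φ' u) * (1 / φ' u) ^ 2 +
        3 * (w u * (φ'' u / φ' u) ^ 2 * (1 / φ' u) ^ 2) := by
      rw [hF]
      field_simp
      ring
    have hg : |1 / φ' u| ≤ 1 / Λ := by
      rw [abs_div, abs_one]; exact one_div_le_one_div_of_le hΛ (bφ' u hu)
    have hq : ∀ {t}, |t| ≤ K * Λ → |t / φ' u| ≤ K := by
      intro t ht
      rw [abs_div, div_le_iff₀ (abs_pos.2 hn)]
      exact ht.trans (mul_le_mul_of_nonneg_left (bφ' u hu) hK)
    have hg2 : |(1 / φ' u) ^ 2| ≤ (1 / Λ) ^ 2 := by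
      rw [abs_pow]; exact pow_le_pow_left₀ (abs_nonneg _) hg 2
    have t1 : |w'' u * (1 / φ' u) ^ 2| ≤ W * (1 / Λ) ^ 2 := by
      rw [abs_mul]; exact mul_le_mul (bw'' u hu) hg2 (abs_nonneg _) hW
    have t2 : |w' u * (φ'' u / φ' u) * (1 / φ' u) ^ 2| ≤ W * K * (1 / Λ) ^ 2 := by
      rw [abs_mul, abs_mul]
      exact mul_le_mul (mul_le_mul (bw' u hu) (hq (bφ'' u hu)) (abs_nonneg _) hW) hg2
        (abs_nonneg _) (by positivity)
    have t3 : |w u * (ψ u / φ' u) * (1 / φ' u) ^ 2| ≤ W * K * (1 / Λ) ^ 2 := by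
      rw [abs_mul, abs_mul]
      exact mul_le_mul (mul_le_mul (bw u hu) (hq (bψ u hu)) (abs_nonneg _) hW) hg2
        (abs_nonneg _) (by positivity)
    have t4 : |w u * (φ'' u / φ' u) ^ 2 * (1 / φ' u) ^ 2| ≤ W * K ^ 2 * (1 / Λ) ^ 2 := by
      rw [abs_mul, abs_mul, abs_pow (φ'' u / φ' u)]
      exact mul_le_mul (mul_le_mul (bw u hu) (pow_le_pow_left₀ (abs_nonneg _) (hq (bφ'' u hu)) 2)
        (by positivity) hW) hg2 (abs_nonneg _) (by positivity)
    rw [abs_le] at t1 t2 t3 t4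
    have hnn : 0 ≤ W * (1 / Λ) ^ 2 := by positivity
    have hnk : 0 ≤ W * (1 / Λ) ^ 2 * K := by positivity
    have hnk2 : 0 ≤ W * (1 / Λ) ^ 2 * K ^ 2 := by positivity
    rw [hrep, show 4 * W * (1 + K) ^ 2 / Λ ^ 2 = 4 * (W * (1 / Λ) ^ 2) + 8 * (W * (1 / Λ) ^ 2 * K) +
      4 * (W * (1 / Λ) ^ 2 * K ^ 2) by field_simp; ring, abs_le]
    constructor <;> linarith
  have hint : ‖∫ u in p..r, (F u : ℂ) * e (φ u)‖ ≤ 4 * W * (1 + K) ^ 2 / Λ ^ 2 * (r - p) := by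
    refine (intervalIntegral.norm_integral_le_of_norm_le_const
      (C := 4 * W * (1 + K) ^ 2 / Λ ^ 2) fun u hu => ?_).trans (le_of_eq ?_)
    · rw [Set.uIoc_of_le hpr] at hu
      rw [norm_mul, norm_e, mul_one, Complex.norm_real]
      exact bF u ⟨hu.1.le, hu.2⟩
    · rw [abs_of_nonneg (by linarith)]
  have n1 := congrArg norm e1
  have n2 := congrArg norm e2
  simp only [norm_mul, norm_neg, Complex.norm_I, Complex.norm_real, Complex.norm_ofNat, mul_one,
    Real.norm_eq_abs, abs_of_pos Real.pi_pos] at n1 n2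
  have hpi : 1 ≤ 2 * Real.pi := by linarith [Real.pi_gt_three]
  have m1 : ∀ {x y : ℝ}, 0 ≤ x → 2 * Real.pi * x = y → x ≤ y := fun hx h => by nlinarith
  calc _ ≤ _ := m1 (norm_nonneg _) n1
    _ ≤ _ := m1 (norm_nonneg _) n2
    _ ≤ _ := hint
    _ = _ := by ring

lemma norm_integral_bump_mul_e_le {γ a b Λ A : ℝ} (h0 : 0 < γ) (h1 : γ < 1) (ha : 0 < a)
    (hΛ : 0 < Λ) (hA : 0 ≤ A) (haA : a ≤ A * Λ)
    (hφ : ∀ u ∈ Set.Icc (1 / 4 : ℝ) 2, Λ ≤ |a * u ^ (γ - 1) - b|) :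
    ‖∫ u in (1 / 4 : ℝ)..2, (bump u : ℂ) * e (a / γ * u ^ γ - b * u)‖ ≤
      700 * (1 + 128 * A) ^ 2 / Λ ^ 2 := by
  have hpos : ∀ u ∈ Set.Icc (1 / 4 : ℝ) 2, 0 < u := fun u hu => by linarith [hu.1]
  have hr : ∀ s : ℝ, ∀ u ∈ Set.Icc (1 / 4 : ℝ) 2,
      HasDerivAt (fun u : ℝ => u ^ s) (s * u ^ (s - 1)) u := fun s u hu =>
    Real.hasDerivAt_rpow_const (Or.inl (hpos u hu).ne')
  have hrc : ∀ s : ℝ, ContinuousOn (fun u : ℝ => u ^ s) (Set.Icc (1 / 4 : ℝ) 2) := fun s =>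
    continuousOn_id.rpow_const fun u hu => Or.inl (hpos u hu).ne'
  have hrb : ∀ s : ℝ, s ≤ 0 → -3 ≤ s → ∀ u ∈ Set.Icc (1 / 4 : ℝ) 2, u ^ s ≤ 64 := by
    intro s hs hs' u hu
    calc u ^ s ≤ (1 / 4 : ℝ) ^ s := Real.rpow_le_rpow_of_nonpos (by norm_num) hu.1 hs
      _ ≤ (1 / 4 : ℝ) ^ (-3 : ℝ) :=
        Real.rpow_le_rpow_of_exponent_ge (by norm_num) (by norm_num) hs'
      _ = 64 := by rw [Real.rpow_neg (by norm_num)]; norm_num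
  have h128 : ∀ c s : ℝ, |c| ≤ 2 → s ≤ 0 → -3 ≤ s → ∀ u ∈ Set.Icc (1 / 4 : ℝ) 2,
      |a * c * u ^ s| ≤ 128 * A * Λ := by
    intro c s hc hs hs' u hu
    have := (hpos u hu)
    rw [abs_mul, abs_mul, abs_of_pos ha, abs_of_pos (by positivity : 0 < u ^ s)]
    calc a * |c| * u ^ s ≤ A * Λ * 2 * 64 := by
          gcongr
          exact hrb s hs hs' u hu
      _ = _ := by ring
  have hI : ∫ u in (1 / 4 : ℝ)..2, (bump u : ℂ) * e (a / γ * u ^ γ - b * u) =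
      ∫ u in (1 / 4 : ℝ)..2, ((8 * ((u - 1 / 4) * (2 - u)) ^ 2 : ℝ) : ℂ) *
        e (a / γ * u ^ γ - b * u) := by
    refine intervalIntegral.integral_congr fun u hu => ?_
    rw [Set.uIcc_of_le (by norm_num)] at hu
    simp only [bump_eq_of_mem hu.1 hu.2]
  have hid : ∀ u : ℝ, HasDerivAt (fun u : ℝ => u) 1 u := hasDerivAt_id
  rw [hI]
  refine (norm_integral_mul_e_le (w := fun u => 8 * ((u - 1 / 4) * (2 - u)) ^ 2)
    (w' := fun u => 16 * ((u - 1 / 4) * (2 - u)) * (9 / 4 - 2 * u))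
    (w'' := fun u => 16 * (9 / 4 - 2 * u) ^ 2 - 32 * ((u - 1 / 4) * (2 - u)))
    (φ := fun u => a / γ * u ^ γ - b * u) (φ' := fun u => a * u ^ (γ - 1) - b)
    (φ'' := fun u => a * (γ - 1) * u ^ (γ - 2))
    (ψ := fun u => a * ((γ - 1) * (γ - 2)) * u ^ (γ - 3)) (p := 1 / 4) (r := 2)
    (W := 100) (K := 128 * A) (Λ := Λ) (by norm_num) hΛ (by positivity) ?_ ?_ ?_ ?_ ?_ ?_ ?_
    (by norm_num) (by norm_num) (by norm_num) (by norm_num) ?_ ?_ ?_ hφ ?_ ?_).trans (le_of_eq ?_)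
  · intro u _
    refine (((((hid u).sub_const (1 / 4)).mul ((hid u).const_sub 2)).pow 2).const_mul
      8).congr_deriv ?_
    simp
    ring
  · intro u _
    refine (((((hid u).sub_const (1 / 4)).mul ((hid u).const_sub 2)).const_mul
      16).mul (((hid u).const_mul 2).const_sub (9 / 4))).congr_deriv ?_
    simp
    ring
  · intro u hu
    refine (((hr γ u hu).const_mul (a / γ)).sub ((hid u).const_mul b)).congr_deriv ?_
    field_simp
  · intro u hu
    refine (((hr (γ - 1) u hu).const_mul a).sub_const b).congr_deriv ?_
    rw [show γ - 1 - 1 = γ - 2 by ring]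
    ring
  · intro u hu
    refine ((hr (γ - 2) u hu).const_mul (a * (γ - 1))).congr_deriv ?_
    rw [show γ - 2 - 1 = γ - 3 by ring]
    ring
  · fun_prop
  · exact continuousOn_const.mul (hrc _)
  · intro u hu
    rw [← bump_eq_of_mem hu.1 hu.2]
    exact (bump_le u).trans (by norm_num)
  · intro u hu
    rw [← bump'_eq_of_mem hu.1 hu.2]
    exact bump'_le u
  · intro u hu
    have := hu.1
    have := hu.2
    rw [abs_le]
    constructor <;> nlinarith
  · exact h128 _ _ (by rw [abs_le]; constructor <;> linarith) (by linarith) (by linarith)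
  · refine h128 _ _ ?_ (by linarith) (by linarith)
    rw [abs_le]
    constructor <;> nlinarith
  · ring

lemma exists_rpow_add_sub_rpow_eq {x q : ℝ} (hx : 0 < x) (hq : 0 < q) (r : ℝ) :
    ∃ ξ, x < ξ ∧ ξ < x + q ∧ (x + q) ^ r - x ^ r = r * ξ ^ (r - 1) * q := by
  obtain ⟨ξ, hξ, h⟩ := exists_hasDerivAt_eq_slope (fun y : ℝ => y ^ r) (fun y => r * y ^ (r - 1))
    (by linarith : x < x + q) (fun y hy => (Real.continuousAt_rpow_const _ _
      (Or.inl (hx.trans_le hy.1).ne')).continuousWithinAt) (fun y hy =>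
      Real.hasDerivAt_rpow_const (Or.inl (hx.trans hy.1).ne'))
  refine ⟨ξ, hξ.1, hξ.2, ?_⟩
  rw [h, add_sub_cancel_left, div_mul_cancel₀ _ hq.ne']

/-- The increments of a power function. -/
noncomputable def rpowDiff (q r x : ℝ) : ℝ := (x + q) ^ r - x ^ r

lemma hasDerivAt_rpowDiff {q r x : ℝ} (hq : 0 < q) (hx : 0 < x) :
    HasDerivAt (rpowDiff q r) (r * rpowDiff q (r - 1) x) x := by
  have h1 := ((hasDerivAt_id x).add_const q).rpow_const (p := r) (Or.inl (by simp; positivity))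
  have h2 := (hasDerivAt_id x).rpow_const (p := r) (Or.inl (by simpa using hx.ne'))
  refine (h1.sub h2).congr_deriv ?_
  simp [rpowDiff]
  ring

lemma rpowDiff_mem {q r x : ℝ} (hq : 0 < q) (hqx : q ≤ x) (hr : r ≤ 1) :
    ∃ κ, 2 ^ (r - 1) ≤ κ ∧ κ ≤ 1 ∧ rpowDiff q r x = r * q * x ^ (r - 1) * κ := by
  have hx : 0 < x := hq.trans_le hqx
  obtain ⟨ξ, h1, h2, h3⟩ := exists_rpow_add_sub_rpow_eq hx hq r
  have hp : 0 < x ^ (r - 1) := by positivity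
  refine ⟨ξ ^ (r - 1) / x ^ (r - 1), ?_, ?_, ?_⟩
  · rw [le_div_iff₀ hp, ← Real.mul_rpow (by norm_num) hx.le]
    exact Real.rpow_le_rpow_of_nonpos (hx.trans h1) (by linarith) (by linarith)
  · rw [div_le_one hp]
    exact Real.rpow_le_rpow_of_nonpos hx h1.le (by linarith)
  · rw [rpowDiff, h3]
    field_simp

lemma rpowDiff_pos {q r x : ℝ} (hq : 0 < q) (hx : 0 < x) (hr : 0 < r) : 0 < rpowDiff q r x :=
  sub_pos.2 (Real.rpow_lt_rpow hx.le (by linarith) hr)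

lemma rpowDiff_anti {q r x y : ℝ} (hq : 0 < q) (hx : 0 < x) (hxy : x ≤ y) (hr : 0 < r)
    (hr1 : r < 1) : rpowDiff q r y ≤ rpowDiff q r x := by
  have h : AntitoneOn (rpowDiff q r) (Set.Ici x) := by
    refine antitoneOn_of_hasDerivWithinAt_nonpos (convex_Ici x)
      (f' := fun z => r * rpowDiff q (r - 1) z)
      (fun z hz => (hasDerivAt_rpowDiff hq (hx.trans_le hz)).continuousAt.continuousWithinAt)
      (fun z hz => ?_) (fun z hz => ?_)
    · rw [interior_Ici] at hz
      exact (hasDerivAt_rpowDiff hq (hx.trans hz)).hasDerivWithinAt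
    · rw [interior_Ici] at hz
      have hz0 : 0 < z := hx.trans hz
      refine mul_nonpos_of_nonneg_of_nonpos hr.le (sub_nonpos.2 ?_)
      exact Real.rpow_le_rpow_of_nonpos hz0 (by linarith) (by linarith)
  exact h (Set.mem_Ici.2 le_rfl) (Set.mem_Ici.2 hxy) hxy

/-- The power of the increment which is inversely proportional to the variable. -/
noncomputable def invDiff (q γ x : ℝ) : ℝ := rpowDiff q γ x ^ (1 / (1 - γ))

lemma invDiff_pos {q γ x : ℝ} (hq : 0 < q) (hx : 0 < x) (h0 : 0 < γ) : 0 < invDiff q γ x :=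
  Real.rpow_pos_of_pos (rpowDiff_pos hq hx h0) _

lemma invDiff_anti {q γ x y : ℝ} (hq : 0 < q) (hx : 0 < x) (hxy : x ≤ y) (h0 : 0 < γ)
    (h1 : γ < 1) : invDiff q γ y ≤ invDiff q γ x :=
  Real.rpow_le_rpow (rpowDiff_pos hq (hx.trans_le hxy) h0).le (rpowDiff_anti hq hx hxy h0 h1)
    (one_div_nonneg.2 (by linarith))

lemma le_invDiff {q γ x y : ℝ} (hq : 0 < q) (hqx : q ≤ x) (hxy : x ≤ y) (hyx : y ≤ 3 * x)
    (h0 : 0 < γ) (h1 : γ < 1) : invDiff q γ x / 6 ≤ invDiff q γ y := by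
  have hx : 0 < x := hq.trans_le hqx
  have hy : 0 < y := hx.trans_le hxy
  obtain ⟨κ, k1, k2, k3⟩ := rpowDiff_mem hq hqx h1.le
  obtain ⟨ι, i1, i2, i3⟩ := rpowDiff_mem hq (hqx.trans hxy) h1.le
  have h2 : (6 : ℝ) ^ (γ - 1) * rpowDiff q γ x ≤ rpowDiff q γ y := by
    rw [k3, i3]
    have : (3 * x) ^ (γ - 1) ≤ y ^ (γ - 1) := Real.rpow_le_rpow_of_nonpos hy hyx (by linarith)
    rw [Real.mul_rpow (by norm_num) hx.le] at this
    calc (6 : ℝ) ^ (γ - 1) * (γ * q * x ^ (γ - 1) * κ) ≤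
        (6 : ℝ) ^ (γ - 1) * (γ * q * x ^ (γ - 1) * 1) := by
          gcongr
      _ = γ * q * (3 ^ (γ - 1) * x ^ (γ - 1)) * 2 ^ (γ - 1) := by
          rw [show (6 : ℝ) = 3 * 2 by norm_num, Real.mul_rpow (by norm_num) (by norm_num)]; ring
      _ ≤ _ := by gcongr
  have h3 : ((6 : ℝ) ^ (γ - 1)) ^ (1 / (1 - γ)) = 1 / 6 := by
    rw [← Real.rpow_mul (by norm_num), show (γ - 1) * (1 / (1 - γ)) = -1 by
      have : 1 - γ ≠ 0 := by linarith
      field_simp; ring, Real.rpow_neg_one]; norm_num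
  have ht := rpowDiff_pos hq hx h0
  have := Real.rpow_le_rpow (by positivity) h2 (one_div_nonneg.2 (by linarith : 0 ≤ 1 - γ))
  rw [Real.mul_rpow (by positivity) ht.le, h3] at this
  unfold invDiff
  linarith

/-- The first derivative of `invDiff`. -/
noncomputable def invDiff' (q γ x : ℝ) : ℝ :=
  γ * rpowDiff q (γ - 1) x * (1 / (1 - γ)) * rpowDiff q γ x ^ (1 / (1 - γ) - 1)

/-- The second derivative of `invDiff`. -/
noncomputable def invDiff'' (q γ x : ℝ) : ℝ :=
  invDiff q γ x * (1 / (1 - γ)) *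
    ((1 / (1 - γ) - 1) * (γ * rpowDiff q (γ - 1) x / rpowDiff q γ x) ^ 2
    + γ * ((γ - 1) * rpowDiff q (γ - 2) x) / rpowDiff q γ x)

lemma hasDerivAt_invDiff {q γ x : ℝ} (hq : 0 < q) (hx : 0 < x) (h0 : 0 < γ) :
    HasDerivAt (invDiff q γ) (invDiff' q γ x) x :=
  (hasDerivAt_rpowDiff hq hx).rpow_const (Or.inl (rpowDiff_pos hq hx h0).ne')

lemma hasDerivAt_invDiff' {q γ x : ℝ} (hq : 0 < q) (hx : 0 < x) (h0 : 0 < γ) :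
    HasDerivAt (invDiff' q γ) (invDiff'' q γ x) x := by
  have ht := rpowDiff_pos hq hx h0
  refine ((((hasDerivAt_rpowDiff (r := γ - 1) hq hx).const_mul γ).mul_const (1 / (1 - γ))).mul
    ((hasDerivAt_rpowDiff (r := γ) hq hx).rpow_const (p := 1 / (1 - γ) - 1)
      (Or.inl ht.ne'))).congr_deriv ?_
  rw [invDiff'', invDiff, show γ - 1 - 1 = γ - 2 by ring]
  generalize 1 / (1 - γ) = p
  rw [Real.rpow_sub_one ht.ne' (p - 1), Real.rpow_sub_one ht.ne' p]
  field_simp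
  ring

lemma invDiff''_mem {q γ x : ℝ} (hq : 0 < q) (hqx : q ≤ x) (h0 : 0 < γ) (h1 : γ < 1) :
    invDiff q γ x / (8 * x ^ 2) ≤ invDiff'' q γ x ∧ invDiff'' q γ x ≤
      8 * invDiff q γ x / x ^ 2 := by
  have hx : 0 < x := hq.trans_le hqx
  obtain ⟨κ, k1, k2, k3⟩ := rpowDiff_mem hq hqx h1.le
  obtain ⟨ι, i1, i2, i3⟩ := rpowDiff_mem (r := γ - 1) hq hqx (by linarith)
  obtain ⟨ρ, r1, r2, r3⟩ := rpowDiff_mem (r := γ - 2) hq hqx (by linarith)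
  have hs := invDiff_pos hq hx h0
  have htwo : ∀ s t : ℝ, -t ≤ s → (2 : ℝ) ^ (-t) ≤ 2 ^ s := fun s t h =>
    Real.rpow_le_rpow_of_exponent_le (by norm_num) h
  have hk : 1 / 2 ≤ κ := by
    have := htwo (γ - 1) 1 (by linarith)
    rw [Real.rpow_neg_one] at this
    norm_num at this ⊢
    linarith
  have hi : 0 < ι := lt_of_lt_of_le (by positivity) i1
  have hr : 1 / 8 ≤ ρ := by
    have := htwo (γ - 2 - 1) (3 : ℕ) (by push_cast; linarith)
    rw [Real.rpow_neg (by norm_num), Real.rpow_natCast] at this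
    norm_num at this ⊢
    linarith
  have hk0 : 0 < κ := by linarith
  have hr0 : 0 < ρ := by linarith
  have e1 : γ * rpowDiff q (γ - 1) x / rpowDiff q γ x = -((1 - γ) * (ι / κ) / x) := by
    rw [k3, i3, Real.rpow_sub_one hx.ne' (γ - 1)]
    field_simp
    ring
  have e2 : γ * ((γ - 1) * rpowDiff q (γ - 2) x) / rpowDiff q γ x =
      (1 - γ) * (2 - γ) * (ρ / κ) / x ^ 2 := by
    rw [k3, r3, Real.rpow_sub_one hx.ne' (γ - 2), show γ - 2 = γ - 1 - 1 by ring,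
      Real.rpow_sub_one hx.ne' (γ - 1)]
    field_simp
    ring
  have h1γ : 0 < 1 - γ := by linarith
  have e3 : invDiff'' q γ x = invDiff q γ x / x ^ 2 * (γ * (ι / κ) ^ 2 + (2 - γ) * (ρ / κ)) := by
    rw [invDiff'', e1, e2]
    field_simp
    ring
  have b1 : ι / κ ≤ 2 := by rw [div_le_iff₀ hk0]; linarith
  have b2 : 0 < ι / κ := by positivity
  have b3 : ρ / κ ≤ 2 := by rw [div_le_iff₀ hk0]; linarith
  have b4 : 1 / 8 ≤ ρ / κ := by rw [le_div_iff₀ hk0]; linarith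
  rw [e3]
  constructor
  · rw [show invDiff q γ x / (8 * x ^ 2) = invDiff q γ x / x ^ 2 * (1 / 8) by field_simp]
    refine mul_le_mul_of_nonneg_left ?_ (by positivity)
    have : 0 ≤ γ * (ι / κ) ^ 2 := by positivity
    nlinarith
  · rw [show 8 * invDiff q γ x / x ^ 2 = invDiff q γ x / x ^ 2 * 8 by ring]
    refine mul_le_mul_of_nonneg_left ?_ (by positivity)
    have : (ι / κ) ^ 2 ≤ 4 := by nlinarith
    nlinarith

lemma exists_norm_sum_e_invDiff_le {γ z0 z1 : ℝ} (h0 : 0 < γ) (h1 : γ < 1) (hz0 : 0 < z0)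
    (hz01 : z0 ≤ z1) : ∃ C, 0 < C ∧ ∀ (a b : ℕ) (q N A V : ℝ), 0 < q → 1 ≤ N → 0 < A → 0 < V →
      (∀ n ∈ Ico a b, N / 2 ≤ n ∧ (n : ℝ) < N ∧ 1 ≤ (n : ℝ) ∧ q ≤ n ∧ z0 ≤ A * invDiff q γ n ∧
        A * invDiff q γ n ≤ z1) →
      ‖∑ n ∈ Ico a b, e (V * (A * invDiff q γ n))‖ ≤ C * (√V + N / √V) := by
  set R : ℝ := 32 * 432 * z1 / z0 with hR
  set w : ℝ := √(z0 / 432) with hw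
  have hz1 : 0 < z1 := hz0.trans_le hz01
  have hwpos : 0 < w := Real.sqrt_pos.2 (by positivity)
  have hR1 : 1 ≤ R := by rw [hR, le_div_iff₀ hz0]; linarith
  refine ⟨10 * R * (2 * w + 1 / w), by positivity, fun a b q N A V hq hN hA hV h => ?_⟩
  have hN0 : 0 < N := by linarith
  have hd : ∀ n ∈ Ico a b, V * z0 / (432 * N ^ 2) ≤
      (V * (A * invDiff q γ ((n : ℝ) + 2)) - V * (A * invDiff q γ ((n : ℝ) + 1))) -
      (V * (A * invDiff q γ ((n : ℝ) + 1)) - V * (A * invDiff q γ (n : ℝ))) ∧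
      (V * (A * invDiff q γ ((n : ℝ) + 2)) - V * (A * invDiff q γ ((n : ℝ) + 1))) -
      (V * (A * invDiff q γ ((n : ℝ) + 1)) - V * (A * invDiff q γ (n : ℝ))) ≤
        R * (V * z0 / (432 * N ^ 2)) := by
    intro n hn
    obtain ⟨g1, g2, g3, g4, g5, g6⟩ := h n hn
    have hn0 : 0 < (n : ℝ) := by linarith
    have hVA : 0 < V * A := by positivity
    have hs := invDiff_pos hq hn0 h0
    have key := second_difference_mem (s := fun y => V * (A * invDiff q γ y))
      (s' := fun y => V * (A * invDiff' q γ y)) (s'' := fun y => V * (A * invDiff'' q γ y))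
      (x := (n : ℝ)) (lo := V * z0 / (432 * N ^ 2)) (hi := R * (V * z0 / (432 * N ^ 2)))
      (fun y hy => ((hasDerivAt_invDiff hq (hn0.trans_le hy.1) h0).const_mul A).const_mul V)
      (fun y hy => ((hasDerivAt_invDiff' hq (hn0.trans_le hy.1) h0).const_mul A).const_mul V)
      (fun y hy => ?_) (fun y hy => ?_)
    · exact key
    · have hy0 : 0 < y := hn0.trans_le hy.1
      have hy3 : y ≤ 3 * n := by linarith [hy.2]
      have m1 := (invDiff''_mem hq (g4.trans hy.1) h0 h1).1
      have m2 := le_invDiff hq g4 hy.1 hy3 h0 h1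
      have hy3N : y ≤ 3 * N := by linarith
      have hsy := invDiff_pos hq hy0 h0
      calc V * z0 / (432 * N ^ 2) ≤ V * (A * invDiff q γ n) / (432 * N ^ 2) := by gcongr
        _ = V * (A * (invDiff q γ n / 6 / (8 * (3 * N) ^ 2))) := by field_simp; ring
        _ ≤ V * (A * (invDiff q γ y / (8 * y ^ 2))) := by gcongr
        _ ≤ _ := by gcongr
    · have hy0 : 0 < y := hn0.trans_le hy.1
      have m1 := (invDiff''_mem hq (g4.trans hy.1) h0 h1).2
      have m2 := invDiff_anti hq hn0 hy.1 h0 h1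
      have hNy : N / 2 ≤ y := g1.trans hy.1
      calc V * (A * invDiff'' q γ y) ≤ V * (A * (8 * invDiff q γ y / y ^ 2)) := by gcongr
        _ ≤ V * (A * (8 * invDiff q γ n / (N / 2) ^ 2)) := by gcongr
        _ = 32 * V * (A * invDiff q γ n) / N ^ 2 := by field_simp; ring
        _ ≤ 32 * V * z1 / N ^ 2 := by gcongr
        _ = _ := by rw [hR]; field_simp
  have hcard : ((b - a : ℕ) : ℝ) ≤ 2 * N := by
    refine card_Ico_le_of_dyadic hN fun n hn => ⟨(h n hn).1, (h n hn).2.1⟩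
  have hmain := second_derivative_test (f := fun n => V * (A * invDiff q γ (n : ℝ))) (a := a)
    (b := b) (lam := V * z0 / (432 * N ^ 2)) (A := R) (by positivity) hR1
    (fun n hn => by have := (hd n hn).1; push_cast; exact this)
    (fun n hn => by have := (hd n hn).2; push_cast; exact this)
  have hsq : √(V * z0 / (432 * N ^ 2)) = √V * w / N := by
    rw [show V * z0 / (432 * N ^ 2) = V * (z0 / 432) / N ^ 2 by field_simp,
      Real.sqrt_div (by positivity), Real.sqrt_mul hV.le, Real.sqrt_sq hN0.le]
  rw [hsq] at hmain
  have hV' : 0 < √V := Real.sqrt_pos.2 hV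
  calc _ ≤ _ := hmain
    _ ≤ 10 * R * (2 * N * (√V * w / N) + 1 / (√V * w / N)) := by gcongr
    _ = 10 * R * (2 * w * √V + 1 / w * (N / √V)) := by field_simp
    _ ≤ 10 * R * ((2 * w + 1 / w) * √V + (2 * w + 1 / w) * (N / √V)) := by
        gcongr
        · exact le_add_of_nonneg_right (by positivity)
        · exact le_add_of_nonneg_left (by positivity)
    _ = _ := by ring

lemma continuous_bump_mul_e {γ : ℝ} (h0 : 0 < γ) (t b : ℝ) :
    Continuous fun u : ℝ => (bump u : ℂ) * e (t * u ^ γ - b * u) :=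
  (Complex.continuous_ofReal.comp continuous_bump).mul (continuous_e.comp
    ((continuous_const.mul (Real.continuous_rpow_const h0.le)).sub
      (continuous_const.mul continuous_id)))

lemma integral_bump_mul_e_eq {γ t b Z z0 z1 : ℝ} (h0 : 0 < γ) (hz0 : 0 < z0) (hZ0 : z0 ≤ Z)
    (hZ1 : Z ≤ z1) (ht : t * γ = b * Z ^ (1 - γ)) :
    ∫ u in (1 / 4 : ℝ)..2, (bump u : ℂ) * e (t * u ^ γ - b * u) =
      ∫ y in (1 / (4 * z1))..(2 / z0),
        ((Z * bump (Z * y) : ℝ) : ℂ) * e (b / γ * statPhase γ y * Z) := by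
  have hZ : 0 < Z := hz0.trans_le hZ0
  have hz1 : 0 < z1 := hZ.trans_le hZ1
  set f : ℝ → ℂ := fun u => (bump u : ℂ) * e (t * u ^ γ - b * u) with hf
  have hfc : Continuous f := continuous_bump_mul_e h0 t b
  have hlo : Z * (1 / (4 * z1)) ≤ 1 / 4 := by
    rw [mul_one_div, div_le_div_iff₀ (by positivity) (by norm_num)]; linarith
  have hhi : 2 ≤ Z * (2 / z0) := by rw [← mul_div_assoc, le_div_iff₀ hz0]; linarith
  have hzero : ∀ p r : ℝ, (∀ u ∈ Set.uIcc p r, u ≤ 1 / 4 ∨ 2 ≤ u) → ∫ u in p..r, f u = 0 := by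
    intro p r h
    rw [intervalIntegral.integral_congr (g := fun _ => 0) fun u hu => by
      simp [hf, bump_eq_zero (h u hu)]]
    simp
  have hchange := intervalIntegral.smul_integral_comp_mul_left f Z (a := 1 / (4 * z1)) (b := 2 / z0)
  have hle : 1 / (4 * z1) ≤ 2 / z0 := by
    have := hlo.trans ((by norm_num : (1 / 4 : ℝ) ≤ 2).trans hhi)
    exact le_of_mul_le_mul_left this hZ
  rw [← intervalIntegral.integral_add_adjacent_intervals (b := 1 / 4)
    (hfc.intervalIntegrable _ _) (hfc.intervalIntegrable _ _),
    ← intervalIntegral.integral_add_adjacent_intervals (a := 1 / 4) (b := 2)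
    (hfc.intervalIntegrable _ _) (hfc.intervalIntegrable _ _),
    hzero (Z * (1 / (4 * z1))) (1 / 4) (fun u hu => by
      rw [Set.uIcc_of_le hlo] at hu; exact Or.inl hu.2),
    hzero 2 (Z * (2 / z0)) (fun u hu => by rw [Set.uIcc_of_le hhi] at hu; exact Or.inr hu.1),
      zero_add,
    add_zero] at hchange
  rw [← hchange, ← intervalIntegral.integral_smul]
  refine intervalIntegral.integral_congr fun y hy => ?_
  rw [Set.uIcc_of_le hle] at hy
  have hy0 : 0 < y := lt_of_lt_of_le (by positivity) hy.1
  have hphase : t * (Z * y) ^ γ - b * (Z * y) = b / γ * statPhase γ y * Z := by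
    have e1 : Z ^ (1 - γ) * Z ^ γ = Z := by
      rw [← Real.rpow_add hZ, sub_add_cancel, Real.rpow_one]
    have e2 : t * (Z * y) ^ γ = b / γ * Z * y ^ γ := by
      rw [Real.mul_rpow hZ.le hy0.le, show t = b * Z ^ (1 - γ) / γ by rw [← ht]; field_simp]
      calc _ = b / γ * (Z ^ (1 - γ) * Z ^ γ) * y ^ γ := by ring
        _ = _ := by rw [e1]
    rw [e2, statPhase]
    field_simp
  simp only [hf, hphase, Complex.real_smul]
  push_cast
  ring

lemma rpowDiff_dyadic {γ q N n : ℝ} (h0 : 0 < γ) (h1 : γ < 1) (hq : 0 < q) (hqn : q ≤ n)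
    (hn : N / 2 ≤ n) (hnN : n < N) : ∃ ρ, 1 / 2 ≤ ρ ∧ ρ ≤ 2 ∧
      rpowDiff q γ n = γ * (q * N ^ (γ - 1)) * ρ := by
  have hn0 : 0 < n := hq.trans_le hqn
  have hN : 0 < N := hn0.trans hnN
  obtain ⟨κ, k1, k2, k3⟩ := rpowDiff_mem hq hqn h1.le
  have hp : 0 < N ^ (γ - 1) := by positivity
  have hk : 1 / 2 ≤ κ := by
    refine le_trans ?_ k1
    have := Real.rpow_le_rpow_of_exponent_le (show (1:ℝ) ≤ 2 by norm_num)
      (show (-1 : ℝ) ≤ γ - 1 by linarith)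
    rw [Real.rpow_neg_one] at this
    linarith
  have a1 : N ^ (γ - 1) ≤ n ^ (γ - 1) := Real.rpow_le_rpow_of_nonpos hn0 hnN.le (by linarith)
  have a2 : n ^ (γ - 1) ≤ 2 * N ^ (γ - 1) := by
    have e1 : n ^ (γ - 1) ≤ (N * 2⁻¹) ^ (γ - 1) :=
      Real.rpow_le_rpow_of_nonpos (by positivity) (by linarith) (by linarith)
    rw [Real.mul_rpow hN.le (by norm_num), Real.inv_rpow (by norm_num),
      ← Real.rpow_neg (by norm_num)] at e1
    have e2 : (2 : ℝ) ^ (-(γ - 1)) ≤ 2 := by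
      have := Real.rpow_le_rpow_of_exponent_le (show (1:ℝ) ≤ 2 by norm_num)
        (show -(γ - 1) ≤ 1 by linarith)
      rwa [Real.rpow_one] at this
    nlinarith
  refine ⟨n ^ (γ - 1) / N ^ (γ - 1) * κ, ?_, ?_, ?_⟩
  · have : 1 ≤ n ^ (γ - 1) / N ^ (γ - 1) := by rwa [one_le_div hp]
    nlinarith
  · have h2 : n ^ (γ - 1) / N ^ (γ - 1) ≤ 2 := by rwa [div_le_iff₀ hp]
    have : 0 < n ^ (γ - 1) / N ^ (γ - 1) := by positivity
    nlinarith
  · rw [k3]; field_simp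

lemma rpow_sub_one_mem {γ u : ℝ} (h0 : 0 < γ) (h1 : γ < 1) (hu : u ∈ Set.Icc (1 / 4 : ℝ) 2) :
    1 / 2 ≤ u ^ (γ - 1) ∧ u ^ (γ - 1) ≤ 4 := by
  have hu0 : 0 < u := by linarith [hu.1]
  constructor
  · calc (1 / 2 : ℝ) = 2 ^ (-1 : ℝ) := by rw [Real.rpow_neg_one]; norm_num
      _ ≤ 2 ^ (γ - 1) := Real.rpow_le_rpow_of_exponent_le (by norm_num) (by linarith)
      _ ≤ _ := Real.rpow_le_rpow_of_nonpos hu0 hu.2 (by linarith)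
  · calc u ^ (γ - 1) ≤ (1 / 4 : ℝ) ^ (γ - 1) :=
          Real.rpow_le_rpow_of_nonpos (by norm_num) hu.1 (by linarith)
      _ ≤ (1 / 4 : ℝ) ^ (-1 : ℝ) :=
          Real.rpow_le_rpow_of_exponent_ge (by norm_num) (by norm_num) (by linarith)
      _ = 4 := by rw [Real.rpow_neg_one]; norm_num

/-- The oscillatory integral is small when its frequency is far from the stationary range. -/
lemma norm_integral_bump_mul_e_le_of_far {γ t b K ρ : ℝ} (h0 : 0 < γ) (h1 : γ < 1) (hK : 0 < K)
    (ht : t * γ = K * ρ) (hρ : 1 / 2 ≤ ρ) (hρ' : ρ ≤ 2) (hb : b < K / 8 ∨ 16 * K < b) :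
    ‖∫ u in (1 / 4 : ℝ)..2, (bump u : ℂ) * e (t * u ^ γ - b * u)‖ ≤
      10 ^ 13 / (K + |b|) ^ 2 := by
  have hΛ : 0 < (K + |b|) / 16 := by positivity
  have hmain := norm_integral_bump_mul_e_le (a := K * ρ) (b := b) (Λ := (K + |b|) / 16) (A := 32)
    h0 h1 (mul_pos hK (by linarith)) hΛ (by norm_num)
    (by have := abs_nonneg b; nlinarith) ?_
  · rw [← ht, mul_div_cancel_right₀ _ h0.ne'] at hmain
    refine hmain.trans ?_
    rw [div_pow, div_div_eq_mul_div]
    gcongr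
    norm_num
  · intro u hu
    obtain ⟨u1, u2⟩ := rpow_sub_one_mem h0 h1 hu
    have k1 : K / 4 ≤ K * ρ * u ^ (γ - 1) := by
      have : 1 / 2 * (1 / 2) ≤ ρ * u ^ (γ - 1) := mul_le_mul hρ u1 (by norm_num) (by linarith)
      nlinarith
    have k2 : K * ρ * u ^ (γ - 1) ≤ 8 * K := by
      have : ρ * u ^ (γ - 1) ≤ 2 * 4 := mul_le_mul hρ' u2 (by linarith) (by norm_num)
      nlinarith
    rcases hb with hb | hb
    · refine le_trans ?_ (le_abs_self _)
      rcases le_total 0 b with hb0 | hb0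
      · rw [abs_of_nonneg hb0]; linarith
      · rw [abs_of_nonpos hb0]; linarith
    · rw [abs_sub_comm]
      refine le_trans ?_ (le_abs_self _)
      rw [abs_of_nonneg (by linarith : 0 ≤ b)]
      linarith

set_option maxHeartbeats 1000000 in
/-- The sum of oscillatory integrals whose frequency lies in the stationary range. -/
lemma exists_norm_sum_integral_le {γ : ℝ} (h0 : 0 < γ) (h1 : γ < 1) : ∃ C, 0 < C ∧
    ∀ (i j : ℕ) (q N H b F : ℝ), 0 < q → 1 ≤ N → 0 < H → F = H * (q * N ^ (γ - 1)) → 1 ≤ F →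
      (∀ n ∈ Ico i j, N / 2 ≤ (n : ℝ) ∧ (n : ℝ) < N ∧ 1 ≤ (n : ℝ) ∧ q ≤ n) →
      γ ^ 2 * F / 8 ≤ b → b ≤ 16 * (γ ^ 2 * F) →
      ‖∑ n ∈ Ico i j, ∫ u in (1 / 4 : ℝ)..2,
        (bump u : ℂ) * e (H * rpowDiff q γ n * u ^ γ - b * u)‖ ≤ C * (1 + N / F) := by
  have h1γ : 0 < 1 - γ := by linarith
  set p : ℝ := 1 / (1 - γ) with hp
  have hp0 : 0 < p := by positivity
  set z0 : ℝ := (1 / 32) ^ p with hz0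
  set z1 : ℝ := 16 ^ p with hz1
  have hz0pos : 0 < z0 := by positivity
  have hz0le : z0 ≤ 1 := Real.rpow_le_one (by norm_num) (by norm_num) hp0.le
  have hz1le : 1 ≤ z1 := Real.one_le_rpow (by norm_num) hp0.le
  obtain ⟨C1, hC1, H1⟩ := exists_norm_integral_sum_le h0 h1 hz0pos hz0le hz1le
  obtain ⟨C2, hC2, H2⟩ := exists_norm_sum_e_invDiff_le h0 h1 hz0pos (hz0le.trans hz1le)
  set c0 : ℝ := 1 / (4 * z1) with hc0
  have hc0pos : 0 < c0 := by positivity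
  set v0 : ℝ := c0 * (1 - γ) / 2 with hv0
  have hv0pos : 0 < v0 := by positivity
  set r0 : ℝ := √(γ / 8 * v0) with hr0
  have hr0pos : 0 < r0 := Real.sqrt_pos.2 (by positivity)
  set r1 : ℝ := √24 with hr1
  have hr1pos : 0 < r1 := Real.sqrt_pos.2 (by norm_num)
  set C3 : ℝ := C2 * (r1 + 1 / r0) with hC3
  have hC3pos : 0 < C3 := by positivity
  refine ⟨C1 * (C3 + 16 / γ * C3 + 16 / γ), by positivity,
    fun i j q N H b F hq hN hH hF hF1 hn hb1 hb2 => ?_⟩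
  have hF0 : 0 < F := by linarith
  have hN0 : 0 < N := by linarith
  have hb0 : 0 < b := lt_of_lt_of_le (by positivity) hb1
  set ω : ℝ := b / γ with hω
  have hω0 : 0 < ω := by positivity
  have hω1 : γ / 8 * F ≤ ω := by
    rw [hω, le_div_iff₀ h0]; calc _ = γ ^ 2 * F / 8 := by ring
      _ ≤ b := hb1
  have hω2 : ω ≤ 16 * F := by
    rw [hω, div_le_iff₀ h0]
    refine hb2.trans ?_
    have : γ ^ 2 * F ≤ γ * F := by
      apply mul_le_mul_of_nonneg_right _ hF0.le; nlinarith
    linarith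
  set A : ℝ := (γ * H / b) ^ p with hA
  have hApos : 0 < A := by positivity
  set Z : ℕ → ℝ := fun n => A * invDiff q γ n with hZ
  have hZeq : ∀ n ∈ Ico i j, Z n = (γ * H / b * rpowDiff q γ n) ^ p := fun n h => by
    obtain ⟨_, _, g3, g4⟩ := hn n h
    rw [hZ, Real.mul_rpow (by positivity) (rpowDiff_pos hq (by linarith) h0).le]
    rfl
  have hZmem : ∀ n ∈ Ico i j, z0 ≤ Z n ∧ Z n ≤ z1 := by
    intro n h
    obtain ⟨g1, g2, g3, g4⟩ := hn n h
    obtain ⟨ρ, r1, r2, r3⟩ := rpowDiff_dyadic h0 h1 hq g4 g1 g2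
    have e1 : γ * H / b * rpowDiff q γ n = γ ^ 2 * F * ρ / b := by
      rw [r3, hF]; ring
    have hγF : 0 < γ ^ 2 * F := by positivity
    have hρ0 : 0 < ρ := by linarith
    rw [hZeq n h, e1]
    constructor
    · refine Real.rpow_le_rpow (by norm_num) ?_ hp0.le
      rw [le_div_iff₀ hb0]
      nlinarith
    · refine Real.rpow_le_rpow (by positivity) ?_ hp0.le
      rw [div_le_iff₀ hb0]
      nlinarith
  have hZpos : ∀ n ∈ Ico i j, 0 ≤ Z n := fun n h => hz0pos.le.trans (hZmem n h).1
  have hsum : ∑ n ∈ Ico i j, ∫ u in (1 / 4 : ℝ)..2,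
        (bump u : ℂ) * e (H * rpowDiff q γ n * u ^ γ - b * u) =
      ∫ y in c0..(2 / z0), ∑ n ∈ Ico i j,
        ((Z n * bump (Z n * y) : ℝ) : ℂ) * e (ω * statPhase γ y * Z n) := by
    rw [intervalIntegral.integral_finsetSum]
    · refine sum_congr rfl fun n h => ?_
      obtain ⟨g1, g2, g3, g4⟩ := hn n h
      refine integral_bump_mul_e_eq h0 hz0pos (hZmem n h).1 (hZmem n h).2 ?_
      have hr := rpowDiff_pos hq (by linarith : (0:ℝ) < n) h0
      rw [hZeq n h, ← Real.rpow_mul (by positivity), hp, one_div_mul_cancel h1γ.ne', Real.rpow_one]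
      field_simp
    · intro n h
      have hle : c0 ≤ 2 / z0 := by
        have hc01 : c0 ≤ 1 := by rw [hc0, div_le_one (by positivity)]; linarith
        refine hc01.trans ?_
        rw [le_div_iff₀ hz0pos]; linarith
      refine ContinuousOn.intervalIntegrable ?_
      rw [Set.uIcc_of_le hle]
      have := continuousOn_sum_mul_e_statPhase (γ := γ) (ω := ω) (t := {n}) (Z := Z)
        (g := fun n y => Z n * bump (Z n * y)) (s := Set.Icc c0 (2 / z0)) (fun n =>
        continuous_const.mul (continuous_bump.comp (continuous_const.mul continuous_id)))
        fun y hy => hc0pos.trans_le hy.1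
      simpa only [sum_singleton] using this
  rw [hsum]
  have hsF : 0 < √F := Real.sqrt_pos.2 hF0
  have hsF1 : 1 ≤ √F := by rwa [Real.one_le_sqrt]
  have hsFF : √F * √F = F := Real.mul_self_sqrt hF0.le
  have hmain := H1 i j Z ω (1 / (2 * √F)) (C3 * (√F + N / √F)) (2 * N) (fun n hin hnj => ?_) hZpos
    (fun n h => (hZmem n h).2) hω0 (by positivity) ?_ ?_ ?_
  · refine hmain.trans ?_
    rw [mul_assoc C1]
    refine mul_le_mul_of_nonneg_left ?_ hC1.le
    have hNF : N / F = N / (√F * √F) := by rw [hsFF]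
    have e1 : 1 / (2 * √F) * (C3 * (√F + N / √F)) = C3 / 2 * (1 + N / F) := by
      rw [hNF]; field_simp
    have e2 : C3 * (√F + N / √F) / (ω * (1 / (2 * √F))) ≤ 16 / γ * C3 * (1 + N / F) := by
      calc C3 * (√F + N / √F) / (ω * (1 / (2 * √F)))
          ≤ C3 * (√F + N / √F) / (γ / 8 * F * (1 / (2 * √F))) := by gcongr
        _ = 16 / γ * C3 * (1 + N / F) := by
          rw [hNF, show γ / 8 * F = γ / 8 * (√F * √F) by rw [hsFF]]; field_simp; ring
    have e3 : 2 * N / ω ≤ 16 / γ * (1 + N / F) := by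
      calc 2 * N / ω ≤ 2 * N / (γ / 8 * F) := by gcongr
        _ = 16 / γ * (N / F) := by field_simp; ring
        _ ≤ _ := by gcongr; linarith
    have e4 : C3 / 2 * (1 + N / F) ≤ C3 * (1 + N / F) := by gcongr; linarith
    rw [e1]
    linarith
  · refine mul_le_mul_of_nonneg_left ?_ hApos.le
    obtain ⟨g1, g2, g3, g4⟩ := hn n (mem_Ico.2 ⟨hin, by omega⟩)
    exact invDiff_anti hq (by linarith) (by push_cast; linarith) h0 h1
  · rw [div_le_div_iff₀ (by positivity) (by norm_num)]; linarith
  · rw [Nat.card_Ico]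
    exact card_Ico_le_of_dyadic hN fun n h => ⟨(hn n h).1, (hn n h).2.1⟩
  · intro y hy k hk
    have hy0 : 0 < y := hc0pos.trans_le hy.1
    have hv := le_statPhase h1 hc0pos hy.1 hy.2
    have hvu : statPhase γ y ≤ 3 / 2 := by
      have : y ^ γ ≤ 3 / 2 := by
        calc y ^ γ ≤ (3 / 2) ^ γ := Real.rpow_le_rpow hy0.le hy.2 h0.le
          _ ≤ (3 / 2) ^ (1 : ℝ) := Real.rpow_le_rpow_of_exponent_le (by norm_num) h1.le
          _ = _ := Real.rpow_one _
      have : 0 < γ * y := by positivity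
      rw [statPhase]; linarith
    have hVpos : 0 < ω * statPhase γ y := mul_pos hω0 (by linarith)
    have h2 := H2 i k q N A (ω * statPhase γ y) hq hN hApos hVpos fun n h => by
      have hm : n ∈ Ico i j := by rw [mem_Ico] at h ⊢; omega
      obtain ⟨g1, g2, g3, g4⟩ := hn n hm
      exact ⟨g1, g2, g3, g4, hZmem n hm⟩
    refine h2.trans ?_
    have s1 : √(ω * statPhase γ y) ≤ r1 * √F := by
      rw [hr1, ← Real.sqrt_mul (by norm_num)]
      refine Real.sqrt_le_sqrt ?_
      nlinarith
    have s0 : r0 * √F ≤ √(ω * statPhase γ y) := by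
      rw [hr0, ← Real.sqrt_mul (by positivity)]
      refine Real.sqrt_le_sqrt ?_
      calc γ / 8 * v0 * F = γ / 8 * F * v0 := by ring
        _ ≤ ω * statPhase γ y := mul_le_mul hω1 hv hv0pos.le hω0.le
    rw [hC3, mul_assoc]
    refine mul_le_mul_of_nonneg_left ?_ hC2.le
    calc √(ω * statPhase γ y) + N / √(ω * statPhase γ y) ≤ r1 * √F + N / (r0 * √F) := by gcongr
      _ = r1 * √F + 1 / r0 * (N / √F) := by field_simp
      _ ≤ (r1 + 1 / r0) * √F + (r1 + 1 / r0) * (N / √F) := by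
        gcongr
        · exact le_add_of_nonneg_right (by positivity)
        · exact le_add_of_nonneg_left (by positivity)
      _ = _ := by ring

lemma sum_range_one_div_add_mul_sq_le {K M : ℝ} (hK : 0 < K) (hM : 0 < M) (n : ℕ) :
    ∑ k ∈ range n, 1 / (K + M * k) ^ 2 ≤ 1 / K ^ 2 + 1 / (M * K) := by
  have key : ∀ n : ℕ, ∑ k ∈ range (n + 1), 1 / (K + M * k) ^ 2 ≤
      1 / K ^ 2 + 1 / M * (1 / K - 1 / (K + M * n)) := by
    intro n
    induction n with
    | zero => simp
    | succ n ih =>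
      rw [sum_range_succ]
      have h : 1 / (K + M * (n + 1 : ℕ)) ^ 2 ≤ 1 / M *
        (1 / (K + M * n) - 1 / (K + M * (n + 1 : ℕ))) := by
        have e1 : 1 / M * (1 / (K + M * n) - 1 / (K + M * (n + 1 : ℕ))) =
            1 / ((K + M * n) * (K + M * (n + 1 : ℕ))) := by
          have : 0 < K + M * n := by positivity
          have : 0 < K + M * (n + 1) := by positivity
          push_cast
          field_simp
          ring
        rw [e1, sq]
        push_cast
        gcongr
        linarith
      have e2 : 1 / M * (1 / K - 1 / (K + M * (n + 1 : ℕ))) =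
        1 / M * (1 / K - 1 / (K + M * n)) +
          1 / M * (1 / (K + M * n) - 1 / (K + M * (n + 1 : ℕ))) := by
        ring
      rw [e2]
      linarith
  calc _ ≤ ∑ k ∈ range (n + 1), 1 / (K + M * k) ^ 2 := by
        rw [sum_range_succ]
        exact le_add_of_nonneg_right (by positivity)
    _ ≤ _ := key n
    _ ≤ 1 / K ^ 2 + 1 / M * (1 / K) := by
        gcongr
        exact sub_le_self _ (by positivity)
    _ = _ := by rw [one_div_mul_one_div]

lemma summable_one_div_add_abs_sq {K M β : ℝ} (hK : 0 < K) (hM : 0 < M) (hβ : -1 ≤ β)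
    (hβ' : β ≤ 0) : Summable (fun μ : ℤ => 1 / (K + |M * (μ - β)|) ^ 2) ∧
      ∑' μ : ℤ, 1 / (K + |M * (μ - β)|) ^ 2 ≤ 2 * (1 / K ^ 2 + 1 / (M * K)) := by
  set f : ℤ → ℝ := fun μ => 1 / (K + |M * (μ - β)|) ^ 2 with hf
  have hb1 : ∀ n : ℕ, f n ≤ 1 / (K + M * n) ^ 2 := by
    intro n
    have : M * n ≤ |M * (((n : ℤ) : ℝ) - β)| := by
      refine le_trans ?_ (le_abs_self _)
      push_cast
      gcongr
      linarith
    simp only [hf]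
    gcongr
  have hb2 : ∀ n : ℕ, f (-(n + 1)) ≤ 1 / (K + M * n) ^ 2 := by
    intro n
    have : M * n ≤ |M * (((-(n + 1) : ℤ) : ℝ) - β)| := by
      refine le_trans ?_ (neg_le_abs _)
      push_cast
      rw [← mul_neg]
      gcongr
      linarith
    simp only [hf]
    gcongr
  have hn1 : ∀ μ, 0 ≤ f μ := fun μ => by simp only [hf]; positivity
  have hs1 : ∀ n, ∑ k ∈ range n, f (k : ℤ) ≤ 1 / K ^ 2 + 1 / (M * K) := fun n =>
    (sum_le_sum fun k _ => hb1 k).trans (sum_range_one_div_add_mul_sq_le hK hM n)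
  have hs2 : ∀ n : ℕ, ∑ k ∈ range n, f (-((k : ℤ) + 1)) ≤ 1 / K ^ 2 + 1 / (M * K) := fun n =>
    (sum_le_sum fun k _ => hb2 k).trans (sum_range_one_div_add_mul_sq_le hK hM n)
  have S1 : Summable fun k : ℕ => f (k : ℤ) := summable_of_sum_range_le (fun _ => hn1 _) hs1
  have S2 : Summable fun k : ℕ => f (-((k : ℤ) + 1)) :=
    summable_of_sum_range_le (fun _ => hn1 _) hs2
  refine ⟨Summable.of_nat_of_neg_add_one S1 S2, ?_⟩
  rw [tsum_of_nat_of_neg_add_one S1 S2, two_mul]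
  exact add_le_add (Real.tsum_le_of_sum_range_le (fun _ => hn1 _) hs1)
    (Real.tsum_le_of_sum_range_le (fun _ => hn1 _) hs2)

lemma norm_integral_bump_mul_e_le_sixteen (t b γ : ℝ) :
    ‖∫ u in (1 / 4 : ℝ)..2, (bump u : ℂ) * e (t * u ^ γ - b * u)‖ ≤ 16 := by
  refine (intervalIntegral.norm_integral_le_of_norm_le_const (C := 8) fun u _ => ?_).trans ?_
  · rw [norm_mul, norm_e, mul_one, Complex.norm_real]
    exact bump_le u
  · norm_num

lemma fourier_bump_div_mul_e {γ M : ℝ} (hM : 0 < M) (β τ μ : ℝ) :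
    FourierTransform.fourier (fun x : ℝ => (bump (x / M) : ℂ) * e (β * x + τ * |x| ^ γ)) μ =
      M * ∫ u in (1 / 4 : ℝ)..2, (bump u : ℂ) * e (τ * M ^ γ * u ^ γ - M * (μ - β) * u) := by
  set g : ℝ → ℂ := fun u => (bump u : ℂ) * e (τ * M ^ γ * |u| ^ γ - M * (μ - β) * u) with hg
  have h1 : ∀ x : ℝ, Complex.exp (↑(-2 * Real.pi * x * μ) * Complex.I) •
      ((bump (x / M) : ℂ) * e (β * x + τ * |x| ^ γ)) = g (M⁻¹ * x) := by
    intro x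
    have e0 : Complex.exp (↑(-2 * Real.pi * x * μ) * Complex.I) = e (-(μ * x)) := by
      rw [e]; congr 1; push_cast; ring
    have e1 : |M⁻¹ * x| = |x| / M := by
      rw [abs_mul, abs_of_pos (by positivity : 0 < M⁻¹)]; ring
    simp only [hg]
    rw [e0, smul_eq_mul, mul_left_comm, ← e_add, e1, Real.div_rpow (abs_nonneg x) hM.le]
    congr 2
    · rw [div_eq_inv_mul]
    · field_simp
      ring
  rw [Real.fourier_real_eq_integral_exp_smul]
  simp_rw [h1]
  rw [MeasureTheory.Measure.integral_comp_mul_left, inv_inv, abs_of_pos hM, Complex.real_smul,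
    ← intervalIntegral.integral_eq_integral_of_support_subset (a := 1 / 4) (b := 2)]
  · congr 1
    refine intervalIntegral.integral_congr fun u hu => ?_
    rw [Set.uIcc_of_le (by norm_num)] at hu
    simp only [hg]
    rw [abs_of_nonneg (by linarith [hu.1] : (0:ℝ) ≤ u)]
  · intro u hu
    by_contra hcon
    refine hu ?_
    have : bump u = 0 := bump_eq_zero (by
      rw [Set.mem_Ioc, not_and_or, not_lt, not_le] at hcon
      rcases hcon with h | h
      · exact Or.inl h
      · exact Or.inr h.le)
    simp [hg, this]

lemma sum_bump_mul_e_eq_tsum {γ M β τ K ρ : ℝ} (h0 : 0 < γ) (h1 : γ < 1) (hM : 0 < M) (hK : 0 < K)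
    (ht : τ * M ^ γ * γ = K * ρ) (hρ : 1 / 2 ≤ ρ) (hρ' : ρ ≤ 2) (hβ : -1 ≤ β) (hβ' : β ≤ 0) :
    (Summable fun μ : ℤ => ∫ u in (1 / 4 : ℝ)..2,
      (bump u : ℂ) * e (τ * M ^ γ * u ^ γ - M * (μ - β) * u)) ∧
    ∑ m ∈ range ⌈2 * M⌉₊, (bump (m / M) : ℂ) * e (β * m + τ * (m : ℝ) ^ γ) =
      M * ∑' μ : ℤ, ∫ u in (1 / 4 : ℝ)..2,
        (bump u : ℂ) * e (τ * M ^ γ * u ^ γ - M * (μ - β) * u) := by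
  set I : ℤ → ℂ := fun μ => ∫ u in (1 / 4 : ℝ)..2,
      (bump u : ℂ) * e (τ * M ^ γ * u ^ γ - M * (μ - β) * u) with hI
  set f : ℝ → ℂ := fun x => (bump (x / M) : ℂ) * e (β * x + τ * |x| ^ γ) with hf
  have hF : ∀ μ : ℤ, FourierTransform.fourier f (μ : ℝ) = M * I μ := fun μ =>
    fourier_bump_div_mul_e hM β τ μ
  have hS : Summable I := by
    refine Summable.of_norm_bounded
      (g := fun μ : ℤ => 10 ^ 13 * (1 / (K + |M * (μ - β)|) ^ 2) + 16 * (17 * K) ^ 2 *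
        (1 / (K + |M * (μ - β)|) ^ 2))
      ?_ fun μ => ?_
    · have := (summable_one_div_add_abs_sq hK hM hβ hβ').1
      exact (this.mul_left _).add (this.mul_left _)
    · by_cases hb : M * (μ - β) < K / 8 ∨ 16 * K < M * (μ - β)
      · have := norm_integral_bump_mul_e_le_of_far h0 h1 hK ht hρ hρ' hb
        refine this.trans ?_
        rw [mul_one_div]
        exact le_add_of_nonneg_right (by positivity)
      · rw [not_or, not_lt, not_lt] at hb
        refine (norm_integral_bump_mul_e_le_sixteen _ _ _).trans ?_
        refine le_trans ?_ (le_add_of_nonneg_left (by positivity))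
        rw [abs_of_nonneg (by linarith [hb.1]), mul_assoc, mul_one_div]
        refine le_mul_of_one_le_right (by norm_num) ?_
        have : 0 < K + M * (μ - β) := by linarith [hb.1]
        rw [one_le_div (by positivity)]
        gcongr
        linarith [hb.2]
  refine ⟨hS, ?_⟩
  have hfc : Continuous f := by
    refine (Complex.continuous_ofReal.comp (continuous_bump.comp (by fun_prop))).mul
      (continuous_e.comp ((by fun_prop : Continuous fun x : ℝ => β * x).add
        (continuous_const.mul ((Real.continuous_rpow_const h0.le).comp continuous_abs))))
  have hO : f =O[Filter.cocompact ℝ] fun x => |x| ^ (-(2:ℝ)) := by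
    rw [Asymptotics.isBigO_iff]
    refine ⟨1, ?_⟩
    rw [Filter.Eventually, Filter.mem_cocompact]
    refine ⟨Set.Icc 0 (2 * M), isCompact_Icc, fun x hx => ?_⟩
    have : bump (x / M) = 0 := bump_eq_zero (by
      rw [Set.mem_compl_iff, Set.mem_Icc, not_and_or, not_le, not_le] at hx
      rcases hx with h | h
      · left
        exact (div_nonpos_of_nonpos_of_nonneg h.le hM.le).trans (by norm_num)
      · right
        rw [le_div_iff₀ hM]; exact h.le)
    simp only [Set.mem_ofPred_eq, hf, this]
    simp only [Complex.ofReal_zero, zero_mul, norm_zero]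
    positivity
  have hP := Real.tsum_eq_tsum_fourier_of_rpow_decay_of_summable hfc (by norm_num : (1:ℝ) < 2) hO
    (by simp_rw [hF]; exact hS.mul_left _) 0
  simp only [zero_add, QuotientAddGroup.mk_zero, fourier_eval_zero, mul_one, hF] at hP
  rw [← tsum_mul_left, ← hP, tsum_eq_sum (s := (range ⌈2 * M⌉₊).map Nat.castEmbedding)]
  · rw [sum_map]
    refine sum_congr rfl fun m _ => ?_
    simp only [hf, Nat.castEmbedding_apply, Int.cast_natCast, Nat.abs_cast]
  · intro b hb
    have : bump ((b : ℝ) / M) = 0 := bump_eq_zero (by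
      by_contra hcon
      rw [not_or, not_le, not_le, div_lt_iff₀ hM, lt_div_iff₀ hM] at hcon
      have hb0 : (0:ℝ) < b := lt_trans (by positivity) hcon.1
      have hb0' : 0 ≤ b := by exact_mod_cast hb0.le
      lift b to ℕ using hb0'
      refine hb (mem_map.2 ⟨b, mem_range.2 (Nat.lt_ceil.2 ?_), rfl⟩)
      exact_mod_cast hcon.2)
    simp [hf, this]

lemma card_int_Icc_ceil_floor_le {x y : ℝ} (h : x ≤ y) : ((Icc ⌈x⌉ ⌊y⌋).card : ℝ) ≤ y - x + 1 := by
  rw [Int.card_Icc]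
  have h1 := Int.floor_le y
  have h2 := Int.le_ceil x
  have h3 : ((max (⌊y⌋ + 1 - ⌈x⌉) 0 : ℤ) : ℝ) ≤ y - x + 1 := by
    push_cast
    exact max_le (by linarith) (by linarith)
  rw [← Int.toNat_eq_max] at h3
  exact_mod_cast h3

/-- Poisson summation in `m` followed by a sum over `n` saves over the trivial bound. -/
lemma exists_norm_sum_bump_mul_e_le {γ : ℝ} (h0 : 0 < γ) (h1 : γ < 1) : ∃ C, 0 < C ∧
    ∀ (i j : ℕ) (q N H M β F : ℝ), 0 < q → 1 ≤ N → 1 ≤ M → 0 < H →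
      F = H * M ^ γ * (q * N ^ (γ - 1)) → 1 ≤ F →
      (∀ n ∈ Ico i j, N / 2 ≤ (n : ℝ) ∧ (n : ℝ) < N ∧ 1 ≤ (n : ℝ) ∧ q ≤ n) →
      ‖∑ n ∈ Ico i j, ∑ m ∈ range ⌈2 * M⌉₊,
        (bump (m / M) : ℂ) * e (β * m + H * rpowDiff q γ n * (m : ℝ) ^ γ)‖ ≤
        C * (F + N + M + M * N / F) := by
  obtain ⟨C, hC, HC⟩ := exists_norm_sum_integral_le h0 h1
  refine ⟨4 * 10 ^ 13 * (1 / γ ^ 4 + 1 / γ ^ 2) + 16 * C, by positivity,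
    fun i j q N H M β F hq hN hM hH hF hF1 hn => ?_⟩
  have hF0 : 0 < F := by linarith
  have hM0 : 0 < M := by linarith
  have hN0 : 0 < N := by linarith
  set K : ℝ := γ ^ 2 * F with hK
  have hK0 : 0 < K := by positivity
  set β' : ℝ := Int.fract β - 1 with hβ'
  have hb1 : -1 ≤ β' := by linarith [Int.fract_nonneg β]
  have hb2 : β' ≤ 0 := by linarith [Int.fract_lt_one β]
  have hshift : ∀ (m : ℕ) (x : ℝ), e (β * m + x) = e (β' * m + x) := by
    intro m x
    rw [← e_sub_intCast (β * m + x) ((⌊β⌋ + 1) * m)]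
    congr 1
    rw [hβ', Int.fract]
    push_cast
    ring
  simp_rw [hshift]
  set I : ℕ → ℤ → ℂ := fun n μ => ∫ u in (1 / 4 : ℝ)..2,
    (bump u : ℂ) * e (H * rpowDiff q γ n * M ^ γ * u ^ γ - M * (μ - β') * u) with hI
  have hρ : ∀ n ∈ Ico i j, ∃ ρ, 1 / 2 ≤ ρ ∧ ρ ≤ 2 ∧ H * rpowDiff q γ n * M ^ γ * γ = K * ρ := by
    intro n h
    obtain ⟨g1, g2, g3, g4⟩ := hn n h
    obtain ⟨ρ, r1, r2, r3⟩ := rpowDiff_dyadic h0 h1 hq g4 g1 g2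
    refine ⟨ρ, r1, r2, ?_⟩
    rw [r3, hK, hF]
    ring
  have hP : ∀ n ∈ Ico i j, (Summable (I n)) ∧ ∑ m ∈ range ⌈2 * M⌉₊,
      (bump (m / M) : ℂ) * e (β' * m + H * rpowDiff q γ n * (m : ℝ) ^ γ) = M * ∑' μ, I n μ := by
    intro n h
    obtain ⟨ρ, r1, r2, r3⟩ := hρ n h
    exact sum_bump_mul_e_eq_tsum h0 h1 hM0 hK0 r3 r1 r2 hb1 hb2
  rw [sum_congr rfl fun n h => (hP n h).2, ← mul_sum,
    ← Summable.tsum_finsetSum fun n h => (hP n h).1, norm_mul, Complex.norm_real,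
    Real.norm_of_nonneg hM0.le]
  set G : ℤ → ℝ := fun μ => 1 / (K + |M * (μ - β')|) ^ 2 with hG
  obtain ⟨hGs, hGt⟩ := summable_one_div_add_abs_sq hK0 hM0 hb1 hb2
  set T : Finset ℤ := Icc ⌈β' + K / (8 * M)⌉ ⌊β' + 16 * K / M⌋ with hT
  set D : ℝ := C * (1 + N / F) with hD
  have hD0 : 0 ≤ D := by positivity
  have hcard : (#(Ico i j) : ℝ) ≤ 2 * N := by
    rw [Nat.card_Ico]
    exact card_Ico_le_of_dyadic hN fun n h => ⟨(hn n h).1, (hn n h).2.1⟩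
  have hterm : ∀ μ : ℤ, ‖∑ n ∈ Ico i j, I n μ‖ ≤
      2 * N * 10 ^ 13 * G μ + if μ ∈ T then D else 0 := by
    intro μ
    have hG0 : 0 ≤ G μ := by simp only [hG]; positivity
    by_cases hb : M * (μ - β') < K / 8 ∨ 16 * K < M * (μ - β')
    · calc ‖∑ n ∈ Ico i j, I n μ‖ ≤ ∑ n ∈ Ico i j, 10 ^ 13 * G μ := by
            refine norm_sum_le_of_le _ fun n h => ?_
            obtain ⟨ρ, r1, r2, r3⟩ := hρ n h
            rw [hG, mul_one_div]
            exact norm_integral_bump_mul_e_le_of_far h0 h1 hK0 r3 r1 r2 hb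
        _ = #(Ico i j) * (10 ^ 13 * G μ) := by rw [sum_const, nsmul_eq_mul]
        _ ≤ 2 * N * (10 ^ 13 * G μ) := by gcongr
        _ = 2 * N * 10 ^ 13 * G μ := by ring
        _ ≤ _ := le_add_of_nonneg_right (by positivity)
    · rw [not_or, not_lt, not_lt] at hb
      have hmem : μ ∈ T := by
        rw [hT, mem_Icc, Int.ceil_le, Int.le_floor]
        constructor
        · have : K / (8 * M) ≤ μ - β' := by
            rw [div_le_iff₀ (by positivity)]; linarith [hb.1]
          linarith
        · have : μ - β' ≤ 16 * K / M := by
            rw [le_div_iff₀ hM0]; linarith [hb.2]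
          linarith
      rw [if_pos hmem]
      refine le_trans ?_ (le_add_of_nonneg_left (by positivity))
      have := HC i j q N (H * M ^ γ) (M * (μ - β')) F hq hN (by positivity) hF hF1 hn hb.1 hb.2
      simp_rw [mul_right_comm H (M ^ γ)] at this
      exact this
  have hsum : HasSum (fun μ : ℤ => 2 * N * 10 ^ 13 * G μ + if μ ∈ T then D else 0)
      (2 * N * 10 ^ 13 * ∑' μ, G μ + #T * D) := by
    refine (hGs.hasSum.mul_left _).add ?_
    have := hasSum_sum_of_ne_finset_zero (L := .unconditional ℤ)
      (f := fun μ : ℤ => if μ ∈ T then D else 0) (s := T)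
      fun b hb => if_neg hb
    rwa [sum_congr rfl fun b hb => if_pos hb, sum_const, nsmul_eq_mul] at this
  have hTcard : (#T : ℝ) ≤ 16 * K / M + 1 := by
    have hle : K / (8 * M) ≤ 16 * K / M := by
      rw [div_le_div_iff₀ (by positivity) hM0]
      nlinarith [mul_pos hK0 hM0]
    have : 0 ≤ K / (8 * M) := by positivity
    have := card_int_Icc_ceil_floor_le (x := β' + K / (8 * M)) (y := β' + 16 * K / M) (by linarith)
    linarith
  calc M * ‖∑' μ, ∑ n ∈ Ico i j, I n μ‖
      ≤ M * (2 * N * 10 ^ 13 * ∑' μ, G μ + #T * D) := by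
        gcongr
        exact tsum_of_norm_bounded hsum hterm
    _ ≤ M * (2 * N * 10 ^ 13 * (2 * (1 / K ^ 2 + 1 / (M * K))) + (16 * K / M + 1) * D) := by
        gcongr
    _ = 4 * 10 ^ 13 * (1 / γ ^ 4 * (M * N / F / F) + 1 / γ ^ 2 * (N / F)) +
        C * (16 * γ ^ 2 * F + 16 * γ ^ 2 * N + M + M * N / F) := by
        rw [hK, hD]
        field_simp
        ring
    _ ≤ 4 * 10 ^ 13 * (1 / γ ^ 4 * (F + N + M + M * N / F) + 1 / γ ^ 2 * (F + N + M + M * N / F)) +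
        C * (16 * F + 16 * N + 16 * M + 16 * (M * N / F)) := by
        have hγ2 : γ ^ 2 ≤ 1 := pow_le_one₀ h0.le h1.le
        have e1 : N / F ≤ N := div_le_self hN0.le hF1
        have e2 : M * N / F / F ≤ M * N / F := div_le_self (by positivity) hF1
        have e3 : 0 ≤ M * N / F := by positivity
        have e4 : 16 * γ ^ 2 * F ≤ 16 * F := by nlinarith
        have e5 : 16 * γ ^ 2 * N ≤ 16 * N := by nlinarith
        gcongr <;> linarith
    _ = _ := by ring

/-- The sequence `z`, restricted to `[A, B)` and shifted by `q`. -/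
noncomputable def shifted (z : ℕ → ℂ) (A B q k : ℕ) : ℂ :=
  if A + q ≤ k ∧ k < B + q then z (k - q) else 0

lemma sum_shifted_mul_conj (z : ℕ → ℂ) {A B Q q d : ℕ} (h : q + d < Q) :
    ∑ k ∈ Ico A (B + Q), shifted z A B q k * (starRingEnd ℂ) (shifted z A B (q + d) k) =
      ∑ n ∈ Ico A (B - d), z (n + d) * (starRingEnd ℂ) (z n) := by
  have h1 := sum_Ico_add' (fun k => z (k - q) * (starRingEnd ℂ) (z (k - (q + d)))) A (B - d) (q + d)
  have h2 : ∀ n, z (n + (q + d) - q) * (starRingEnd ℂ) (z (n + (q + d) - (q + d))) =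
      z (n + d) * (starRingEnd ℂ) (z n) := fun n => by
    rw [show n + (q + d) - q = n + d by omega, Nat.add_sub_cancel]
  simp only [h2] at h1
  rw [h1]
  symm
  calc _ = ∑ k ∈ Ico (A + (q + d)) (B - d + (q + d)),
        shifted z A B q k * (starRingEnd ℂ) (shifted z A B (q + d) k) := by
        refine sum_congr rfl fun k hk => ?_
        rw [mem_Ico] at hk
        rw [shifted, shifted, if_pos (by omega), if_pos (by omega)]
    _ = _ := by
        refine sum_subset (fun k hk => ?_) fun k hk hk' => ?_
        · rw [mem_Ico] at hk ⊢; omega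
        · rw [mem_Ico] at hk hk'
          by_cases h3 : A + (q + d) ≤ k ∧ k < B + (q + d)
          · rw [shifted, if_neg (by omega), zero_mul]
          · rw [shifted.eq_1 z A B (q + d), if_neg h3, map_zero, mul_zero]

lemma sum_shifted (z : ℕ → ℂ) {A B Q q : ℕ} (h : q < Q) :
    ∑ k ∈ Ico A (B + Q), shifted z A B q k = ∑ n ∈ Ico A B, z n := by
  have h1 := sum_Ico_add' (fun k => z (k - q)) A B q
  simp only [Nat.add_sub_cancel] at h1
  rw [h1]
  symm
  calc _ = ∑ k ∈ Ico (A + q) (B + q), shifted z A B q k := by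
        refine sum_congr rfl fun k hk => ?_
        rw [mem_Ico] at hk
        rw [shifted, if_pos hk]
    _ = _ := by
        refine sum_subset (fun k hk => ?_) fun k hk hk' => ?_
        · rw [mem_Ico] at hk ⊢; omega
        · rw [mem_Ico] at hk'
          rw [shifted, if_neg hk']

lemma sum_dist_le {E : ℕ → ℝ} {Q : ℕ} (hE : ∀ d < Q, 0 ≤ E d) {q : ℕ} (hq : q < Q) :
    ∑ r ∈ range Q, E (Nat.dist q r) ≤ 2 * ∑ d ∈ range Q, E d := by
  rw [← sum_filter_add_sum_filter_not (range Q) (fun r => r ≤ q), two_mul]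
  refine add_le_add ?_ ?_
  · rw [← sum_image (g := fun r => Nat.dist q r) (f := E)]
    · refine sum_le_sum_of_subset_of_nonneg (fun d hd => ?_) fun d hd _ => hE d (mem_range.1 hd)
      obtain ⟨r, hr, rfl⟩ := mem_image.1 hd
      simp only [mem_filter, mem_range, Nat.dist] at hr ⊢
      omega
    · intro r hr s hs hrs
      simp only [coe_filter, mem_range, Set.mem_ofPred_eq, Nat.dist] at hr hs hrs
      omega
  · rw [← sum_image (g := fun r => Nat.dist q r) (f := E)]
    · refine sum_le_sum_of_subset_of_nonneg (fun d hd => ?_) fun d hd _ => hE d (mem_range.1 hd)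
      obtain ⟨r, hr, rfl⟩ := mem_image.1 hd
      simp only [mem_filter, mem_range, Nat.dist] at hr ⊢
      omega
    · intro r hr s hs hrs
      simp only [coe_filter, mem_range, Set.mem_ofPred_eq, Nat.dist] at hr hs hrs
      omega

/-- A weighted form of the Weyl–van der Corput inequality. -/
lemma weighted_van_der_corput {ι : Type*} (S : Finset ι) {w : ι → ℝ} (hw : ∀ m ∈ S, 0 ≤ w m)
    (z : ι → ℕ → ℂ) {A B Q : ℕ} (hQ : 0 < Q) {E : ℕ → ℝ}
    (hE : ∀ d < Q, ‖∑ n ∈ Ico A (B - d), ∑ m ∈ S,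
      (w m : ℂ) * (z m (n + d) * (starRingEnd ℂ) (z m n))‖ ≤ E d) :
    Q * ∑ m ∈ S, w m * ‖∑ n ∈ Ico A B, z m n‖ ^ 2 ≤
      ((B - A : ℕ) + Q) * (2 * ∑ d ∈ range Q, E d) := by
  have hQ0 : (0:ℝ) < Q := by exact_mod_cast hQ
  have hE0 : ∀ d < Q, 0 ≤ E d := fun d hd => (norm_nonneg _).trans (hE d hd)
  set K := Ico A (B + Q) with hK
  have hKcard : (#K : ℝ) ≤ (B - A : ℕ) + Q := by
    rw [hK, Nat.card_Ico]
    norm_cast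
    omega
  have hCS : ∀ m, (Q : ℝ) ^ 2 * ‖∑ n ∈ Ico A B, z m n‖ ^ 2 ≤
      #K * ∑ k ∈ K, ‖∑ q ∈ range Q, shifted (z m) A B q k‖ ^ 2 := by
    intro m
    have e1 : (Q : ℂ) * ∑ n ∈ Ico A B, z m n = ∑ k ∈ K, ∑ q ∈ range Q, shifted (z m) A B q k := by
      rw [sum_comm, sum_congr rfl fun q hq => sum_shifted (z m) (mem_range.1 hq), sum_const,
        card_range, nsmul_eq_mul]
    have e2 : (Q : ℝ) * ‖∑ n ∈ Ico A B, z m n‖ ≤ ∑ k ∈ K, ‖∑ q ∈ range Q,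
      shifted (z m) A B q k‖ := by
      rw [← Complex.norm_natCast, ← norm_mul, e1]
      exact norm_sum_le _ _
    rw [← mul_pow]
    exact (pow_le_pow_left₀ (by positivity) e2 2).trans sq_sum_le_card_mul_sum_sq
  have hcorr : ∀ q < Q, ∀ r < Q, ‖∑ m ∈ S, (w m : ℂ) * ∑ k ∈ K,
      shifted (z m) A B q k * (starRingEnd ℂ) (shifted (z m) A B r k)‖ ≤ E (Nat.dist q r) := by
    have key : ∀ q d, q + d < Q → ‖∑ m ∈ S, (w m : ℂ) * ∑ k ∈ K,
        shifted (z m) A B q k * (starRingEnd ℂ) (shifted (z m) A B (q + d) k)‖ ≤ E d := by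
      intro q d hqd
      rw [sum_congr rfl fun m _ => by rw [sum_shifted_mul_conj (z m) hqd, mul_sum], sum_comm]
      exact hE d (by omega)
    intro q hq r hr
    rcases le_total q r with h | h
    · obtain ⟨d, rfl⟩ := Nat.exists_eq_add_of_le h
      rw [Nat.dist_eq_sub_of_le h, Nat.add_sub_cancel_left]
      exact key q d hr
    · obtain ⟨d, rfl⟩ := Nat.exists_eq_add_of_le h
      rw [Nat.dist_eq_sub_of_le_right h, Nat.add_sub_cancel_left]
      refine le_trans (le_of_eq ?_) (key r d hq)
      rw [← RCLike.norm_conj, map_sum]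
      congr 1
      refine sum_congr rfl fun m _ => ?_
      rw [map_mul, map_sum, Complex.conj_ofReal]
      congr 1
      refine sum_congr rfl fun k _ => ?_
      rw [map_mul, Complex.conj_conj, mul_comm]
  have htot : ∑ m ∈ S, w m * ∑ k ∈ K, ‖∑ q ∈ range Q, shifted (z m) A B q k‖ ^ 2 ≤
      Q * (2 * ∑ d ∈ range Q, E d) := by
    have e3 : ((∑ m ∈ S, w m * ∑ k ∈ K, ‖∑ q ∈ range Q, shifted (z m) A B q k‖ ^ 2 : ℝ) : ℂ) =
        ∑ p ∈ range Q ×ˢ range Q, ∑ m ∈ S, (w m : ℂ) * ∑ k ∈ K,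
          shifted (z m) A B p.1 k * (starRingEnd ℂ) (shifted (z m) A B p.2 k) := by
      rw [sum_comm, Complex.ofReal_sum]
      refine sum_congr rfl fun m _ => ?_
      rw [Complex.ofReal_mul, Complex.ofReal_sum, ← mul_sum, sum_comm]
      congr 1
      exact sum_congr rfl fun k _ => norm_sq_sum_eq _ _
    have hnn : 0 ≤ ∑ m ∈ S, w m * ∑ k ∈ K, ‖∑ q ∈ range Q, shifted (z m) A B q k‖ ^ 2 :=
      sum_nonneg fun m hm => mul_nonneg (hw m hm) (by positivity)
    rw [← Real.norm_of_nonneg hnn, ← Complex.norm_real, e3]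
    calc _ ≤ ∑ p ∈ range Q ×ˢ range Q, E (Nat.dist p.1 p.2) :=
          norm_sum_le_of_le _ fun p hp => by
            rw [mem_product, mem_range, mem_range] at hp
            exact hcorr _ hp.1 _ hp.2
      _ = ∑ q ∈ range Q, ∑ r ∈ range Q, E (Nat.dist q r) := sum_product _ _ _
      _ ≤ ∑ q ∈ range Q, 2 * ∑ d ∈ range Q, E d :=
          sum_le_sum fun q hq => sum_dist_le hE0 (mem_range.1 hq)
      _ = _ := by rw [sum_const, card_range, nsmul_eq_mul]
  have hfin : (Q : ℝ) * (Q * ∑ m ∈ S, w m * ‖∑ n ∈ Ico A B, z m n‖ ^ 2) ≤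
      Q * (((B - A : ℕ) + Q) * (2 * ∑ d ∈ range Q, E d)) := by
    calc (Q : ℝ) * (Q * ∑ m ∈ S, w m * ‖∑ n ∈ Ico A B, z m n‖ ^ 2)
        = ∑ m ∈ S, w m * ((Q : ℝ) ^ 2 * ‖∑ n ∈ Ico A B, z m n‖ ^ 2) := by
          rw [mul_sum, mul_sum]
          exact sum_congr rfl fun m _ => by ring
      _ ≤ ∑ m ∈ S, w m * (#K * ∑ k ∈ K, ‖∑ q ∈ range Q, shifted (z m) A B q k‖ ^ 2) :=
          sum_le_sum fun m hm => mul_le_mul_of_nonneg_left (hCS m) (hw m hm)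
      _ = #K * ∑ m ∈ S, w m * ∑ k ∈ K, ‖∑ q ∈ range Q, shifted (z m) A B q k‖ ^ 2 := by
          rw [mul_sum]
          exact sum_congr rfl fun m _ => by ring
      _ ≤ ((B - A : ℕ) + Q) * (Q * (2 * ∑ d ∈ range Q, E d)) := by
          refine mul_le_mul hKcard htot ?_ (by positivity)
          exact sum_nonneg fun m hm => mul_nonneg (hw m hm) (by positivity)
      _ = _ := by ring
  exact le_of_mul_le_mul_left hfin hQ0

lemma card_range_ceil_two_mul_le {M : ℝ} (hM : 1 ≤ M) : (#(range ⌈2 * M⌉₊) : ℝ) ≤ 3 * M := by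
  rw [card_range]
  have := Nat.ceil_lt_add_one (by linarith : 0 ≤ 2 * M)
  linarith

lemma norm_sum_range_bump_mul_e_le {M : ℝ} (hM : 1 ≤ M) (x : ℕ → ℝ) :
    ‖∑ m ∈ range ⌈2 * M⌉₊, (bump (m / M) : ℂ) * e (x m)‖ ≤ 24 * M := by
  calc _ ≤ ∑ m ∈ range ⌈2 * M⌉₊, (8 : ℝ) := by
        refine norm_sum_le_of_le _ fun m _ => ?_
        rw [norm_mul, norm_e, mul_one, Complex.norm_real]
        exact bump_le _
    _ = #(range ⌈2 * M⌉₊) * 8 := by rw [sum_const, nsmul_eq_mul]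
    _ ≤ 3 * M * 8 := by gcongr; exact card_range_ceil_two_mul_le hM
    _ = _ := by ring

lemma exists_norm_sum_bump_mul_e_le_of_pos {γ : ℝ} (h0 : 0 < γ) (h1 : γ < 1) : ∃ C, 0 < C ∧
    ∀ (i j : ℕ) (q N H M β F : ℝ), 0 < q → 1 ≤ N → 1 ≤ M → 0 < H →
      F = H * M ^ γ * (q * N ^ (γ - 1)) →
      (∀ n ∈ Ico i j, N / 2 ≤ (n : ℝ) ∧ (n : ℝ) < N ∧ 1 ≤ (n : ℝ) ∧ q ≤ n) →
      ‖∑ n ∈ Ico i j, ∑ m ∈ range ⌈2 * M⌉₊,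
        (bump (m / M) : ℂ) * e (β * m + H * rpowDiff q γ n * (m : ℝ) ^ γ)‖ ≤
        C * (F + N + M + M * N / F) := by
  obtain ⟨C, hC, HC⟩ := exists_norm_sum_bump_mul_e_le h0 h1
  refine ⟨C + 48, by positivity, fun i j q N H M β F hq hN hM hH hF hn => ?_⟩
  have hF0 : 0 < F := by rw [hF]; positivity
  have hpos : 0 ≤ F + N + M + M * N / F := by positivity
  by_cases hF1 : 1 ≤ F
  · refine (HC i j q N H M β F hq hN hM hH hF hF1 hn).trans ?_
    gcongr
    linarith
  · have hMN : M * N ≤ M * N / F := by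
      rw [le_div_iff₀ hF0]
      exact mul_le_of_le_one_right (by positivity) (not_le.1 hF1).le
    calc _ ≤ ∑ n ∈ Ico i j, 24 * M :=
          norm_sum_le_of_le _ fun n _ => norm_sum_range_bump_mul_e_le hM _
      _ = #(Ico i j) * (24 * M) := by rw [sum_const, nsmul_eq_mul]
      _ ≤ 2 * N * (24 * M) := by
          gcongr
          rw [Nat.card_Ico]
          exact card_Ico_le_of_dyadic hN fun n h => ⟨(hn n h).1, (hn n h).2.1⟩
      _ = 48 * (M * N) := by ring
      _ ≤ 48 * (F + N + M + M * N / F) := by gcongr; linarith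
      _ ≤ _ := by gcongr; linarith

/-- The weighted mean square over `m` of a twisted sum over a dyadic range of `n`. -/
lemma exists_sum_bump_mul_norm_sq_le {γ : ℝ} (h0 : 0 < γ) (h1 : γ < 1) : ∃ C, 0 < C ∧
    ∀ (A B Q : ℕ) (N M h β κ : ℝ), 1 ≤ N → 1 ≤ M → 0 < h → 0 < Q → (Q : ℝ) ≤ N →
      (∀ n ∈ Ico A B, N / 2 ≤ (n : ℝ) ∧ (n : ℝ) < N) →
      ∑ m ∈ range ⌈2 * M⌉₊, bump (m / M) *
        ‖∑ n ∈ Ico A B, e (β * m * n + h * ((m : ℝ) * n) ^ γ + κ * n)‖ ^ 2 ≤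
        C * (M * N ^ 2 / Q + Q * (h * (M * N) ^ γ) + N ^ 2 + M * N +
          M * N ^ 3 / (h * (M * N) ^ γ)) := by
  obtain ⟨C, hC, HC⟩ := exists_norm_sum_bump_mul_e_le_of_pos h0 h1
  refine ⟨288 + 6 * C, by positivity, fun A B Q N M h β κ hN hM hh hQ hQN hn => ?_⟩
  have hQ0 : (0:ℝ) < Q := by exact_mod_cast hQ
  have hN0 : 0 < N := by linarith
  have hM0 : 0 < M := by linarith
  set F : ℝ := h * M ^ γ * N ^ (γ - 1) with hF
  have hF0 : 0 < F := by positivity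
  have hFN : h * (M * N) ^ γ = F * N := by
    rw [hF, Real.mul_rpow hM0.le hN0.le, Real.rpow_sub_one hN0.ne']
    field_simp
  set D : ℝ := C * (F * Q + N + M + M * N / F) with hD
  have hD0 : 0 ≤ D := by positivity
  have hcardN : ((B - A : ℕ) : ℝ) ≤ 2 * N := card_Ico_le_of_dyadic hN hn
  set z : ℕ → ℕ → ℂ := fun m n => e (β * m * n + h * ((m : ℝ) * n) ^ γ + κ * n) with hz
  have hcorr : ∀ m n d : ℕ, z m (n + d) * (starRingEnd ℂ) (z m n) =
      e (κ * d) * e (β * d * m + h * rpowDiff d γ n * (m : ℝ) ^ γ) := by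
    intro m n d
    simp only [hz]
    rw [conj_e, ← e_add, ← e_add, rpowDiff, Real.mul_rpow (by positivity) (by positivity),
      Real.mul_rpow (by positivity) (by positivity)]
    congr 1
    push_cast
    ring
  have hE : ∀ d < Q, ‖∑ n ∈ Ico A (B - d), ∑ m ∈ range ⌈2 * M⌉₊,
      ((bump (m / M) : ℝ) : ℂ) * (z m (n + d) * (starRingEnd ℂ) (z m n))‖ ≤
      (if d = 0 then 48 * (M * N) else 0) + D := by
    intro d hd
    have e1 : ∑ n ∈ Ico A (B - d), ∑ m ∈ range ⌈2 * M⌉₊,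
        ((bump (m / M) : ℝ) : ℂ) * (z m (n + d) * (starRingEnd ℂ) (z m n)) =
        e (κ * d) * ∑ n ∈ Ico A (B - d), ∑ m ∈ range ⌈2 * M⌉₊,
          (bump (m / M) : ℂ) * e (β * d * m + h * rpowDiff d γ n * (m : ℝ) ^ γ) := by
      rw [mul_sum]
      refine sum_congr rfl fun n _ => ?_
      rw [mul_sum]
      refine sum_congr rfl fun m _ => ?_
      rw [hcorr]
      ring
    rw [e1, norm_mul, norm_e, one_mul]
    rcases Nat.eq_zero_or_pos d with rfl | hd0
    · rw [if_pos rfl]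
      refine le_trans ?_ (le_add_of_nonneg_right hD0)
      calc _ ≤ ∑ n ∈ Ico A (B - 0), 24 * M :=
            norm_sum_le_of_le _ fun n _ => norm_sum_range_bump_mul_e_le hM _
        _ = ((B - A : ℕ) : ℝ) * (24 * M) := by rw [sum_const, nsmul_eq_mul, Nat.card_Ico,
            Nat.sub_zero]
        _ ≤ 2 * N * (24 * M) := by gcongr
        _ = _ := by ring
    · rw [if_neg hd0.ne', zero_add]
      have hd1 : (1:ℝ) ≤ d := by exact_mod_cast hd0
      have hdQ : (d : ℝ) ≤ Q := by exact_mod_cast hd.le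
      refine (HC A (B - d) d N h M (β * d) (F * d) (by linarith) hN hM hh (by rw [hF]; ring)
        fun n hnm => ?_).trans ?_
      · rw [mem_Ico] at hnm
        have g1 := hn n (mem_Ico.2 (by omega))
        have g2 := hn (n + d) (mem_Ico.2 (by omega))
        push_cast at g2
        refine ⟨g1.1, g1.2, ?_, by linarith⟩
        have : (0:ℝ) < n := by linarith
        exact_mod_cast (by exact_mod_cast this : 0 < n)
      · rw [hD]
        have : F ≤ F * d := le_mul_of_one_le_right hF0.le hd1
        gcongr
  have hvdc := weighted_van_der_corput (range ⌈2 * M⌉₊) (fun m _ => bump_nonneg (m / M)) z hQ hE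
  rw [sum_add_distrib, sum_ite_eq' (range Q) 0, if_pos (mem_range.2 hQ), sum_const, card_range,
    nsmul_eq_mul] at hvdc
  have hfin : (Q : ℝ) * ∑ m ∈ range ⌈2 * M⌉₊, bump (m / M) * ‖∑ n ∈ Ico A B, z m n‖ ^ 2 ≤
      Q * ((288 + 6 * C) * (M * N ^ 2 / Q + Q * (h * (M * N) ^ γ) + N ^ 2 + M * N +
          M * N ^ 3 / (h * (M * N) ^ γ))) := by
    refine hvdc.trans ?_
    calc (((B - A : ℕ) : ℝ) + Q) * (2 * (48 * (M * N) + Q * D))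
        ≤ (2 * N + N) * (2 * (48 * (M * N) + Q * D)) := by gcongr
      _ = Q * (288 * (M * N ^ 2 / Q) +
          6 * C * (Q * (F * N) + N ^ 2 + M * N + M * N ^ 3 / (F * N))) := by
          rw [hD]; field_simp; ring
      _ ≤ Q * (288 * (M * N ^ 2 / Q + Q * (F * N) + N ^ 2 + M * N + M * N ^ 3 / (F * N)) +
          6 * C * (M * N ^ 2 / Q + Q * (F * N) + N ^ 2 + M * N + M * N ^ 3 / (F * N))) := by
          have : 0 ≤ Q * (F * N) + N ^ 2 + M * N + M * N ^ 3 / (F * N) := by positivity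
          have : 0 ≤ M * N ^ 2 / Q := by positivity
          gcongr <;> linarith
      _ = _ := by rw [hFN]; ring
  exact le_of_mul_le_mul_left hfin hQ0

lemma e_natCast_mul (r : ℕ) (x : ℝ) : e (r * x) = e x ^ r := by
  rw [e, e, ← Complex.exp_nat_mul]
  congr 1
  push_cast
  ring

lemma e_ne_one {x : ℝ} (h1 : -1 < x) (h2 : x < 1) (h0 : x ≠ 0) : e x ≠ 1 := by
  intro h
  rw [e, Complex.exp_eq_one_iff] at h
  obtain ⟨n, hn⟩ := h
  have hne : (2 * Real.pi * Complex.I : ℂ) ≠ 0 := Complex.two_pi_I_ne_zero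
  have h3 : (x : ℂ) = n := by
    rw [mul_comm (n : ℂ)] at hn
    exact mul_left_cancel₀ hne hn
  have h4 : x = n := by exact_mod_cast h3
  rw [h4] at h1 h2 h0
  have h5 : -1 < n := by exact_mod_cast h1
  have h6 : n < 1 := by exact_mod_cast h2
  exact h0 (by exact_mod_cast (by omega : n = 0))

lemma sum_range_e_div {L : ℕ} (n k : ℕ) (h1 : n < k + L) (h2 : k < n + L) :
    ∑ r ∈ range L, e (r / L * n) * e (-(r / L * k)) = if n = k then (L : ℂ) else 0 := by
  have hL0 : (0:ℝ) < L := by exact_mod_cast (by omega : 0 < L)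
  have h3 : ∀ r : ℕ, e (r / L * n) * e (-(r / L * k)) = e (((n : ℝ) - k) / L) ^ r := fun r => by
    rw [← e_add, ← e_natCast_mul]
    congr 1
    ring
  simp_rw [h3]
  split_ifs with h
  · simp [h, e]
  · have hx : e (((n : ℝ) - k) / L) ≠ 1 := by
      have g1 : (n : ℝ) < k + L := by exact_mod_cast h1
      have g2 : (k : ℝ) < n + L := by exact_mod_cast h2
      refine e_ne_one ?_ ?_ ?_
      · rw [lt_div_iff₀ hL0]; linarith
      · rw [div_lt_iff₀ hL0]; linarith
      · exact div_ne_zero (sub_ne_zero.2 (by exact_mod_cast h)) hL0.ne'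
    rw [geom_sum_eq hx, ← e_natCast_mul, mul_div_cancel₀ _ hL0.ne']
    have : e ((n : ℝ) - k) = 1 := by
      have := e_intCast ((n : ℤ) - k)
      push_cast at this
      exact this
    rw [this, sub_self, zero_div]

/-- Weights for completing an incomplete sum. -/
noncomputable def completionWeight (L r : ℕ) : ℝ :=
  if r = 0 then 1 else 2 * (1 / (r : ℝ) + 1 / ((L - r : ℕ) : ℝ))

lemma completionWeight_nonneg (L r : ℕ) : 0 ≤ completionWeight L r := by
  unfold completionWeight; split_ifs <;> positivity

lemma norm_sum_e_div_le {L a b r : ℕ} (hab : b ≤ a + L) (hr : r < L) :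
    ‖∑ k ∈ Ico a b, e (-(r / L * k))‖ ≤ L * completionWeight L r := by
  have hL0 : (0:ℝ) < L := by exact_mod_cast (by omega : 0 < L)
  unfold completionWeight
  split_ifs with h
  · refine (norm_sum_le _ _).trans ?_
    simp only [norm_e, sum_const, Nat.card_Ico, nsmul_eq_mul, mul_one]
    exact_mod_cast (by omega)
  · have hr0 : 0 < r := Nat.pos_of_ne_zero h
    have hr0' : (0:ℝ) < r := by exact_mod_cast hr0
    have hLr : (0:ℝ) < (L - r : ℕ) := by exact_mod_cast (by omega : 0 < L - r)
    have hcast : ((L - r : ℕ) : ℝ) = L - r := Nat.cast_sub hr.le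
    set ρ : ℝ := min (r / L) ((L - r : ℕ) / L) with hρ
    have hρ0 : 0 < ρ := lt_min (by positivity) (by positivity)
    have hd : ∀ n : ℕ, -((r : ℝ) / L * ((n + 1 : ℕ) : ℝ)) - -((r : ℝ) / L * n) = -(r / L) := by
      intro n; push_cast; ring
    have e1 : ((L - r : ℕ) : ℝ) / L = 1 - r / L := by rw [hcast]; field_simp
    have hKL := kusmin_landau (f := fun k : ℕ => -((r : ℝ) / L * k)) (a := a) (b := b) (-1) hρ0
      (fun n _ _ => by
        have h1 := hd n
        have h2 := hd (n + 1)
        simp only [add_assoc, Nat.reduceAdd] at h1 h2 ⊢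
        rw [h1, h2]) (fun n _ => by
        simp only [hd]
        have := min_le_right (r / L : ℝ) ((L - r : ℕ) / L)
        rw [← hρ, e1] at this
        push_cast
        linarith) (fun n _ => by
        simp only [hd]
        have := min_le_left (r / L : ℝ) ((L - r : ℕ) / L)
        rw [← hρ] at this
        push_cast
        linarith)
    refine hKL.trans ?_
    rcases min_choice (r / L : ℝ) ((L - r : ℕ) / L) with h' | h'
    · rw [hρ, h', div_div_eq_mul_div, mul_add, mul_add, mul_one_div, mul_div_assoc']
      rw [mul_comm]
      exact le_add_of_nonneg_right (by positivity)
    · rw [hρ, h', div_div_eq_mul_div, mul_add, mul_add, mul_one_div, mul_one_div, mul_div_assoc',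
        mul_div_assoc', mul_comm]
      exact le_add_of_nonneg_left (by positivity)

lemma norm_sum_Ico_le_completion {A B a b : ℕ} (hA : A ≤ a) (hB : b ≤ B) (z : ℕ → ℂ) :
    ‖∑ n ∈ Ico a b, z n‖ ≤ ∑ r ∈ range (B - A),
      completionWeight (B - A) r * ‖∑ n ∈ Ico A B, z n * e (r / (B - A : ℕ) * n)‖ := by
  rcases le_or_gt b a with hab | hab
  · rw [Ico_eq_empty_of_le hab, sum_empty, norm_zero]
    exact sum_nonneg fun r _ => mul_nonneg (completionWeight_nonneg _ _) (norm_nonneg _)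
  set L : ℕ := B - A with hL
  have hL0 : (0:ℝ) < L := by exact_mod_cast (by omega : 0 < L)
  have h1 : (L : ℂ) * ∑ n ∈ Ico a b, z n = ∑ r ∈ range L, (∑ k ∈ Ico a b, e (-(r / L * k))) *
      ∑ n ∈ Ico A B, z n * e (r / L * n) := by
    have h2 : ∀ n ∈ Ico A B, ∑ k ∈ Ico a b, ∑ r ∈ range L, e (r / L * n) * e (-(r / L * k)) =
        if n ∈ Ico a b then (L : ℂ) else 0 := by
      intro n hn
      rw [mem_Ico] at hn
      rw [sum_congr rfl fun k hk => sum_range_e_div n k (by rw [mem_Ico] at hk; omega)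
        (by rw [mem_Ico] at hk; omega), sum_ite_eq]
    calc (L : ℂ) * ∑ n ∈ Ico a b, z n = ∑ n ∈ Ico a b, z n * L := by rw [mul_comm, sum_mul]
      _ = ∑ n ∈ Ico A B, z n * if n ∈ Ico a b then (L : ℂ) else 0 := by
          rw [← sum_subset (Ico_subset_Ico hA hB) fun n _ hn => by rw [if_neg hn, mul_zero]]
          exact sum_congr rfl fun n hn => by rw [if_pos hn]
      _ = ∑ n ∈ Ico A B, z n * ∑ r ∈ range L, ∑ k ∈ Ico a b, e (r / L * n) * e (-(r / L * k)) := by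
          refine sum_congr rfl fun n hn => ?_
          rw [sum_comm, h2 n hn]
      _ = _ := by
          simp_rw [mul_sum]
          rw [sum_comm]
          refine sum_congr rfl fun r _ => ?_
          refine sum_congr rfl fun n _ => ?_
          rw [sum_mul]
          exact sum_congr rfl fun k _ => by ring
  have h3 : (L : ℝ) * ‖∑ n ∈ Ico a b, z n‖ ≤ L * ∑ r ∈ range L,
      completionWeight L r * ‖∑ n ∈ Ico A B, z n * e (r / L * n)‖ := by
    rw [← Complex.norm_natCast, ← norm_mul, h1, Complex.norm_natCast, mul_sum]
    refine norm_sum_le_of_le _ fun r hr => ?_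
    rw [norm_mul, ← mul_assoc]
    gcongr
    exact norm_sum_e_div_le (by omega) (mem_range.1 hr)
  exact le_of_mul_le_mul_left h3 hL0

lemma sum_completionWeight_le {L : ℕ} {N : ℝ} (hN : 1 ≤ N) (hL : (L : ℝ) ≤ 2 * N) :
    ∑ r ∈ range L, completionWeight L r ≤ 9 * (1 + Real.log N) := by
  have hlogN := Real.log_nonneg hN
  rcases Nat.eq_zero_or_pos L with rfl | hL0
  · simp only [range_zero, sum_empty]; positivity
  have hL1 : (1:ℝ) ≤ L := by exact_mod_cast hL0
  obtain ⟨K, rfl⟩ : ∃ K, L = K + 1 := ⟨L - 1, by omega⟩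
  have hK : ∑ r ∈ range K, 1 / ((r + 1 : ℕ) : ℝ) ≤ 1 + Real.log ((K + 1 : ℕ) : ℝ) := by
    refine le_trans ?_ (sum_one_div_le_one_add_log hL1)
    rw [Nat.floor_natCast, ← sum_image (f := fun n : ℕ => 1 / (n : ℝ)) (g := fun r => r + 1)
      (fun x _ y _ h => by simpa using h)]
    refine sum_le_sum_of_subset_of_nonneg (fun x hx => ?_) fun _ _ _ => by positivity
    simp only [mem_image, mem_range, mem_Icc] at hx ⊢
    omega
  have h1 : ∀ r ∈ range K, completionWeight (K + 1) (r + 1) =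
      2 * (1 / ((r + 1 : ℕ) : ℝ)) + 2 * (1 / ((K - 1 - r + 1 : ℕ) : ℝ)) := by
    intro r hr
    rw [mem_range] at hr
    rw [completionWeight, if_neg (by omega), mul_add,
      show K + 1 - (r + 1) = K - 1 - r + 1 by omega]
  have hlog : Real.log ((K + 1 : ℕ) : ℝ) ≤ 1 + Real.log N := by
    refine (Real.log_le_log (by positivity) hL).trans ?_
    rw [Real.log_mul (by norm_num) (by positivity)]
    linarith [Real.log_two_lt_d9]
  rw [sum_range_succ', sum_congr rfl h1, sum_add_distrib, ← mul_sum, ← mul_sum,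
    sum_range_reflect (fun r => 1 / ((r + 1 : ℕ) : ℝ)) K, completionWeight, if_pos rfl]
  linarith

lemma norm_sum_subset_le_completion {A B a b : ℕ} (h : Ico a b ⊆ Ico A B) (z : ℕ → ℂ) :
    ‖∑ n ∈ Ico a b, z n‖ ≤ ∑ r ∈ range (B - A),
      completionWeight (B - A) r * ‖∑ n ∈ Ico A B, z n * e (r / (B - A : ℕ) * n)‖ := by
  rcases le_or_gt b a with hab | hab
  · rw [Ico_eq_empty_of_le hab, sum_empty, norm_zero]
    exact sum_nonneg fun r _ => mul_nonneg (completionWeight_nonneg _ _) (norm_nonneg _)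
  · rw [Ico_subset_Ico_iff hab] at h
    exact norm_sum_Ico_le_completion h.1 h.2 z

/-- Mean square over `m` of the inner sums, the interval of summation depending on `m`. -/
lemma exists_sum_norm_sq_dyN_filter_le {γ : ℝ} (h0 : 0 < γ) (h1 : γ < 1) : ∃ C, 0 < C ∧
    ∀ (X M N h β : ℝ) (Q : ℕ), 1 ≤ M → 1 ≤ N → 0 < h → 0 < Q → (Q : ℝ) ≤ N →
      ∑ m ∈ dyN M, ‖∑ n ∈ (dyN N).filter
          (fun n => X / 2 ≤ ((m * n : ℕ) : ℝ) ∧ ((m * n : ℕ) : ℝ) < X),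
          e (β * m * n + h * ((m : ℝ) * n) ^ γ)‖ ^ 2 ≤
        C * (1 + Real.log N) ^ 2 * (M * N ^ 2 / Q + Q * (h * (M * N) ^ γ) + N ^ 2 + M * N +
          M * N ^ 3 / (h * (M * N) ^ γ)) := by
  obtain ⟨C, hC, HC⟩ := exists_sum_bump_mul_norm_sq_le h0 h1
  refine ⟨81 * C, by positivity, fun X M N h β Q hM hN hh hQ hQN => ?_⟩
  set W : ℝ := M * N ^ 2 / Q + Q * (h * (M * N) ^ γ) + N ^ 2 + M * N +
          M * N ^ 3 / (h * (M * N) ^ γ) with hW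
  have hM0 : 0 < M := by linarith
  have hN0 : 0 < N := by linarith
  have hlogN := Real.log_nonneg hN
  have hW0 : 0 ≤ W := by positivity
  obtain ⟨A, B, hAB⟩ := exists_dyN_filter_eq_Ico N (fun _ => True) fun _ _ _ _ _ _ _ => trivial
  rw [filter_true] at hAB
  have hmem : ∀ n ∈ Ico A B, N / 2 ≤ (n : ℝ) ∧ (n : ℝ) < N := fun n hn =>
    mem_dyN.1 (hAB ▸ hn)
  set L : ℕ := B - A with hL
  have hL2 : (L : ℝ) ≤ 2 * N := card_Ico_le_of_dyadic hN hmem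
  set S : ℝ := ∑ r ∈ range L, completionWeight L r with hS
  have hS1 : S ≤ 9 * (1 + Real.log N) := sum_completionWeight_le hN hL2
  have hS0 : 0 ≤ S := sum_nonneg fun r _ => completionWeight_nonneg _ _
  set T : ℕ → ℕ → ℝ := fun r m =>
    ‖∑ n ∈ Ico A B, e (β * m * n + h * ((m : ℝ) * n) ^ γ + (r / L : ℝ) * n)‖ with hT
  have hinner : ∀ m ∈ dyN M, ‖∑ n ∈ (dyN N).filter
      (fun n => X / 2 ≤ ((m * n : ℕ) : ℝ) ∧ ((m * n : ℕ) : ℝ) < X),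
      e (β * m * n + h * ((m : ℝ) * n) ^ γ)‖ ^ 2 ≤
      S * ∑ r ∈ range L, completionWeight L r * T r m ^ 2 := by
    intro m hm
    obtain ⟨a, b, hab⟩ := exists_dyN_filter_eq_Ico N
      (fun n => X / 2 ≤ ((m * n : ℕ) : ℝ) ∧ ((m * n : ℕ) : ℝ) < X) fun i j k hij hjk hi hk =>
        ⟨hi.1.trans (by exact_mod_cast Nat.mul_le_mul_left m hij),
          lt_of_le_of_lt (by exact_mod_cast Nat.mul_le_mul_left m hjk) hk.2⟩
    have hsub : Ico a b ⊆ Ico A B := by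
      rw [← hab, ← hAB]; exact filter_subset _ _
    rw [hab]
    have h2 := norm_sum_subset_le_completion hsub fun n => e (β * m * n + h * ((m : ℝ) * n) ^ γ)
    simp only [← e_add] at h2
    refine (pow_le_pow_left₀ (norm_nonneg _) h2 2).trans ?_
    refine sum_sq_le_sum_mul_sum_of_sq_le_mul _ (fun r _ => completionWeight_nonneg _ _)
      (fun r _ => mul_nonneg (completionWeight_nonneg _ _) (sq_nonneg _)) fun r _ => le_of_eq ?_
    simp only [hT]
    ring
  have hsubM : dyN M ⊆ range ⌈2 * M⌉₊ := fun m hm => by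
    rw [mem_range, Nat.lt_ceil]
    linarith [(mem_dyN.1 hm).2]
  have hmean : ∀ r, ∑ m ∈ dyN M, T r m ^ 2 ≤ C * W := by
    intro r
    calc ∑ m ∈ dyN M, T r m ^ 2 ≤ ∑ m ∈ dyN M, bump (m / M) * T r m ^ 2 := by
          refine sum_le_sum fun m hm => ?_
          rw [mem_dyN] at hm
          refine le_mul_of_one_le_left (sq_nonneg _) (one_le_bump ?_ ?_)
          · rw [le_div_iff₀ hM0]; linarith
          · rw [div_le_one hM0]; exact hm.2.le
      _ ≤ ∑ m ∈ range ⌈2 * M⌉₊, bump (m / M) * T r m ^ 2 :=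
          sum_le_sum_of_subset_of_nonneg hsubM fun m _ _ =>
            mul_nonneg (bump_nonneg _) (sq_nonneg _)
      _ ≤ C * W := HC A B Q N M h β (r / L) hN hM hh hQ hQN hmem
  calc _ ≤ ∑ m ∈ dyN M, S * ∑ r ∈ range L, completionWeight L r * T r m ^ 2 := sum_le_sum hinner
    _ = S * ∑ r ∈ range L, completionWeight L r * ∑ m ∈ dyN M, T r m ^ 2 := by
        rw [← mul_sum, sum_comm]
        simp_rw [mul_sum]
    _ ≤ S * ∑ r ∈ range L, completionWeight L r * (C * W) := by
        gcongr with r _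
        · exact completionWeight_nonneg _ _
        · exact hmean r
    _ = S ^ 2 * (C * W) := by rw [← sum_mul, ← hS]; ring
    _ ≤ (9 * (1 + Real.log N)) ^ 2 * (C * W) := by gcongr
    _ = _ := by ring

lemma exists_norm_triSum_sq_le_of_completion {γ : ℝ} (h0 : 0 < γ) (h1 : γ < 1) : ∃ C, 0 < C ∧
    ∀ (X M N V β : ℝ) (Q : ℕ) (a d : ℕ → ℂ), 1 ≤ M → 1 ≤ N → 1 ≤ V → 0 < Q → (Q : ℝ) ≤ N →
      (∀ m ∈ dyN M, ‖a m‖ ≤ 1) → (∀ h ∈ dyN V, ‖d h‖ ≤ 1) →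
      ‖triSum γ X M N V β a d‖ ^ 2 ≤ C * (1 + Real.log N) ^ 2 * (V ^ 2 * M *
        (M * N ^ 2 / Q + Q * (V * (M * N) ^ γ) + N ^ 2 + M * N +
          M * N ^ 3 / (V * (M * N) ^ γ))) := by
  obtain ⟨C, hC, HC⟩ := exists_sum_norm_sq_dyN_filter_le h0 h1
  refine ⟨16 * C, by positivity, fun X M N V β Q a d hM hN hV hQ hQN ha hd => ?_⟩
  have hM0 : 0 < M := by linarith
  have hN0 : 0 < N := by linarith
  have hV0 : 0 < V := by linarith
  have hlogN := Real.log_nonneg hN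
  set G : ℝ := (M * N) ^ γ with hG
  have hG0 : 0 < G := by positivity
  set W : ℝ := M * N ^ 2 / Q + Q * (V * G) + N ^ 2 + M * N + M * N ^ 3 / (V * G) with hW
  have hW0 : 0 ≤ W := by positivity
  set I : ℕ → ℕ → ℂ := fun h m => ∑ n ∈ (dyN N).filter
      (fun n => X / 2 ≤ ((m * n : ℕ) : ℝ) ∧ ((m * n : ℕ) : ℝ) < X),
      e (β * m * n + h * ((m : ℝ) * n) ^ γ) with hI
  have e1 : triSum γ X M N V β a d = ∑ h ∈ dyN V, d h * ∑ m ∈ dyN M, a m * I h m := by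
    rw [triSum]
    simp only [hI, mul_sum]
    rw [sum_congr rfl fun m _ => sum_comm, sum_comm]
    refine sum_congr rfl fun h _ => sum_congr rfl fun m _ => sum_congr rfl fun n _ => ?_
    ring
  have hI2 : ∀ h ∈ dyN V, ∑ m ∈ dyN M, ‖I h m‖ ^ 2 ≤ C * (1 + Real.log N) ^ 2 * (2 * W) := by
    intro h hh
    have hpos : (0:ℝ) < h := dyN_pos hV hh
    rw [mem_dyN] at hh
    refine (HC X M N h β Q hM hN hpos hQ hQN).trans ?_
    gcongr
    have e2 : Q * (h * G) ≤ Q * (V * G) := by gcongr; exact hh.2.le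
    have e3 : M * N ^ 3 / (h * G) ≤ 2 * (M * N ^ 3 / (V * G)) := by
      rw [← mul_div_assoc, div_le_div_iff₀ (by positivity) (by positivity)]
      have : V * G ≤ 2 * (h * G) := by nlinarith [hh.1]
      nlinarith [mul_le_mul_of_nonneg_left this (by positivity : 0 ≤ M * N ^ 3)]
    have : 0 ≤ M * N ^ 2 / Q := by positivity
    have : 0 ≤ Q * (V * G) := by positivity
    rw [hW]
    nlinarith [sq_nonneg N, mul_pos hM0 hN0]
  have h2 : ∀ h ∈ dyN V, ‖∑ m ∈ dyN M, a m * I h m‖ ^ 2 ≤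
      2 * M * (C * (1 + Real.log N) ^ 2 * (2 * W)) := by
    intro h hh
    have : ‖∑ m ∈ dyN M, a m * I h m‖ ≤ ∑ m ∈ dyN M, ‖I h m‖ :=
      norm_sum_le_of_le _ fun m hm => by
        rw [norm_mul]; exact mul_le_of_le_one_left (norm_nonneg _) (ha m hm)
    calc _ ≤ (∑ m ∈ dyN M, ‖I h m‖) ^ 2 := pow_le_pow_left₀ (norm_nonneg _) this 2
      _ ≤ #(dyN M) * ∑ m ∈ dyN M, ‖I h m‖ ^ 2 := sq_sum_le_card_mul_sum_sq
      _ ≤ _ := mul_le_mul (card_dyN_le hM) (hI2 h hh) (by positivity) (by positivity)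
  have h3 : ‖triSum γ X M N V β a d‖ ≤ ∑ h ∈ dyN V, ‖∑ m ∈ dyN M, a m * I h m‖ := by
    rw [e1]
    exact norm_sum_le_of_le _ fun h hh => by
        rw [norm_mul]; exact mul_le_of_le_one_left (norm_nonneg _) (hd h hh)
  calc _ ≤ (∑ h ∈ dyN V, ‖∑ m ∈ dyN M, a m * I h m‖) ^ 2 := pow_le_pow_left₀ (norm_nonneg _) h3 2
    _ ≤ #(dyN V) * ∑ h ∈ dyN V, ‖∑ m ∈ dyN M, a m * I h m‖ ^ 2 := sq_sum_le_card_mul_sum_sq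
    _ ≤ #(dyN V) * (#(dyN V) * (2 * M * (C * (1 + Real.log N) ^ 2 * (2 * W)))) := by
        gcongr
        exact (sum_le_card_nsmul _ _ _ h2).trans_eq (nsmul_eq_mul _ _)
    _ ≤ 2 * V * (2 * V * (2 * M * (C * (1 + Real.log N) ^ 2 * (2 * W)))) := by
        have := card_dyN_le hV
        gcongr
    _ = _ := by ring

lemma sum_dyZ_eq {V : ℝ} (hV : 1 ≤ V) (f : ℤ → ℂ) :
    ∑ h ∈ dyZ V, f h = ∑ h ∈ dyN V, f h + ∑ h ∈ dyN V, f (-(h : ℤ)) := by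
  have hne : ∀ h ∈ dyN V, h ≠ 0 := fun h hh h0 => by
    have := dyN_pos hV hh
    simp [h0] at this
  rw [← sum_filter_add_sum_filter_not (dyZ V) (fun h => 0 < h)]
  congr 1
  · refine sum_nbij' Int.toNat Nat.cast ?_ ?_ ?_ ?_ ?_
    · intro h hh
      rw [mem_filter, mem_dyZ] at hh
      obtain ⟨⟨_, h2, h3⟩, h4⟩ := hh
      have h5 : ((h.toNat : ℕ) : ℝ) = |(h : ℝ)| := by
        rw [abs_of_pos (by exact_mod_cast h4)]
        exact_mod_cast Int.toNat_of_nonneg h4.le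
      rw [mem_dyN, h5]
      exact ⟨h2, h3⟩
    · intro h hh
      have := hne h hh
      rw [mem_dyN] at hh
      rw [mem_filter, mem_dyZ]
      simp only [Int.cast_natCast, Nat.abs_cast]
      exact ⟨⟨by exact_mod_cast this, hh⟩, by exact_mod_cast Nat.pos_of_ne_zero this⟩
    · intro h hh
      exact Int.toNat_of_nonneg (mem_filter.1 hh).2.le
    · intro h _
      exact Int.toNat_natCast h
    · intro h hh
      rw [Int.toNat_of_nonneg (mem_filter.1 hh).2.le]
  · refine sum_nbij' (fun h => (-h).toNat) (fun h => -(h : ℤ)) ?_ ?_ ?_ ?_ ?_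
    · intro h hh
      rw [mem_filter, mem_dyZ] at hh
      obtain ⟨⟨_, h2, h3⟩, h4⟩ := hh
      have h4' : h ≤ 0 := not_lt.1 h4
      have h5 : (((-h).toNat : ℕ) : ℝ) = |(h : ℝ)| := by
        rw [abs_of_nonpos (by exact_mod_cast h4')]
        exact_mod_cast Int.toNat_of_nonneg (by omega : 0 ≤ -h)
      rw [mem_dyN, h5]
      exact ⟨h2, h3⟩
    · intro h hh
      have := hne h hh
      rw [mem_dyN] at hh
      rw [mem_filter, mem_dyZ]
      simp only [Int.cast_neg, Int.cast_natCast, abs_neg, Nat.abs_cast]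
      exact ⟨⟨by omega, hh⟩, by omega⟩
    · intro h hh
      have := not_lt.1 (mem_filter.1 hh).2
      omega
    · intro h _
      simp
    · intro h hh
      have := not_lt.1 (mem_filter.1 hh).2
      congr 1
      omega

/-- The sum over `l` and over both signs of `h` is controlled by the trilinear sums `triSum`. -/
lemma norm_quadrilinear_le {γ X M N U V B : ℝ} (hU : 1 ≤ U) (hV : 1 ≤ V)
    (hB : ∀ (β : ℝ) (a d : ℕ → ℂ), (∀ m ∈ dyN M, ‖a m‖ ≤ 1) → (∀ h ∈ dyN V, ‖d h‖ ≤ 1) →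
      ‖triSum γ X M N V β a d‖ ≤ B) (α : ℝ) {am : ℕ → ℂ} {cl dh : ℤ → ℂ}
    (ha : ∀ m ∈ dyN M, ‖am m‖ ≤ 1) (hc : ∀ l ∈ dyZ U, ‖cl l‖ ≤ 1) (hd : ∀ h ∈ dyZ V, ‖dh h‖ ≤ 1) :
    ‖∑ m ∈ dyN M, ∑ n ∈ (dyN N).filter (fun n => X / 2 ≤ ((m * n : ℕ) : ℝ) ∧ ((m * n : ℕ) : ℝ) < X),
        ∑ l ∈ dyZ U, ∑ h ∈ dyZ V, am m * cl l * dh h *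
          e (α * (l : ℝ) * (m : ℝ) * (n : ℝ) + (h : ℝ) * ((m : ℝ) * (n : ℝ)) ^ γ)‖ ≤ 6 * U * B := by
  have hB0 : 0 ≤ B := (norm_nonneg _).trans
    (hB 0 (fun _ => 0) (fun _ => 0) (by simp) (by simp))
  have hmemV : ∀ h ∈ dyN V, (h : ℤ) ∈ dyZ V ∧ -(h : ℤ) ∈ dyZ V := by
    intro h hh
    have h0 := dyN_pos hV hh
    have h1 : h ≠ 0 := by rintro rfl; simp at h0
    rw [mem_dyN] at hh
    rw [mem_dyZ, mem_dyZ]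
    simp only [Int.cast_neg, Int.cast_natCast, abs_neg, Nat.abs_cast]
    exact ⟨⟨by omega, hh⟩, ⟨by omega, hh⟩⟩
  have e1 : ∑ m ∈ dyN M, ∑ n ∈ (dyN N).filter
        (fun n => X / 2 ≤ ((m * n : ℕ) : ℝ) ∧ ((m * n : ℕ) : ℝ) < X),
        ∑ l ∈ dyZ U, ∑ h ∈ dyZ V, am m * cl l * dh h *
          e (α * (l : ℝ) * (m : ℝ) * (n : ℝ) + (h : ℝ) * ((m : ℝ) * (n : ℝ)) ^ γ) =
      ∑ l ∈ dyZ U, cl l * (triSum γ X M N V (α * l) am (fun h => dh h) +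
        (starRingEnd ℂ) (triSum γ X M N V (-(α * l)) (fun m => (starRingEnd ℂ) (am m))
          (fun h => (starRingEnd ℂ) (dh (-(h : ℤ)))))) := by
    rw [sum_congr rfl fun m _ => sum_comm, sum_comm]
    refine sum_congr rfl fun l _ => ?_
    rw [triSum, triSum, map_sum, ← sum_add_distrib, mul_sum]
    refine sum_congr rfl fun m _ => ?_
    rw [map_sum, ← sum_add_distrib, mul_sum]
    refine sum_congr rfl fun n _ => ?_
    rw [sum_dyZ_eq hV, map_sum, mul_add, mul_sum, mul_sum]
    congr 1
    · refine sum_congr rfl fun h _ => ?_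
      push_cast
      ring
    · refine sum_congr rfl fun h _ => ?_
      rw [map_mul, map_mul, Complex.conj_conj, Complex.conj_conj, conj_e,
        show -(-(α * l) * m * n + h * ((m : ℝ) * n) ^ γ) =
          α * l * m * n + ((-(h : ℤ) : ℤ) : ℝ) * ((m : ℝ) * n) ^ γ by push_cast; ring]
      ring
  rw [e1]
  calc _ ≤ ∑ l ∈ dyZ U, 2 * B := by
        refine norm_sum_le_of_le _ fun l hl => ?_
        rw [norm_mul, two_mul]
        refine (mul_le_of_le_one_left (norm_nonneg _) (hc l hl)).trans
          ((norm_add_le _ _).trans (add_le_add ?_ ?_))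
        · exact hB _ _ _ ha fun h hh => hd _ (hmemV h hh).1
        · rw [RCLike.norm_conj]
          refine hB _ _ _ (fun m hm => ?_) fun h hh => ?_
          · rw [RCLike.norm_conj]; exact ha m hm
          · rw [RCLike.norm_conj]; exact hd _ (hmemV h hh).2
    _ = #(dyZ U) * (2 * B) := by rw [sum_const, nsmul_eq_mul]
    _ ≤ 3 * U * (2 * B) := by gcongr; exact card_dyZ_le hU
    _ = _ := by ring

lemma eventually_mul_one_add_log_sq_le (K : ℝ) {η : ℝ} (hη : 0 < η) :
    ∀ᶠ x : ℝ in Filter.atTop, K * (1 + 2 * Real.log x) ^ 2 ≤ x ^ η := by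
  have h1 : (fun x : ℝ => 1 + 2 * Real.log x) =o[Filter.atTop] fun x : ℝ => x ^ (η / 2) := by
    refine Asymptotics.IsLittleO.add ?_
      ((isLittleO_log_rpow_atTop (by positivity)).const_mul_left 2)
    rw [Asymptotics.isLittleO_const_left]
    right
    exact tendsto_norm_atTop_atTop.comp (tendsto_rpow_atTop (by positivity))
  have h2 := ((h1.mul h1).const_mul_left K).bound zero_lt_one
  filter_upwards [h2, Filter.eventually_gt_atTop 0] with x hx hx0
  rw [one_mul, ← Real.rpow_add hx0, add_halves,
    Real.norm_of_nonneg (Real.rpow_nonneg hx0.le η)] at hx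
  rw [sq]
  exact (le_abs_self _).trans hx

/-- Powers of `x` attached to the four lengths, in the range relevant to `S3_final`. -/
structure ExponentData (γ θ η x μ ν u v : ℝ) : Prop where
  lt_gamma : 8 / 9 < γ
  gamma_lt : γ < 1
  theta_pos : 0 < θ
  eta_pos : 0 < η
  eta_le : 10 * η ≤ (9 * γ - 8) / 10 - θ
  eta_le' : 1000 * η ≤ 1
  one_lt : 1 < x
  le_add : 1 - η ≤ μ + ν
  add_le : μ + ν ≤ 1 + η
  mu_le : μ ≤ 15 / 22
  u_nonneg : 0 ≤ u
  u_le : u ≤ θ + η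
  v_nonneg : 0 ≤ v
  v_le : v ≤ 1 - γ + 2 * η

namespace ExponentData

variable {γ θ η x μ ν u v : ℝ}

lemma mul_gamma (h : ExponentData γ θ η x μ ν u v) :
    γ - η ≤ (μ + ν) * γ ∧ (μ + ν) * γ ≤ γ + η := by
  have h1 := h.lt_gamma
  have h2 := h.gamma_lt
  have h3 := h.eta_pos
  constructor
  · nlinarith [h.le_add]
  · nlinarith [h.add_le]

lemma long (h : ExponentData γ θ η x μ ν u v) (hν : 1 / 2 + (2 - γ) / 10 ≤ ν) {K : ℝ} (hK : 0 < K)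
    (hKx : 20 * K ≤ x ^ η) :
    x ^ u * (K * (x ^ v * x ^ μ * (√(x ^ v * (x ^ μ * x ^ ν) ^ γ) +
      x ^ ν / √(x ^ v * (x ^ μ * x ^ ν) ^ γ)))) ≤ x ^ (1 - 2 * η) := by
  have hx0 : 0 < x := by linarith [h.one_lt]
  obtain ⟨g1, g2⟩ := h.mul_gamma
  have hs : √(x ^ v * (x ^ μ * x ^ ν) ^ γ) = x ^ ((v + (μ + ν) * γ) / 2) := by
    rw [← Real.rpow_add hx0, ← Real.rpow_mul hx0.le, ← Real.rpow_add hx0, Real.sqrt_eq_rpow,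
      ← Real.rpow_mul hx0.le, mul_one_div]
  rw [hs]
  have e1 : x ^ u * (x ^ v * x ^ μ * x ^ ((v + (μ + ν) * γ) / 2)) ≤ x ^ (1 - 3 * η) := by
    simp only [← Real.rpow_add hx0]
    refine Real.rpow_le_rpow_of_exponent_le h.one_lt.le ?_
    linarith [h.add_le, h.u_le, h.v_le, h.eta_pos, h.eta_le]
  have e2 : x ^ u * (x ^ v * x ^ μ * (x ^ ν / x ^ ((v + (μ + ν) * γ) / 2))) ≤ x ^ (1 - 3 * η) := by
    simp only [← Real.rpow_add hx0, ← Real.rpow_sub hx0]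
    refine Real.rpow_le_rpow_of_exponent_le h.one_lt.le ?_
    linarith [h.add_le, h.u_le, h.v_le, h.eta_pos, h.eta_le, h.eta_le', h.lt_gamma, h.v_nonneg]
  calc _ = K * (x ^ u * (x ^ v * x ^ μ * x ^ ((v + (μ + ν) * γ) / 2)) +
        x ^ u * (x ^ v * x ^ μ * (x ^ ν / x ^ ((v + (μ + ν) * γ) / 2)))) := by ring
    _ ≤ K * (x ^ (1 - 3 * η) + x ^ (1 - 3 * η)) := by gcongr
    _ ≤ 20 * K * x ^ (1 - 3 * η) := by
        have : 0 < K * x ^ (1 - 3 * η) := by positivity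
        linarith
    _ ≤ x ^ η * x ^ (1 - 3 * η) := by gcongr
    _ = x ^ (1 - 2 * η) := by rw [← Real.rpow_add hx0]; congr 1; ring

lemma short (h : ExponentData γ θ η x μ ν u v) (hν : ν ≤ 4 * ((2 - γ) / 10)) {K : ℝ} (hK : 0 < K)
    (hKx : 20 * K ≤ x ^ η) :
    (x ^ u) ^ 2 * (K * ((x ^ v * x ^ ν) ^ 2 * x ^ μ * (x ^ μ / x ^ (2 * (θ + 1 - γ) + 20 * η) +
      √(x ^ (2 * (θ + 1 - γ) + 20 * η) * (x ^ μ * x ^ ν) ^ γ / x ^ ν) +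
      x ^ μ * √(x ^ ν / (x ^ μ * x ^ ν) ^ γ)))) ≤ (x ^ (1 - 2 * η)) ^ 2 := by
  have hx0 : 0 < x := by linarith [h.one_lt]
  obtain ⟨g1, g2⟩ := h.mul_gamma
  set κ := 2 * (θ + 1 - γ) + 20 * η with hκ
  have hsq : ∀ y : ℝ, (x ^ y) ^ 2 = x ^ (y * 2) := fun y => by
    rw [← Real.rpow_two, ← Real.rpow_mul hx0.le]
  have hsr : ∀ y : ℝ, √(x ^ y) = x ^ (y / 2) := fun y => by
    rw [Real.sqrt_eq_rpow, ← Real.rpow_mul hx0.le, mul_one_div]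
  have e1 : (x ^ u) ^ 2 * ((x ^ v * x ^ ν) ^ 2 * x ^ μ * (x ^ μ / x ^ κ)) ≤ x ^ (2 - 5 * η) := by
    simp only [← Real.rpow_add hx0, ← Real.rpow_sub hx0, hsq]
    refine Real.rpow_le_rpow_of_exponent_le h.one_lt.le ?_
    linarith [h.add_le, h.u_le, h.v_le, h.eta_pos, h.eta_le]
  have e2 : (x ^ u) ^ 2 * ((x ^ v * x ^ ν) ^ 2 * x ^ μ * √(x ^ κ * (x ^ μ * x ^ ν) ^ γ / x ^ ν)) ≤
      x ^ (2 - 5 * η) := by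
    simp only [← Real.rpow_add hx0, ← Real.rpow_sub hx0, ← Real.rpow_mul hx0.le, hsq, hsr]
    refine Real.rpow_le_rpow_of_exponent_le h.one_lt.le ?_
    linarith [h.add_le, h.u_le, h.v_le, h.eta_pos, h.eta_le]
  have e3 : (x ^ u) ^ 2 * ((x ^ v * x ^ ν) ^ 2 * x ^ μ * (x ^ μ * √(x ^ ν / (x ^ μ * x ^ ν) ^ γ))) ≤
      x ^ (2 - 5 * η) := by
    simp only [← Real.rpow_add hx0, ← Real.rpow_sub hx0, ← Real.rpow_mul hx0.le, hsq, hsr]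
    refine Real.rpow_le_rpow_of_exponent_le h.one_lt.le ?_
    linarith [h.add_le, h.u_le, h.v_le, h.eta_pos, h.eta_le, h.lt_gamma]
  calc _ = K * ((x ^ u) ^ 2 * ((x ^ v * x ^ ν) ^ 2 * x ^ μ * (x ^ μ / x ^ κ)) +
        (x ^ u) ^ 2 * ((x ^ v * x ^ ν) ^ 2 * x ^ μ * √(x ^ κ * (x ^ μ * x ^ ν) ^ γ / x ^ ν)) +
        (x ^ u) ^ 2 * ((x ^ v * x ^ ν) ^ 2 * x ^ μ *
          (x ^ μ * √(x ^ ν / (x ^ μ * x ^ ν) ^ γ)))) := by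
        ring
    _ ≤ K * (x ^ (2 - 5 * η) + x ^ (2 - 5 * η) + x ^ (2 - 5 * η)) := by gcongr
    _ ≤ 20 * K * x ^ (2 - 5 * η) := by
        have : 0 < K * x ^ (2 - 5 * η) := by positivity
        linarith
    _ ≤ x ^ η * x ^ (2 - 5 * η) := by gcongr
    _ = (x ^ (1 - 2 * η)) ^ 2 := by rw [← Real.rpow_add hx0, hsq]; congr 1; ring

lemma medium (h : ExponentData γ θ η x μ ν u v) (hν : 4 * ((2 - γ) / 10) ≤ ν)
    (hν' : ν ≤ 1 / 2 + (2 - γ) / 10) {K Q : ℝ} (hK : 0 < K) (hKx : 20 * K ≤ x ^ η)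
    (hQ : x ^ (2 * (θ + 1 - γ) + 20 * η) ≤ Q) (hQ' : Q ≤ x ^ (2 * (θ + 1 - γ) + 21 * η)) :
    (x ^ u) ^ 2 * (K * ((x ^ v) ^ 2 * x ^ μ * (x ^ μ * (x ^ ν) ^ 2 / Q +
      Q * (x ^ v * (x ^ μ * x ^ ν) ^ γ) + (x ^ ν) ^ 2 + x ^ μ * x ^ ν +
      x ^ μ * (x ^ ν) ^ 3 / (x ^ v * (x ^ μ * x ^ ν) ^ γ)))) ≤ (x ^ (1 - 2 * η)) ^ 2 := by
  have hx0 : 0 < x := by linarith [h.one_lt]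
  obtain ⟨g1, g2⟩ := h.mul_gamma
  set κ := 2 * (θ + 1 - γ) + 20 * η with hκ
  set κ' := 2 * (θ + 1 - γ) + 21 * η with hκ'
  have hsq : ∀ y : ℝ, (x ^ y) ^ 2 = x ^ (y * 2) := fun y => by
    rw [← Real.rpow_two, ← Real.rpow_mul hx0.le]
  have hcb : ∀ y : ℝ, (x ^ y) ^ 3 = x ^ (y * 3) := fun y => by
    rw [← Real.rpow_natCast, ← Real.rpow_mul hx0.le]; norm_num
  have e1 : (x ^ u) ^ 2 * ((x ^ v) ^ 2 * x ^ μ * (x ^ μ * (x ^ ν) ^ 2 / x ^ κ)) ≤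
      x ^ (2 - 5 * η) := by
    simp only [← Real.rpow_add hx0, ← Real.rpow_sub hx0, hsq]
    refine Real.rpow_le_rpow_of_exponent_le h.one_lt.le ?_
    linarith [h.add_le, h.u_le, h.v_le, h.eta_pos, h.eta_le]
  have e2 : (x ^ u) ^ 2 * ((x ^ v) ^ 2 * x ^ μ * (x ^ κ' * (x ^ v * (x ^ μ * x ^ ν) ^ γ))) ≤
      x ^ (2 - 5 * η) := by
    simp only [← Real.rpow_add hx0, ← Real.rpow_mul hx0.le, hsq]
    refine Real.rpow_le_rpow_of_exponent_le h.one_lt.le ?_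
    linarith [h.add_le, h.u_le, h.v_le, h.eta_pos, h.eta_le]
  have e3 : (x ^ u) ^ 2 * ((x ^ v) ^ 2 * x ^ μ * (x ^ ν) ^ 2) ≤ x ^ (2 - 5 * η) := by
    simp only [← Real.rpow_add hx0, hsq]
    refine Real.rpow_le_rpow_of_exponent_le h.one_lt.le ?_
    linarith [h.add_le, h.u_le, h.v_le, h.eta_pos, h.eta_le, h.eta_le', h.lt_gamma]
  have e4 : (x ^ u) ^ 2 * ((x ^ v) ^ 2 * x ^ μ * (x ^ μ * x ^ ν)) ≤ x ^ (2 - 5 * η) := by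
    simp only [← Real.rpow_add hx0, hsq]
    refine Real.rpow_le_rpow_of_exponent_le h.one_lt.le ?_
    linarith [h.add_le, h.u_le, h.v_le, h.eta_pos, h.eta_le, h.eta_le', h.lt_gamma, h.mu_le]
  have e5 : (x ^ u) ^ 2 * ((x ^ v) ^ 2 * x ^ μ *
      (x ^ μ * (x ^ ν) ^ 3 / (x ^ v * (x ^ μ * x ^ ν) ^ γ))) ≤ x ^ (2 - 5 * η) := by
    simp only [← Real.rpow_add hx0, ← Real.rpow_sub hx0, ← Real.rpow_mul hx0.le, hsq, hcb]
    refine Real.rpow_le_rpow_of_exponent_le h.one_lt.le ?_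
    linarith [h.add_le, h.u_le, h.v_le, h.eta_pos, h.eta_le, h.eta_le', h.lt_gamma, h.v_nonneg]
  calc _ ≤ (x ^ u) ^ 2 * (K * ((x ^ v) ^ 2 * x ^ μ * (x ^ μ * (x ^ ν) ^ 2 / x ^ κ +
        x ^ κ' * (x ^ v * (x ^ μ * x ^ ν) ^ γ) + (x ^ ν) ^ 2 + x ^ μ * x ^ ν +
        x ^ μ * (x ^ ν) ^ 3 / (x ^ v * (x ^ μ * x ^ ν) ^ γ)))) := by gcongr
    _ = K * ((x ^ u) ^ 2 * ((x ^ v) ^ 2 * x ^ μ * (x ^ μ * (x ^ ν) ^ 2 / x ^ κ)) +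
        (x ^ u) ^ 2 * ((x ^ v) ^ 2 * x ^ μ * (x ^ κ' * (x ^ v * (x ^ μ * x ^ ν) ^ γ))) +
        (x ^ u) ^ 2 * ((x ^ v) ^ 2 * x ^ μ * (x ^ ν) ^ 2) +
        (x ^ u) ^ 2 * ((x ^ v) ^ 2 * x ^ μ * (x ^ μ * x ^ ν)) +
        (x ^ u) ^ 2 * ((x ^ v) ^ 2 * x ^ μ *
          (x ^ μ * (x ^ ν) ^ 3 / (x ^ v * (x ^ μ * x ^ ν) ^ γ)))) := by
        ring
    _ ≤ K * (x ^ (2 - 5 * η) + x ^ (2 - 5 * η) + x ^ (2 - 5 * η) + x ^ (2 - 5 * η) +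
        x ^ (2 - 5 * η)) := by gcongr
    _ ≤ 20 * K * x ^ (2 - 5 * η) := by
        have : 0 < K * x ^ (2 - 5 * η) := by positivity
        linarith
    _ ≤ x ^ η * x ^ (2 - 5 * η) := by gcongr
    _ = (x ^ (1 - 2 * η)) ^ 2 := by rw [← Real.rpow_add hx0, hsq]; congr 1; ring

end ExponentData

lemma exists_mul_norm_triSum_le {γ : ℝ} (h0 : 0 < γ) (h1 : γ < 1) :
    ∃ C, 0 < C ∧ ∀ (θ η x μ ν u v β : ℝ) (a d : ℕ → ℂ), ExponentData γ θ η x μ ν u v →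
      0 ≤ μ → 0 ≤ ν → C * (1 + 2 * Real.log x) ^ 2 ≤ x ^ η →
      (∀ m ∈ dyN (x ^ μ), ‖a m‖ ≤ 1) → (∀ h ∈ dyN (x ^ v), ‖d h‖ ≤ 1) →
      x ^ u * ‖triSum γ x (x ^ μ) (x ^ ν) (x ^ v) β a d‖ ≤ x ^ (1 - 2 * η) := by
  obtain ⟨C₀, hC₀, long⟩ := exists_norm_triSum_le_of_long h0 h1
  obtain ⟨C₁, hC₁, short⟩ := exists_norm_triSum_sq_le_of_spacing h0 h1
  obtain ⟨C₂, hC₂, medium⟩ := exists_norm_triSum_sq_le_of_completion h0 h1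
  refine ⟨20 * (1 + C₀ + C₁ + C₂), by positivity, ?_⟩
  intro θ η x μ ν u v β a d h hμ hν hx ha hd
  have hx0 : 0 < x := by linarith [h.one_lt]
  have hlog : 0 < Real.log x := Real.log_pos h.one_lt
  have hlogsq : 1 ≤ (1 + 2 * Real.log x) ^ 2 := one_le_pow₀ (by linarith)
  have hconst : 20 * (1 + C₀ + C₁ + C₂) ≤ x ^ η :=
    (le_mul_of_one_le_right (by positivity) hlogsq).trans hx
  have hM1 : 1 ≤ x ^ μ := Real.one_le_rpow h.one_lt.le hμ
  have hN1 : 1 ≤ x ^ ν := Real.one_le_rpow h.one_lt.le hν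
  have hV1 : 1 ≤ x ^ v := Real.one_le_rpow h.one_lt.le h.v_nonneg
  have hlogN : Real.log (x ^ ν) = ν * Real.log x := Real.log_rpow hx0 ν
  have hlogV : Real.log (x ^ v) = v * Real.log x := Real.log_rpow hx0 v
  have hν2 : ν ≤ 2 := by linarith [h.add_le, h.eta_le']
  have hv2 : v ≤ 2 := by linarith [h.v_le, h.eta_le', h.lt_gamma]
  have hN2 : 1 + Real.log (x ^ ν) ≤ 1 + 2 * Real.log x := by
    rw [hlogN]
    gcongr
  have hV2 : 1 + Real.log (x ^ v) ≤ 1 + 2 * Real.log x := by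
    rw [hlogV]
    gcongr
  have hN0 : 0 < 1 + Real.log (x ^ ν) := by
    rw [hlogN]
    positivity
  have hV0 : 0 < 1 + Real.log (x ^ v) := by
    have := h.v_nonneg
    rw [hlogV]
    positivity
  set κ := 2 * (θ + 1 - γ) + 20 * η with hκ
  have hκ0 : 0 ≤ κ := by linarith [h.theta_pos, h.eta_pos]
  have hκ2 : κ ≤ 2 * ((2 - γ) / 10) := by linarith [h.eta_le]
  have hQ1 : 1 ≤ x ^ κ := Real.one_le_rpow h.one_lt.le hκ0
  have of_sq : (x ^ u) ^ 2 * ‖triSum γ x (x ^ μ) (x ^ ν) (x ^ v) β a d‖ ^ 2 ≤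
      (x ^ (1 - 2 * η)) ^ 2 →
      x ^ u * ‖triSum γ x (x ^ μ) (x ^ ν) (x ^ v) β a d‖ ≤ x ^ (1 - 2 * η) := fun h' =>
    (sq_le_sq₀ (by positivity) (by positivity)).1 (by rwa [mul_pow])
  rcases le_total (1 / 2 + (2 - γ) / 10) ν with hlong | hlong
  · refine le_trans ?_ (h.long hlong hC₀ (by linarith))
    gcongr
    exact long x (x ^ μ) (x ^ ν) (x ^ v) β a d hM1 hN1 hV1 ha hd
  rcases le_total ν (4 * ((2 - γ) / 10)) with hshort | hshort
  · refine of_sq (le_trans ?_ (h.short hshort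
      (K := C₁ * ((1 + Real.log (x ^ v)) * (1 + Real.log (x ^ ν)))) (by positivity) ?_))
    · gcongr
      refine short x (x ^ μ) (x ^ ν) (x ^ v) β (x ^ κ) a d hM1 hN1 hV1 hQ1 ?_ ha hd
      rw [← Real.rpow_add hx0]
      refine Real.rpow_le_rpow_of_exponent_le h.one_lt.le ?_
      linarith [h.le_add, h.mu_le, h.v_nonneg, h.lt_gamma, h.eta_le']
    · refine le_trans ?_ hx
      rw [sq, ← mul_assoc]
      gcongr
      linarith
  · have hQN : x ^ (2 * (θ + 1 - γ) + 21 * η) ≤ x ^ ν :=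
      Real.rpow_le_rpow_of_exponent_le h.one_lt.le (by linarith [h.eta_le', h.gamma_lt])
    have hQ : (⌈x ^ κ⌉₊ : ℝ) ≤ x ^ (2 * (θ + 1 - γ) + 21 * η) := by
      calc (⌈x ^ κ⌉₊ : ℝ) ≤ x ^ κ + 1 := (Nat.ceil_lt_add_one (by positivity)).le
        _ ≤ x ^ η * x ^ κ := by nlinarith
        _ = x ^ (2 * (θ + 1 - γ) + 21 * η) := by
          rw [← Real.rpow_add hx0, hκ]
          ring_nf
    refine of_sq (le_trans ?_ (h.medium hshort hlong
      (K := C₂ * (1 + Real.log (x ^ ν)) ^ 2) (by positivity) ?_ (Nat.le_ceil _) hQ))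
    · gcongr
      exact medium x (x ^ μ) (x ^ ν) (x ^ v) β ⌈x ^ κ⌉₊ a d hM1 hN1 hV1
        (Nat.ceil_pos.2 (by positivity)) (hQ.trans hQN) ha hd
    · refine le_trans ?_ hx
      rw [← mul_assoc]
      gcongr
      linarith

lemma triSum_eq_zero {γ X M N V β : ℝ} {a d : ℕ → ℂ} (hM : 1 ≤ M)
    (h : M * N ≤ X / 2 ∨ 4 * X ≤ M * N) : triSum γ X M N V β a d = 0 := by
  refine sum_eq_zero fun m hm => ?_
  rw [filter_eq_empty_iff.2, sum_empty]
  rintro n hn ⟨h1, h2⟩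
  obtain ⟨m1, m2⟩ := mem_dyN.1 hm
  obtain ⟨n1, n2⟩ := mem_dyN.1 hn
  push_cast at h1 h2
  rcases h with h | h
  · nlinarith
  · nlinarith

theorem S3_final (c γ θ : ℝ) (hc1 : 1 < c) (hc2 : c < 9/8) (hγ : γ = 1/c)
    (hθ1 : 0 < θ) (hθ2 : θ < (9*γ - 8)/10) :
    ∃ η > (0:ℝ), ∃ C > (0:ℝ), ∃ X₀ > (0:ℝ), ∀ X : ℕ, X₀ ≤ (X:ℝ) → ∀ α : ℝ,
    ∀ M N U V : ℝ, 1 ≤ M → 1 ≤ N → 1 ≤ U → 1 ≤ V →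
    M ≤ (X:ℝ)^((15:ℝ)/22) → U ≤ (⌊(X:ℝ)^(θ+η)⌋₊ : ℝ) → V ≤ (⌊10 * (X:ℝ)^(1-γ+η) / γ⌋₊ : ℝ) →
    ∀ am : ℕ → ℂ, ∀ cl dh : ℤ → ℂ,
    (∀ m ∈ dyN M, ‖am m‖ ≤ 1) →
    (∀ l ∈ dyZ U, ‖cl l‖ ≤ 1) → (∀ h ∈ dyZ V, ‖dh h‖ ≤ 1) →
    ‖∑ m ∈ dyN M, ∑ n ∈ (dyN N).filter (fun n => (X:ℝ)/2 ≤ ((m*n:ℕ):ℝ) ∧ ((m*n:ℕ):ℝ) < (X:ℝ)),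
        ∑ l ∈ dyZ U, ∑ h ∈ dyZ V, am m * cl l * dh h *
          e (α * (l:ℝ) * (m:ℝ) * (n:ℝ) + (h:ℝ) * ((m:ℝ)*(n:ℝ))^γ)‖ ≤ C * (X:ℝ)^(1-2*η) := by
  have hγ1 : 8 / 9 < γ := by
    rw [hγ, lt_div_iff₀ (by linarith)]
    linarith
  have hγ2 : γ < 1 := by
    rw [hγ, div_lt_one (by linarith)]
    exact hc1
  obtain ⟨K, hK, main⟩ := exists_mul_norm_triSum_le (γ := γ) (by linarith) hγ2
  set η := min (((9 * γ - 8) / 10 - θ) / 10) (1 / 1000) with hη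
  have hη0 : 0 < η := lt_min (by linarith) (by norm_num)
  have hη1 : η ≤ ((9 * γ - 8) / 10 - θ) / 10 := min_le_left _ _
  have hη2 : η ≤ 1 / 1000 := min_le_right _ _
  obtain ⟨X₀, hX₀⟩ := Filter.eventually_atTop.1 (eventually_mul_one_add_log_sq_le (K + 20) hη0)
  refine ⟨η, hη0, 6, by norm_num, max X₀ 2, by positivity, ?_⟩
  intro X hX α M N U V hM hN hU hV hMX hUX hVX am cl dh ham hcl hdh
  set x : ℝ := (X : ℝ) with hx
  have hx1 : 1 < x := by linarith [le_max_right X₀ 2]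
  have hx0 : 0 < x := by linarith
  have hlog : 0 < Real.log x := Real.log_pos hx1
  have hlogsq : 1 ≤ (1 + 2 * Real.log x) ^ 2 := one_le_pow₀ (by linarith)
  have hxK := hX₀ x ((le_max_left _ _).trans hX)
  have hx20 : 20 ≤ x ^ η := by nlinarith
  suffices hB : ∀ (β : ℝ) (a d : ℕ → ℂ), (∀ m ∈ dyN M, ‖a m‖ ≤ 1) → (∀ h ∈ dyN V, ‖d h‖ ≤ 1) →
      ‖triSum γ x M N V β a d‖ ≤ x ^ (1 - 2 * η) / U by
    refine (norm_quadrilinear_le hU hV hB α ham hcl hdh).trans_eq ?_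
    field_simp
  intro β a d ha hd
  by_cases hMN : M * N ≤ x / 2 ∨ 4 * x ≤ M * N
  · rw [triSum_eq_zero hM hMN, norm_zero]
    positivity
  push Not at hMN
  rw [le_div_iff₀' (by linarith)]
  have exp_log : ∀ {y : ℝ}, 1 ≤ y → x ^ Real.logb x y = y := fun hy =>
    Real.rpow_logb hx0 hx1.ne' (by linarith)
  have log_nonneg : ∀ {y : ℝ}, 1 ≤ y → 0 ≤ Real.logb x y := fun hy => Real.logb_nonneg hx1 hy
  have log_le : ∀ {y t : ℝ}, 1 ≤ y → y ≤ x ^ t → Real.logb x y ≤ t := fun hy ht =>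
    (Real.logb_le_iff_le_rpow hx1 (by linarith)).2 ht
  have hadd : Real.logb x M + Real.logb x N = Real.logb x (M * N) :=
    (Real.logb_mul (by positivity) (by positivity)).symm
  have data : ExponentData γ θ η x (Real.logb x M) (Real.logb x N) (Real.logb x U)
      (Real.logb x V) :=
    { lt_gamma := hγ1
      gamma_lt := hγ2
      theta_pos := hθ1
      eta_pos := hη0
      eta_le := by linarith
      eta_le' := by linarith
      one_lt := hx1
      le_add := by
        rw [hadd, Real.le_logb_iff_rpow_le hx1 (by positivity), Real.rpow_sub hx0, Real.rpow_one,
          div_le_iff₀ (by positivity)]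
        nlinarith
      add_le := by
        rw [hadd]
        refine log_le (one_le_mul_of_one_le_of_one_le hM hN) ?_
        rw [Real.rpow_add hx0, Real.rpow_one]
        nlinarith
      mu_le := log_le hM hMX
      u_nonneg := log_nonneg hU
      u_le := log_le hU (hUX.trans (Nat.floor_le (by positivity)))
      v_nonneg := log_nonneg hV
      v_le := by
        refine log_le hV (hVX.trans ((Nat.floor_le (by positivity)).trans ?_))
        have : x ^ (1 - γ + 2 * η) = x ^ η * x ^ (1 - γ + η) := by
          rw [← Real.rpow_add hx0]
          ring_nf
        rw [this, div_le_iff₀ (by linarith)]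
        have : 0 < x ^ (1 - γ + η) := by positivity
        nlinarith [mul_le_mul_of_nonneg_right hx20 this.le] }
  have := main θ η x _ _ _ _ β a d data (log_nonneg hM) (log_nonneg hN)
    (le_trans (by gcongr; linarith) hxK)
  rw [exp_log hM, exp_log hN, exp_log hU, exp_log hV] at this
  exact this ha hd
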